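/- arXiv:2509.04314 — 7 statements merged into one kernel-verified Lean document; each statement's English description precedes it below -/
import Mathlib

section
/- Let n ≥ 6. If A is a homogeneous polynomial of degree 2 with real coefficients in the variables x_1,…,x_n such that A has at least one negative coefficient while A·S_n is coefficientwise nonnegative, then |supp(A·S_n)| ≥ (n² + n)/2 − 6. -/
open MvPolynomial

namespace QuadraticSupport

open Finset

set_option linter.unusedSectionVars false

variable {ι : Type*} [DecidableEq ι]

/-- The exponent vector of the cubic monomial `x_i x_j x_k`. -/
noncomputable def cubic (i j k : ι) : ι →₀ ℕ :=
  Finsupp.single i 1 + Finsupp.single j 1 + Finsupp.single k 1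

lemma cubic_apply (i j k x : ι) :
    cubic i j k x =
      (if i = x then 1 else 0) + (if j = x then 1 else 0) + (if k = x then 1 else 0) := by
  simp [cubic, Finsupp.single_apply]

/-- `E i j` is the coefficient of `x_i x_j` in a quadratic form whose product with the sum of the
variables has nonnegative coefficients; `T` contains the support of this product, and `E a b` is
negative and least among the coefficients. -/
structure IsMinimalEdge (E : ι → ι → ℝ) (T : Finset (ι →₀ ℕ)) (a b : ι) : Prop where
  symm : ∀ i j, E i j = E j i
  cube_nonneg : ∀ i, 0 ≤ E i i
  sq_nonneg : ∀ i j, i ≠ j → 0 ≤ E i i + E i j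
  triple_nonneg : ∀ i j k, i ≠ j → i ≠ k → j ≠ k → 0 ≤ E i j + E i k + E j k
  cube_mem : ∀ i, 0 < E i i → cubic i i i ∈ T
  sq_mem : ∀ i j, i ≠ j → 0 < E i i + E i j → cubic i i j ∈ T
  triple_mem : ∀ i j k, i ≠ j → i ≠ k → j ≠ k → 0 < E i j + E i k + E j k → cubic i j k ∈ T
  neg : E a b < 0
  least : ∀ i j, E a b ≤ E i j

/-- The monomials in `T` in the variables `a, b` and those of `W`. -/
def restrict (T : Finset (ι →₀ ℕ)) (a b : ι) (W : Finset ι) : Finset (ι →₀ ℕ) :=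
  T.filter fun m => m.support ⊆ insert a (insert b W)

/-- The monomials in `T` in the variables `a, b, k, l` that are divisible by both `x_k`
and `x_l`. -/
def fiber (T : Finset (ι →₀ ℕ)) (a b k l : ι) : Finset (ι →₀ ℕ) :=
  T.filter fun m => m k ≠ 0 ∧ m l ≠ 0 ∧ ∀ i ∈ m.support, i = a ∨ i = b ∨ i = k ∨ i = l

lemma mem_fiber {T : Finset (ι →₀ ℕ)} {a b k l : ι} {m : ι →₀ ℕ} :
    m ∈ fiber T a b k l ↔
      m ∈ T ∧ m k ≠ 0 ∧ m l ≠ 0 ∧ ∀ i, m i ≠ 0 → i = a ∨ i = b ∨ i = k ∨ i = l := by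
  simp [fiber]

lemma mem_restrict {T : Finset (ι →₀ ℕ)} {a b : ι} {W : Finset ι} {m : ι →₀ ℕ} :
    m ∈ restrict T a b W ↔ m ∈ T ∧ ∀ i, m i ≠ 0 → i = a ∨ i = b ∨ i ∈ W := by
  simp [restrict, subset_iff]

lemma card_restrict_erase_add_le (T : Finset (ι →₀ ℕ)) {a b : ι} {W : Finset ι} (ha : a ∉ W)
    (hb : b ∉ W) {k : ι} (hk : k ∈ W) :
    (restrict T a b (W.erase k)).card + ∑ l ∈ W, (fiber T a b k l).card ≤
      (restrict T a b W).card := by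
  rw [← card_biUnion, ← card_union_of_disjoint]
  · refine card_le_card fun m hm => ?_
    simp only [mem_union, mem_biUnion, mem_fiber, mem_restrict, mem_erase] at hm ⊢
    grind
  · rw [disjoint_left]
    intro m hm
    simp only [mem_biUnion, mem_fiber, mem_restrict, mem_erase] at hm ⊢
    grind
  · intro l hl l' hl' hne
    refine disjoint_left.2 fun m hm => ?_
    simp only [mem_fiber] at hm ⊢
    grind

namespace IsMinimalEdge

variable {E : ι → ι → ℝ} {T : Finset (ι →₀ ℕ)} {a b : ι}

lemma ne (h : IsMinimalEdge E T a b) : a ≠ b := by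
  rintro rfl
  linarith [h.neg, h.cube_nonneg a]

lemma cube_mem_fiber (h : IsMinimalEdge E T a b) {k : ι} (hp : 0 < E k k) :
    cubic k k k ∈ fiber T a b k k := by
  simp only [mem_fiber, cubic_apply]
  exact ⟨h.cube_mem k hp, by grind⟩

lemma sq_left_mem_fiber (h : IsMinimalEdge E T a b) {c k : ι} (hc : c = a ∨ c = b) (hck : c ≠ k)
    (hp : 0 < E c c + E c k) : cubic c c k ∈ fiber T a b k k := by
  simp only [mem_fiber, cubic_apply]
  exact ⟨h.sq_mem c k hck hp, by grind⟩

lemma sq_right_mem_fiber (h : IsMinimalEdge E T a b) {c k : ι} (hc : c = a ∨ c = b) (hck : c ≠ k)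
    (hp : 0 < E k k + E c k) : cubic k k c ∈ fiber T a b k k := by
  simp only [mem_fiber, cubic_apply]
  exact ⟨h.sq_mem k c hck.symm (by rwa [h.symm k c]), by grind⟩

lemma sq_mem_fiber (h : IsMinimalEdge E T a b) {k l : ι} (hkl : k ≠ l)
    (hp : 0 < E k k + E k l) : cubic k k l ∈ fiber T a b k l := by
  simp only [mem_fiber, cubic_apply]
  exact ⟨h.sq_mem k l hkl hp, by grind⟩

lemma sq_mem_fiber_swap (h : IsMinimalEdge E T a b) {k l : ι} (hkl : k ≠ l)
    (hp : 0 < E l l + E k l) : cubic l l k ∈ fiber T a b k l := by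
  simp only [mem_fiber, cubic_apply]
  exact ⟨h.sq_mem l k hkl.symm (by rwa [h.symm l k]), by grind⟩

lemma triple_mem_fiber (h : IsMinimalEdge E T a b) {c k l : ι} (hc : c = a ∨ c = b)
    (hck : c ≠ k) (hcl : c ≠ l) (hkl : k ≠ l) (hp : 0 < E c k + E c l + E k l) :
    cubic c k l ∈ fiber T a b k l := by
  simp only [mem_fiber, cubic_apply]
  exact ⟨h.triple_mem c k l hck hcl hkl hp, by grind⟩

lemma cubic_ne_of_apply {i j k i' j' k' : ι} (x : ι)
    (hx : cubic i j k x ≠ cubic i' j' k' x) : cubic i j k ≠ cubic i' j' k' :=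
  fun he => hx (by rw [he])

lemma three_le_card_fiber_self (h : IsMinimalEdge E T a b) {k : ι} (hka : a ≠ k) (hkb : b ≠ k) :
    3 ≤ (fiber T a b k k).card := by
  have hab := h.ne
  have h0 := h.neg
  have h1 := h.triple_nonneg a b k hab hka hkb
  have h2 := h.sq_nonneg a b hab
  have h3 := h.sq_nonneg b a hab.symm
  have h4 := h.sq_nonneg k a hka.symm
  have h5 := h.sq_nonneg k b hkb.symm
  have h6 := h.cube_nonneg k
  rw [h.symm b a] at h3
  rw [h.symm k a] at h4
  rw [h.symm k b] at h5
  rw [Nat.succ_le_iff, two_lt_card]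
  rcases lt_trichotomy (E b k) 0 with hb | hb | hb
  · refine ⟨_, h.cube_mem_fiber (by linarith), _, h.sq_left_mem_fiber (Or.inl rfl) hka
      (by linarith), _, h.sq_right_mem_fiber (Or.inl rfl) hka (by linarith), ?_, ?_, ?_⟩ <;>
    · apply cubic_ne_of_apply k
      simp [cubic_apply, hka]
  · refine ⟨_, h.sq_left_mem_fiber (Or.inr rfl) hkb (by linarith),
      _, h.sq_left_mem_fiber (Or.inl rfl) hka
      (by linarith), _, h.sq_right_mem_fiber (Or.inl rfl) hka (by linarith), ?_, ?_, ?_⟩ <;>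
    · apply cubic_ne_of_apply a
      simp [cubic_apply, hka.symm, hab.symm]
  · rcases lt_trichotomy (E a k) 0 with ha | ha | ha
    · refine ⟨_, h.cube_mem_fiber (by linarith), _, h.sq_left_mem_fiber (Or.inr rfl) hkb
        (by linarith), _, h.sq_right_mem_fiber (Or.inr rfl) hkb (by linarith), ?_, ?_, ?_⟩ <;>
      · apply cubic_ne_of_apply k
        simp [cubic_apply, hkb]
    · refine ⟨_, h.sq_left_mem_fiber (Or.inl rfl) hka (by linarith),
        _, h.sq_left_mem_fiber (Or.inr rfl) hkb
        (by linarith), _, h.sq_right_mem_fiber (Or.inr rfl) hkb (by linarith), ?_, ?_, ?_⟩ <;>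
      · apply cubic_ne_of_apply b
        simp [cubic_apply, hkb.symm, hab]
    · refine ⟨_, h.sq_left_mem_fiber (Or.inl rfl) hka (by linarith),
        _, h.sq_left_mem_fiber (Or.inr rfl) hkb
        (by linarith), _, h.sq_right_mem_fiber (Or.inr rfl) hkb (by linarith), ?_, ?_, ?_⟩ <;>
      · apply cubic_ne_of_apply b
        simp [cubic_apply, hkb.symm, hab]

/-- Neither `x_a x_k x_l` nor `x_b x_k x_l` occurs in the product. -/
def IsBad (E : ι → ι → ℝ) (a b k l : ι) : Prop :=
  k ≠ l ∧ E a k + E a l + E k l = 0 ∧ E b k + E b l + E k l = 0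

lemma isBad_comm (h : IsMinimalEdge E T a b) {k l : ι} :
    IsBad E a b k l ↔ IsBad E a b l k := by
  unfold IsBad
  rw [h.symm k l, ne_comm, add_comm (E a k), add_comm (E b k)]

lemma eq_of_isBad (h : IsMinimalEdge E T a b) {k l : ι} (hka : a ≠ k) (hkb : b ≠ k)
    (hla : a ≠ l) (hlb : b ≠ l) (hbad : IsBad E a b k l) :
    E k l = E a b ∧ E a k + E b k = -E a b := by
  obtain ⟨-, h1, h2⟩ := hbad
  have h3 := h.triple_nonneg a b k h.ne hka hkb
  have h4 := h.triple_nonneg a b l h.ne hla hlb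
  have h5 := h.least k l
  constructor <;> linarith

lemma one_le_card_fiber (h : IsMinimalEdge E T a b) {k l : ι} (hka : a ≠ k) (hkb : b ≠ k)
    (hla : a ≠ l) (hlb : b ≠ l) (hkl : k ≠ l) (hbad : ¬ IsBad E a b k l) :
    1 ≤ (fiber T a b k l).card := by
  rw [Nat.succ_le_iff, card_pos]
  have h1 := h.triple_nonneg a k l hka hla hkl
  have h2 := h.triple_nonneg b k l hkb hlb hkl
  rcases h1.lt_or_eq with h1 | h1
  · exact ⟨_, h.triple_mem_fiber (Or.inl rfl) hka hla hkl h1⟩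
  · rcases h2.lt_or_eq with h2 | h2
    · exact ⟨_, h.triple_mem_fiber (Or.inr rfl) hkb hlb hkl h2⟩
    · exact absurd ⟨hkl, h1.symm, h2.symm⟩ hbad

lemma three_le_card_fiber (h : IsMinimalEdge E T a b) {k l : ι} (hka : a ≠ k) (hkb : b ≠ k)
    (hla : a ≠ l) (hlb : b ≠ l) (hkl : k ≠ l) (hpos : 0 < E k l) :
    3 ≤ (fiber T a b k l).card := by
  have h1 := h.triple_nonneg a b k h.ne hka hkb
  have h2 := h.triple_nonneg a b l h.ne hla hlb
  have h3 := h.neg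
  obtain ⟨c, hc, hck, hcl, hp⟩ : ∃ c, (c = a ∨ c = b) ∧ c ≠ k ∧ c ≠ l ∧
      0 < E c k + E c l + E k l := by
    by_cases hp : 0 < E a k + E a l + E k l
    · exact ⟨a, Or.inl rfl, hka, hla, hp⟩
    · exact ⟨b, Or.inr rfl, hkb, hlb, by linarith⟩
  rw [Nat.succ_le_iff, two_lt_card]
  refine ⟨_, h.triple_mem_fiber hc hck hcl hkl hp,
    _, h.sq_mem_fiber hkl (by linarith [h.cube_nonneg k]),
    _, h.sq_mem_fiber_swap hkl (by linarith [h.cube_nonneg l]), ?_, ?_, ?_⟩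
  · apply cubic_ne_of_apply c
    simp [cubic_apply, hck.symm, hcl.symm]
  · apply cubic_ne_of_apply c
    simp [cubic_apply, hck.symm, hcl.symm]
  · apply cubic_ne_of_apply k
    simp [cubic_apply, hkl.symm]

lemma four_le_card_fiber_self (h : IsMinimalEdge E T a b) {k : ι} (hka : a ≠ k) (hkb : b ≠ k)
    (hd : -E a b ≤ E k k) (ha : E a b < E a k) (hb : E a b < E b k) :
    4 ≤ (fiber T a b k k).card := by
  have hab := h.ne
  have h2 := h.sq_nonneg a b hab
  have h3 := h.sq_nonneg b a hab.symm
  rw [h.symm b a] at h3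
  have hsub : ({cubic a a k, cubic k k a, cubic b b k, cubic k k b} : Finset (ι →₀ ℕ)) ⊆
      fiber T a b k k := by
    simp only [insert_subset_iff, singleton_subset_iff]
    exact ⟨h.sq_left_mem_fiber (Or.inl rfl) hka (by linarith),
      h.sq_right_mem_fiber (Or.inl rfl) hka (by linarith),
      h.sq_left_mem_fiber (Or.inr rfl) hkb (by linarith),
      h.sq_right_mem_fiber (Or.inr rfl) hkb (by linarith)⟩
  refine le_trans (le_of_eq ?_) (card_le_card hsub)
  rw [card_insert_of_notMem, card_insert_of_notMem, card_insert_of_notMem, card_singleton]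
  · rw [mem_singleton]
    apply cubic_ne_of_apply b
    simp [cubic_apply, hkb.symm]
  · simp only [mem_insert, mem_singleton, not_or]
    constructor <;>
    · apply cubic_ne_of_apply a
      simp [cubic_apply, hka.symm, hab.symm]
  · simp only [mem_insert, mem_singleton, not_or]
    refine ⟨?_, ?_, ?_⟩ <;>
    · apply cubic_ne_of_apply a
      simp [cubic_apply, hka.symm, hab.symm]

lemma two_le_card_fiber (h : IsMinimalEdge E T a b) {k l : ι} (hka : a ≠ k) (hkb : b ≠ k)
    (hla : a ≠ l) (hlb : b ≠ l) (hkl : k ≠ l) (hd : -E a b ≤ E k k) (hlt : E a b < E k l)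
    (hext : E a k = -2 * E a b ∨ E b k = -2 * E a b) :
    2 ≤ (fiber T a b k l).card := by
  obtain ⟨c, hc, hck, hcl, hp⟩ : ∃ c, (c = a ∨ c = b) ∧ c ≠ k ∧ c ≠ l ∧
      0 < E c k + E c l + E k l := by
    rcases hext with hp | hp
    · exact ⟨a, Or.inl rfl, hka, hla, by linarith [h.least a l]⟩
    · exact ⟨b, Or.inr rfl, hkb, hlb, by linarith [h.least b l]⟩
  rw [Nat.succ_le_iff, one_lt_card]
  refine ⟨_, h.triple_mem_fiber hc hck hcl hkl hp, _, h.sq_mem_fiber hkl (by linarith), ?_⟩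
  apply cubic_ne_of_apply c
  simp [cubic_apply, hck.symm, hcl.symm]

lemma pos_of_common (h : IsMinimalEdge E T a b) {k l x : ι} (hkl : k ≠ l) (hkx : k ≠ x)
    (hlx : l ≠ x) (h1 : E k l = E a b) (h2 : E l x = E a b) : 0 < E k x := by
  linarith [h.triple_nonneg k l x hkl hkx hlx, h.neg]

open Classical in
lemma exists_card_add_two_le_sum (h : IsMinimalEdge E T a b) {W : Finset ι} (ha : a ∉ W)
    (hb : b ∉ W) (hW : 3 ≤ W.card) :
    ∃ k ∈ W, W.card + 2 ≤ ∑ l ∈ W, (fiber T a b k l).card := by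
  have hWa : ∀ x ∈ W, a ≠ x := fun x hx => by rintro rfl; exact ha hx
  have hWb : ∀ x ∈ W, b ≠ x := fun x hx => by rintro rfl; exact hb hx
  obtain ⟨k, hk, hmin⟩ := W.exists_min_image (fun k => (W.filter (IsBad E a b k)).card)
    (card_pos.1 (by omega))
  have hself := h.three_le_card_fiber_self (hWa k hk) (hWb k hk)
  have hone : ∀ x ∈ W, x ≠ k → ¬ IsBad E a b k x → 1 ≤ (fiber T a b k x).card :=
    fun x hx hxk hbad =>
      h.one_le_card_fiber (hWa k hk) (hWb k hk) (hWa x hx) (hWb x hx) hxk.symm hbad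
  rcases (W.filter (IsBad E a b k)).eq_empty_or_nonempty with hB | ⟨l, hl⟩
  · refine ⟨k, hk, ?_⟩
    have hsum : ∑ x ∈ W, (1 + if x = k then 2 else 0) ≤ ∑ x ∈ W, (fiber T a b k x).card := by
      refine sum_le_sum fun x hx => ?_
      by_cases hxk : x = k
      · subst hxk
        simpa using hself
      · simpa [hxk] using hone x hx hxk fun hbad => by
          have : x ∈ W.filter (IsBad E a b k) := mem_filter.2 ⟨hx, hbad⟩
          simp [hB] at this
    simpa [sum_add_distrib, hk] using hsum
  · obtain ⟨hlW, hbad⟩ := mem_filter.1 hl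
    have hkl : k ≠ l := hbad.1
    obtain ⟨hEkl, hEk⟩ := h.eq_of_isBad (hWa k hk) (hWb k hk) (hWa l hlW) (hWb l hlW) hbad
    by_cases hm : 2 ≤ (W.filter (IsBad E a b k)).card
    · refine ⟨k, hk, ?_⟩
      have hpos : ∀ x ∈ W, x ≠ k → IsBad E a b l x → 0 < E k x := fun x hx hxk hlx =>
        h.pos_of_common hkl hxk.symm hlx.1 hEkl
          (h.eq_of_isBad (hWa l hlW) (hWb l hlW) (hWa x hx) (hWb x hx) hlx).1
      have hsum : ∑ x ∈ W, ((1 + if x = k then 2 else 0) +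
            2 * if x ∈ (W.filter (IsBad E a b l)).erase k then 1 else 0) ≤
          ∑ x ∈ W, ((fiber T a b k x).card +
            if x ∈ W.filter (IsBad E a b k) then 1 else 0) := by
        refine sum_le_sum fun x hx => ?_
        by_cases hxk : x = k
        · subst hxk
          simp only [mem_erase]
          simp
          omega
        · by_cases hlx : IsBad E a b l x
          · have := h.three_le_card_fiber (hWa k hk) (hWb k hk) (hWa x hx) (hWb x hx)
              (Ne.symm hxk) (hpos x hx hxk hlx)
            simp [hxk, hlx, hx]
            omega
          · have := hone x hx hxk
            by_cases hkx : IsBad E a b k x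
            · simp [hxk, hlx, hkx, hx]
            · simpa [hxk, hlx, hkx] using this hkx
      have hcard : ((W.filter (IsBad E a b l)).erase k).card =
          (W.filter (IsBad E a b l)).card - 1 :=
        card_erase_of_mem (mem_filter.2 ⟨hk, h.isBad_comm.1 hbad⟩)
      have hmin' := hmin l hlW
      have hsub : W ∩ (W.filter (IsBad E a b l)).erase k =
          (W.filter (IsBad E a b l)).erase k :=
        inter_eq_right.2 ((erase_subset _ _).trans (filter_subset _ _))
      rw [sum_add_distrib, sum_add_distrib, sum_add_distrib, ← mul_sum, sum_boole, sum_boole,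
        filter_mem_eq_inter, filter_mem_eq_inter, hsub, hcard,
        inter_eq_right.2 (filter_subset (IsBad E a b k) W)] at hsum
      simp only [sum_const, smul_eq_mul, mul_one, sum_ite_eq', hk, if_true, Nat.cast_id] at hsum
      omega
    · have huniq : ∀ x ∈ W, IsBad E a b k x → x = l := fun x hx hkx =>
        card_le_one.1 (by omega) x (mem_filter.2 ⟨hx, hkx⟩) l hl
      have hdk : -E a b ≤ E k k := by linarith [h.sq_nonneg k l hkl]
      have hla := h.least a k
      have hlb := h.least b k
      by_cases hext : E a b < E a k ∧ E a b < E b k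
      · refine ⟨k, hk, ?_⟩
        have hfour := h.four_le_card_fiber_self (hWa k hk) (hWb k hk) hdk hext.1 hext.2
        have hsum : ∑ x ∈ W, (1 + if x = k then 3 else 0) ≤
            ∑ x ∈ W, ((fiber T a b k x).card + if x = l then 1 else 0) := by
          refine sum_le_sum fun x hx => ?_
          have := hone x hx
          have := huniq x hx
          grind
        simp [sum_add_distrib, hk, hlW] at hsum
        omega
      · have hext' : E a k = -2 * E a b ∨ E b k = -2 * E a b := by
          by_cases h1 : E a b < E a k
          · left
            have : ¬ E a b < E b k := fun h2 => hext ⟨h1, h2⟩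
            linarith
          · right
            linarith
        by_cases hp : ∃ p ∈ W, p ≠ k ∧ p ≠ l ∧ E a b < E k p
        · obtain ⟨p, hpW, hpk, hpl, hlt⟩ := hp
          refine ⟨k, hk, ?_⟩
          have htwo := h.two_le_card_fiber (hWa k hk) (hWb k hk) (hWa p hpW) (hWb p hpW)
            hpk.symm hdk hlt hext'
          have hsum : ∑ x ∈ W, ((1 + if x = k then 2 else 0) + if x = p then 1 else 0) ≤
              ∑ x ∈ W, ((fiber T a b k x).card + if x = l then 1 else 0) := by
            refine sum_le_sum fun x hx => ?_
            have := hone x hx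
            have := huniq x hx
            grind
          simp [sum_add_distrib, hk, hlW, hpW] at hsum
          omega
        · push Not at hp
          have heq : ∀ x ∈ W, x ≠ k → E k x = E a b := fun x hx hxk => by
            by_cases hxl : x = l
            · rw [hxl, hEkl]
            · exact le_antisymm (hp x hx hxk hxl) (h.least k x)
          refine ⟨l, hlW, ?_⟩
          have hself' := h.three_le_card_fiber_self (hWa l hlW) (hWb l hlW)
          have hsum : ∑ x ∈ W, 3 ≤
              ∑ x ∈ W, ((fiber T a b l x).card + if x = k then 3 else 0) := by
            refine sum_le_sum fun x hx => ?_
            by_cases hxk : x = k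
            · simp [hxk]
            · by_cases hxl : x = l
              · subst hxl
                omega
              · have := h.three_le_card_fiber (hWa l hlW) (hWb l hlW) (hWa x hx) (hWb x hx)
                  (Ne.symm hxl) (h.pos_of_common hkl.symm (Ne.symm hxl) (Ne.symm hxk)
                    ((h.symm l k).trans hEkl) (heq x hx hxk))
                omega
          simp [sum_add_distrib, hk] at hsum
          omega

lemma three_mul_card_le (h : IsMinimalEdge E T a b) {W : Finset ι} (ha : a ∉ W) (hb : b ∉ W) :
    3 * W.card ≤ (restrict T a b W).card := by
  induction W using Finset.strongInduction with
  | H W ih =>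
    rcases W.eq_empty_or_nonempty with rfl | ⟨k, hk⟩
    · simp
    · have h1 := ih _ (erase_ssubset hk) (fun hx => ha (mem_of_mem_erase hx))
        fun hx => hb (mem_of_mem_erase hx)
      have h2 := card_restrict_erase_add_le T ha hb hk
      have h3 := h.three_le_card_fiber_self (k := k) (by rintro rfl; exact ha hk)
        (by rintro rfl; exact hb hk)
      have h4 := single_le_sum (f := fun l => (fiber T a b k l).card)
        (fun _ _ => Nat.zero_le _) hk
      rw [card_erase_of_mem hk] at h1
      omega

lemma card_restrict_lower_bound (h : IsMinimalEdge E T a b) {W : Finset ι} (ha : a ∉ W)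
    (hb : b ∉ W) :
    (W.card + 2) * (W.card + 3) ≤ 2 * ((restrict T a b W).card + 6) := by
  induction W using Finset.strongInduction with
  | H W ih =>
    by_cases hW : 3 ≤ W.card
    · obtain ⟨k, hk, hsum⟩ := h.exists_card_add_two_le_sum ha hb hW
      have h1 := ih _ (erase_ssubset hk) (fun hx => ha (mem_of_mem_erase hx))
        fun hx => hb (mem_of_mem_erase hx)
      have h2 := card_restrict_erase_add_le T ha hb hk
      rw [card_erase_of_mem hk] at h1
      obtain ⟨w, hw⟩ : ∃ w, W.card = w + 1 := ⟨W.card - 1, by omega⟩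
      rw [hw] at hsum h1 ⊢
      simp only [Nat.add_sub_cancel] at h1
      nlinarith
    · have h1 := h.three_mul_card_le ha hb
      push Not at hW
      generalize W.card = w at *
      interval_cases w <;> omega

end IsMinimalEdge

lemma coeff_mul_sum_X [Fintype ι] (A : MvPolynomial ι ℝ) (m : ι →₀ ℕ) :
    coeff m (A * ∑ i, X i) = ∑ i ∈ m.support, coeff (m - Finsupp.single i 1) A := by
  rw [mul_sum, coeff_sum]
  simp_rw [coeff_mul_X']
  rw [← sum_filter]
  congr 1
  ext i
  simp

/-- The coefficient of `x_i x_j`. -/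
noncomputable def quadCoeff (A : MvPolynomial ι ℝ) (i j : ι) : ℝ :=
  coeff (Finsupp.single i 1 + Finsupp.single j 1) A

lemma quadCoeff_comm (A : MvPolynomial ι ℝ) (i j : ι) : quadCoeff A i j = quadCoeff A j i := by
  rw [quadCoeff, quadCoeff, add_comm]

lemma cubic_sub_right (i j k : ι) :
    cubic i j k - Finsupp.single k 1 = Finsupp.single i 1 + Finsupp.single j 1 := by
  rw [cubic, add_tsub_cancel_right]

lemma cubic_rotate (i j k : ι) : cubic i j k = cubic j k i := by
  simp only [cubic]; abel

lemma cubic_sub_left (i j k : ι) :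
    cubic i j k - Finsupp.single i 1 = Finsupp.single j 1 + Finsupp.single k 1 := by
  rw [cubic_rotate, cubic_sub_right]

lemma cubic_sub_mid (i j k : ι) :
    cubic i j k - Finsupp.single j 1 = Finsupp.single k 1 + Finsupp.single i 1 := by
  rw [cubic_rotate, cubic_sub_left]

lemma support_cubic (i j k : ι) : (cubic i j k).support = {i, j, k} := by
  ext x
  simp only [Finsupp.mem_support_iff, cubic_apply, mem_insert, mem_singleton]
  grind

lemma coeff_cube [Fintype ι] (A : MvPolynomial ι ℝ) (i : ι) :
    coeff (cubic i i i) (A * ∑ i, X i) = quadCoeff A i i := by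
  rw [coeff_mul_sum_X, support_cubic]
  simp [cubic_sub_right, quadCoeff]

lemma coeff_sq [Fintype ι] (A : MvPolynomial ι ℝ) {i j : ι} (hij : i ≠ j) :
    coeff (cubic i i j) (A * ∑ i, X i) = quadCoeff A i i + quadCoeff A i j := by
  rw [coeff_mul_sum_X, support_cubic]
  simp [hij, cubic_sub_right, cubic_sub_left, quadCoeff, add_comm]

lemma coeff_triple [Fintype ι] (A : MvPolynomial ι ℝ) {i j k : ι} (hij : i ≠ j) (hik : i ≠ k)
    (hjk : j ≠ k) :
    coeff (cubic i j k) (A * ∑ i, X i) = quadCoeff A i j + quadCoeff A i k + quadCoeff A j k := by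
  rw [coeff_mul_sum_X, support_cubic, sum_insert (by simp [hij, hik]), sum_pair hjk,
    cubic_sub_right, cubic_sub_left, cubic_sub_mid, quadCoeff_comm A i k]
  simp only [quadCoeff]
  ring

lemma exists_quadCoeff_of_isHomogeneous {A : MvPolynomial ι ℝ} (hA : A.IsHomogeneous 2)
    {m : ι →₀ ℕ} (hm : coeff m A ≠ 0) : ∃ i j, coeff m A = quadCoeff A i j := by
  have hdeg : m.degree = 2 := by
    rw [Finsupp.degree_eq_weight_one]
    exact hA hm
  have hcard : Multiset.card (Finsupp.toMultiset m) = 2 := by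
    rw [Finsupp.card_toMultiset]
    exact hdeg
  obtain ⟨i, j, hij⟩ := Multiset.card_eq_two.1 hcard
  refine ⟨i, j, ?_⟩
  have : m = Finsupp.single i 1 + Finsupp.single j 1 := by
    apply Multiset.toFinsupp.symm.injective
    change Finsupp.toMultiset m = Finsupp.toMultiset _
    rw [hij, map_add, Finsupp.toMultiset_single, Finsupp.toMultiset_single, one_smul, one_smul]
    rfl
  rw [quadCoeff, ← this]

lemma exists_isMinimalEdge [Fintype ι] {A : MvPolynomial ι ℝ} (hA : A.IsHomogeneous 2)
    (hneg : ∃ m, coeff m A < 0) (hpos : ∀ m, 0 ≤ coeff m (A * ∑ i, X i)) :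
    ∃ a b, IsMinimalEdge (quadCoeff A) (A * ∑ i, X i).support a b := by
  obtain ⟨m, hm⟩ := hneg
  obtain ⟨i₀, j₀, h₀⟩ := exists_quadCoeff_of_isHomogeneous hA hm.ne
  obtain ⟨⟨a, b⟩, -, hmin⟩ := (univ : Finset (ι × ι)).exists_min_image
    (fun p => quadCoeff A p.1 p.2) ⟨(i₀, j₀), mem_univ _⟩
  refine ⟨a, b, quadCoeff_comm A, fun i => ?_, fun i j hij => ?_, fun i j k hij hik hjk => ?_,
    fun i hp => ?_, fun i j hij hp => ?_, fun i j k hij hik hjk hp => ?_, ?_, fun i j => ?_⟩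
  · exact coeff_cube A i ▸ hpos _
  · exact coeff_sq A hij ▸ hpos _
  · exact coeff_triple A hij hik hjk ▸ hpos _
  · exact mem_support_iff.2 (by rw [coeff_cube]; exact hp.ne')
  · exact mem_support_iff.2 (by rw [coeff_sq A hij]; exact hp.ne')
  · exact mem_support_iff.2 (by rw [coeff_triple A hij hik hjk]; exact hp.ne')
  · exact (hmin (i₀, j₀) (mem_univ _)).trans_lt (h₀ ▸ hm)
  · exact hmin (i, j) (mem_univ _)

end QuadraticSupport

/-- Theorem 1.3(B): if a homogeneous quadratic `A` in `n ≥ 6` variables has a negative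
coefficient while `A * S_n` has nonnegative coefficients, then
`|supp(A * S_n)| ≥ (n² + n)/2 − 6`. -/
theorem stmt1 (n : ℕ) (hn : 6 ≤ n)
    (A : MvPolynomial (Fin n) ℝ) (hA : A.IsHomogeneous 2)
    (hneg : ∃ m, coeff m A < 0)
    (S : MvPolynomial (Fin n) ℝ) (hS : S = ∑ i, X i)
    (hpos : ∀ m, 0 ≤ coeff m (A * S)) :
    (n ^ 2 + n) / 2 - 6 ≤ (A * S).support.card := by
  subst hS
  obtain ⟨a, b, h⟩ := QuadraticSupport.exists_isMinimalEdge hA hneg hpos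
  have hbound := h.card_restrict_lower_bound (W := (Finset.univ.erase a).erase b) (by simp)
    (by simp)
  have hcard : ((Finset.univ.erase a).erase b).card = n - 2 := by
    rw [Finset.card_erase_of_mem (by simpa using h.ne.symm),
      Finset.card_erase_of_mem (Finset.mem_univ _), Finset.card_fin]
    omega
  have hle : (QuadraticSupport.restrict (A * ∑ i, X i).support a b
      ((Finset.univ.erase a).erase b)).card ≤ (A * ∑ i, X i).support.card :=
    Finset.card_le_card (Finset.filter_subset _ _)
  obtain ⟨k, rfl⟩ : ∃ k, n = k + 2 := ⟨n - 2, by omega⟩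
  rw [hcard, Nat.add_sub_cancel] at hbound
  have hexp : (k + 2) ^ 2 + (k + 2) = (k + 2) * (k + 3) := by ring
  rw [hexp]
  omega
end

section
/- Let n ≥ 2. If A is any polynomial (not necessarily homogeneous) with real coefficients in the variables x_1,…,x_n such that A has at least one negative coefficient while A·S_n is coefficientwise nonnegative, then |supp(A·S_n)| ≥ 3n − 4. -/
open MvPolynomial

noncomputable section

open scoped Classical

/-- The coefficient at `β` of the product of `∑ v, a v • x ^ v` with `∑ i ∈ J, x i`. -/
def mulSum {ι : Type*} (J : Finset ι) (a : (ι → ℤ) → ℝ) (β : ι → ℤ) : ℝ :=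
  ∑ i ∈ J, a (β - Pi.single i 1)

/-- `a` is a finitely supported coefficient family, homogeneous in the variables of `J` and constant
in the others, which has a negative value although its product with `∑ i ∈ J, x i` is nonnegative. -/
structure NegFactor {ι : Type*} [Fintype ι] (J : Finset ι) (a : (ι → ℤ) → ℝ) :
    Prop where
  finite : (Function.support a).Finite
  eq_off : ∀ v w, a v ≠ 0 → a w ≠ 0 → ∀ i ∉ J, v i = w i
  sum_eq : ∀ v w, a v ≠ 0 → a w ≠ 0 → ∑ i, v i = ∑ i, w i
  exists_neg : ∃ α, a α < 0
  nonneg : ∀ β, 0 ≤ mulSum J a β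

section

variable {ι : Type*} {J : Finset ι} {a : (ι → ℤ) → ℝ}

lemma exists_ne_zero_of_mulSum_ne_zero {β : ι → ℤ} (h : mulSum J a β ≠ 0) :
    ∃ i ∈ J, a (β - Pi.single i 1) ≠ 0 :=
  Finset.exists_ne_zero_of_sum_ne_zero h

lemma finite_support_mulSum (J : Finset ι) (ha : (Function.support a).Finite) :
    (Function.support (mulSum J a)).Finite := by
  refine (J.finite_toSet.biUnion fun i _ => ha.image (· + Pi.single i 1)).subset fun β hβ => ?_
  obtain ⟨i, hi, h⟩ := exists_ne_zero_of_mulSum_ne_zero hβ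
  exact Set.mem_biUnion hi ⟨_, h, by simp⟩

lemma mulSum_ne_zero {β : ι → ℤ} {i : ι} (hi : i ∈ J)
    (h0 : ∀ k ∈ J, 0 ≤ a (β - Pi.single k 1)) (hp : 0 < a (β - Pi.single i 1)) :
    mulSum J a β ≠ 0 :=
  (Finset.sum_pos' h0 ⟨i, hi, hp⟩).ne'

lemma exists_pos_of_neg {v : ι → ℤ} {i : ι} (hn : ∀ β, 0 ≤ mulSum J a β) (hi : i ∈ J)
    (hv : a v < 0) : ∃ j ∈ J, j ≠ i ∧ 0 < a (v + Pi.single i 1 - Pi.single j 1) := by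
  by_contra! h
  refine (hn (v + Pi.single i 1)).not_gt (Finset.sum_neg' (fun j hj => ?_) ⟨i, hi, by simpa⟩)
  by_cases hji : j = i
  · subst hji; simpa using hv.le
  · exact h j hj hji

/-- The points `p + e k` for `k ∈ J`. -/
def shifts (J : Finset ι) (p : ι → ℤ) : Finset (ι → ℤ) := J.image fun k => p + Pi.single k 1

lemma mem_shifts {p β : ι → ℤ} : β ∈ shifts J p ↔ ∃ k ∈ J, p + Pi.single k 1 = β := Finset.mem_image

lemma card_shifts (p : ι → ℤ) : (shifts J p).card = J.card := by
  refine Finset.card_image_of_injective _ fun i k h => ?_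
  have := congrFun (add_left_cancel h) i
  simp only [Pi.single_apply] at this
  by_contra hik
  simp [hik] at this

lemma card_inter_shifts_le [DecidableEq (ι → ℤ)] {J₁ J₂ : Finset ι} {p q : ι → ℤ} (h : p ≠ q) :
    (shifts J₁ p ∩ shifts J₂ q).card ≤ 1 := by
  rw [Finset.card_le_one]
  intro x hx y hy
  simp only [Finset.mem_inter, mem_shifts] at hx hy
  obtain ⟨⟨i, -, rfl⟩, k, -, hk⟩ := hx
  obtain ⟨⟨i', -, rfl⟩, k', -, hk'⟩ := hy
  have hik : i ≠ k := by
    rintro rfl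
    exact h (add_right_cancel hk).symm
  suffices i = i' by rw [this]
  by_contra hne
  have h1 := congrFun hk i
  have h2 := congrFun hk' i
  simp only [Pi.add_apply, Pi.single_apply, hik, if_true, if_false] at h1 h2
  rw [if_neg hne] at h2
  split_ifs at h2 <;> omega

lemma card_union_shifts [DecidableEq (ι → ℤ)] {J₁ J₂ : Finset ι} {p q : ι → ℤ} (h : p ≠ q) :
    J₁.card + J₂.card ≤ (shifts J₁ p ∪ shifts J₂ q).card + 1 := by
  have := Finset.card_union_add_card_inter (shifts J₁ p) (shifts J₂ q)
  have := card_inter_shifts_le (J₁ := J₁) (J₂ := J₂) h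
  simp only [card_shifts] at *
  omega

end

section

variable {ι : Type*} [Fintype ι] {J : Finset ι} {a : (ι → ℤ) → ℝ}

lemma NegFactor.exists_min (h : NegFactor J a) (l : ι) :
    ∃ p, a p ≠ 0 ∧ ∀ v, a v ≠ 0 → p l ≤ v l := by
  obtain ⟨α, hα⟩ := h.exists_neg
  obtain ⟨p, hp, hm⟩ := Set.exists_min_image _ (fun v : ι → ℤ => v l) h.finite ⟨α, hα.ne⟩
  exact ⟨p, hp, fun v hv => hm v hv⟩

/-- Above the negative coefficients of largest degree in `x i` there is a positive coefficient
`γ`, and `γ + e i` survives in the product. -/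
lemma NegFactor.exists_top (h : NegFactor J a) {i : ι} (hi : i ∈ J) :
    ∃ α j, a α < 0 ∧ j ∈ J ∧ j ≠ i ∧ (∀ v, a v < 0 → v i ≤ α i) ∧
      0 < a (α + Pi.single i 1 - Pi.single j 1) ∧
      mulSum J a (α + Pi.single i 1 - Pi.single j 1 + Pi.single i 1) ≠ 0 := by
  have hfin : {v | a v < 0}.Finite := h.finite.subset fun v hv => ne_of_lt hv
  obtain ⟨α, hα, hm⟩ := Set.exists_max_image _ (fun v : ι → ℤ => v i) hfin h.exists_neg
  obtain ⟨j, hj, hji, hp⟩ := exists_pos_of_neg h.nonneg hi hα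
  refine ⟨α, j, hα, hj, hji, hm, hp, mulSum_ne_zero hi (fun k _ => ?_) (by simpa using hp)⟩
  by_contra! hlt
  have := hm _ hlt
  simp only [Pi.add_apply, Pi.sub_apply, Pi.single_apply, if_true, hji.symm, if_false] at this
  split_ifs at this <;> omega

end

section

variable {ι : Type*} [Fintype ι] {J : Finset ι} {a : (ι → ℤ) → ℝ}

lemma NegFactor.card_le_ncard (h : NegFactor J a) :
    J.card ≤ (Function.support (mulSum J a)).ncard := by
  choose! α j hneg hj hji hmax hpos hZ using fun i (hi : i ∈ J) => h.exists_top hi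
  rw [Set.ncard_eq_toFinset_card _ (finite_support_mulSum J h.finite)]
  refine Finset.card_le_card_of_injOn
    (fun i => α i + Pi.single i 1 - Pi.single (j i) 1 + Pi.single i 1) ?_ ?_
  · intro i hi
    simpa using hZ i hi
  · intro i hi k hk hik
    by_contra hne
    have h1 := congrFun hik i
    have h2 := hmax i hi _ (hneg k hk)
    simp only [Pi.add_apply, Pi.sub_apply, Pi.single_apply, if_true, if_neg hne,
      if_neg (hji i hi).symm] at h1
    split_ifs at h1 <;> omega

lemma NegFactor.three_mul_card_le_of_interior (h : NegFactor J a) (hJ : 2 ≤ J.card)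
    (hb : ∀ l ∈ J, ∀ α, a α < 0 → ∃ v, a v ≠ 0 ∧ v l < α l) :
    3 * J.card ≤ (Function.support (mulSum J a)).ncard + 4 := by
  choose! α j hneg hj hji hmax hpos hZ using fun i (hi : i ∈ J) => h.exists_top hi
  choose p hp hmin using h.exists_min
  have hint : ∀ l ∈ J, ∀ v, a v < 0 → p l l < v l := by
    intro l hl v hv
    obtain ⟨w, hw, hlt⟩ := hb l hl v hv
    exact (hmin l w hw).trans_lt hlt
  rw [Set.ncard_eq_toFinset_card _ (finite_support_mulSum J h.finite)]
  set Z := (finite_support_mulSum J h.finite).toFinset with hZdef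
  have memZ : ∀ β, β ∈ Z ↔ mulSum J a β ≠ 0 := by simp [Z]
  set γ : ι → ι → ℤ := fun i => α i + Pi.single i 1 - Pi.single (j i) 1 with hγ
  set w : ι → ι → ℤ := fun i => γ i + Pi.single i 1 with hw
  have hface : ∀ l ∈ J, ∀ q, a q ≠ 0 → q l = p l l → shifts (J.erase l) q ⊆ Z := by
    intro l hl q hq hql β hβ
    obtain ⟨k, hk, rfl⟩ := mem_shifts.1 hβ
    obtain ⟨hkl, hkJ⟩ := Finset.mem_erase.1 hk
    refine (memZ _).2 (mulSum_ne_zero hkJ (fun m _ => ?_) ?_)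
    · by_contra! hlt
      have := hint l hl _ hlt
      simp only [Pi.add_apply, Pi.sub_apply, Pi.single_apply, if_neg hkl.symm] at this
      split_ifs at this <;> omega
    · rw [add_sub_cancel_right]
      refine lt_of_le_of_ne (not_lt.1 fun hlt => ?_) hq.symm
      exact (hint l hl _ hlt).ne' hql
  have happ : ∀ l q, ∀ β ∈ shifts (J.erase l) q, β l = q l := by
    intro l q β hβ
    obtain ⟨k, hk, rfl⟩ := mem_shifts.1 hβ
    simp [(Finset.mem_erase.1 hk).1.symm]
  have hle : ∀ J' q, ∀ β ∈ shifts J' q, ∀ l : ι, q l ≤ β l := by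
    intro J' q β hβ l
    obtain ⟨k, hk, rfl⟩ := mem_shifts.1 hβ
    simp only [Pi.add_apply, Pi.single_apply]
    split_ifs <;> omega
  have hγpos : ∀ i ∈ J, ∀ l ∈ J, l ≠ j i → p l l < γ i l := by
    intro i hi l hl hlj
    have := hint l hl _ (hneg i hi)
    simp only [hγ, Pi.add_apply, Pi.sub_apply, Pi.single_apply, if_neg hlj]
    split_ifs <;> omega
  have hγne : ∀ i ∈ J, ∀ k ∈ J, i ≠ k → γ k i < γ i i := by
    intro i hi k hk hik
    have := hmax i hi _ (hneg k hk)
    simp only [hγ, Pi.add_apply, Pi.sub_apply, Pi.single_apply, if_neg hik, if_true,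
      if_neg (hji i hi).symm]
    split_ifs <;> omega
  have hwinj : Set.InjOn w J := by
    intro i hi k hk hik
    by_contra hne
    have h1 := congrFun hik i
    have h2 := hγne i hi k hk hne
    simp only [hw, Pi.add_apply, Pi.single_apply, if_true, if_neg hne] at h1
    omega
  set G := J.filter fun i => p (j i) (j i) < γ i (j i) with hG
  set B := J.filter fun i => ¬ p (j i) (j i) < γ i (j i) with hB
  have hGB : G.card + B.card = J.card := Finset.card_filter_add_card_filter_not _
  have hGcard : (G.image w).card = G.card :=
    Finset.card_image_of_injOn (hwinj.mono (Finset.filter_subset _ _))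
  have hGZ : G.image w ⊆ Z := by
    intro β hβ
    obtain ⟨i, hi, rfl⟩ := Finset.mem_image.1 hβ
    exact (memZ _).2 (hZ i (Finset.mem_filter.1 hi).1)
  have hGpos : ∀ β ∈ G.image w, ∀ l ∈ J, p l l < β l := by
    intro β hβ l hl
    obtain ⟨i, hi, rfl⟩ := Finset.mem_image.1 hβ
    obtain ⟨hiJ, hi⟩ := Finset.mem_filter.1 hi
    have : p l l < γ i l := by
      by_cases hlj : l = j i
      · rw [hlj]; exact hi
      · exact hγpos i hiJ l hl hlj
    simp only [hw, Pi.add_apply, Pi.single_apply]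
    split_ifs <;> omega
  have hBeq : ∀ i ∈ B, γ i (j i) = p (j i) (j i) := by
    intro i hi
    obtain ⟨hiJ, hi⟩ := Finset.mem_filter.1 hi
    exact le_antisymm (not_lt.1 hi) (hmin _ _ (hpos i hiJ).ne')
  have hBface : ∀ i ∈ B, shifts (J.erase (j i)) (γ i) ⊆ Z := fun i hi =>
    hface _ (hj i (Finset.mem_filter.1 hi).1) _ (hpos i (Finset.mem_filter.1 hi).1).ne' (hBeq i hi)
  have hBJ : ∀ i ∈ B, i ∈ J := fun i hi => (Finset.mem_filter.1 hi).1
  have hcard : ∀ l ∈ J, (J.erase l).card = J.card - 1 := fun l hl => Finset.card_erase_of_mem hl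
  by_cases hB1 : B.card ≤ 1
  · obtain ⟨l, hl⟩ : J.Nonempty := Finset.card_pos.1 (by omega)
    obtain ⟨k, hk, hkp⟩ : ∃ k ∈ J, p k k < p l k := by
      by_contra! hk
      obtain ⟨v, hv⟩ := h.exists_neg
      refine (Finset.sum_lt_sum (f := p l) (g := v) (s := Finset.univ) (fun i _ => ?_)
        ⟨l, Finset.mem_univ _, hint l hl v hv⟩).ne (h.sum_eq _ _ (hp l) hv.ne)
      by_cases hi : i ∈ J
      · exact (hk i hi).trans (hint i hi v hv).le
      · exact (h.eq_off _ _ (hp l) hv.ne i hi).le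
    have hne : p l ≠ p k := fun he => by rw [he] at hkp; exact lt_irrefl _ hkp
    have h1 := card_union_shifts (J₁ := J.erase l) (J₂ := J.erase k) hne
    rw [hcard l hl, hcard k hk] at h1
    have hdisj : Disjoint (shifts (J.erase l) (p l) ∪ shifts (J.erase k) (p k)) (G.image w) := by
      rw [Finset.disjoint_left]
      intro β hβ hβ'
      rcases Finset.mem_union.1 hβ with hβ | hβ
      · exact (hGpos β hβ' l hl).ne' (happ _ _ _ hβ)
      · exact (hGpos β hβ' k hk).ne' (happ _ _ _ hβ)
    have h2 := Finset.card_le_card (Finset.union_subset (Finset.union_subset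
      (hface l hl _ (hp l) rfl) (hface k hk _ (hp k) rfl)) hGZ)
    rw [Finset.card_union_of_disjoint hdisj, hGcard] at h2
    omega
  · by_cases hinj : Set.InjOn j B
    · have hdisj : Disjoint (B.biUnion fun i => shifts (J.erase (j i)) (γ i)) (G.image w) := by
        rw [Finset.disjoint_left]
        intro β hβ hβ'
        obtain ⟨i, hi, hβ⟩ := Finset.mem_biUnion.1 hβ
        exact (hGpos β hβ' (j i) (hj i (hBJ i hi))).ne' ((happ _ _ _ hβ).trans (hBeq i hi))
      have h1 : (B.biUnion fun i => shifts (J.erase (j i)) (γ i)).card = B.card * (J.card - 1) := by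
        rw [Finset.card_biUnion, Finset.sum_const_nat]
        · intro i hi
          rw [card_shifts, hcard _ (hj i (hBJ i hi))]
        · intro i hi k hk hik
          rw [Function.onFun, Finset.disjoint_left]
          intro β hβ hβ'
          have h1 := (happ _ _ _ hβ).trans (hBeq i hi)
          have h2 := hγpos k (hBJ k hk) _ (hj i (hBJ i hi)) fun hjj => hik (hinj hi hk hjj)
          exact (h2.trans_le (hle _ _ _ hβ' _)).ne' h1
      have h2 := Finset.card_le_card (Finset.union_subset (Finset.biUnion_subset.2 hBface) hGZ)
      rw [Finset.card_union_of_disjoint hdisj, hGcard, h1] at h2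
      obtain ⟨m, hm⟩ := Nat.exists_eq_add_of_le hJ
      obtain ⟨b, hb'⟩ := Nat.exists_eq_add_of_lt (not_le.1 hB1)
      have h3 : J.card - 1 = m + 1 := by omega
      rw [h3] at h2
      have : B.card * (m + 1) = B.card * m + B.card := by ring
      have : B.card * m ≥ 2 * m := Nat.mul_le_mul_right _ (by omega)
      omega
    · obtain ⟨i, hi, k, hk, hjj, hik⟩ : ∃ i ∈ B, ∃ k ∈ B, j i = j k ∧ i ≠ k := by
        simpa [Set.InjOn] using hinj
      have hiJ := hBJ i hi
      have hkJ := hBJ k hk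
      have hne : γ i ≠ γ k := fun he =>
        (hγne i hiJ k hkJ hik).ne' (congrFun he i)
      have h1 := card_union_shifts (J₁ := J.erase (j i)) (J₂ := J.erase (j k)) hne
      rw [hcard _ (hj i hiJ), hcard _ (hj k hkJ)] at h1
      have hdisj : Disjoint (shifts (J.erase (j i)) (γ i) ∪ shifts (J.erase (j k)) (γ k))
          (shifts (J.erase i) (p i)) := by
        rw [Finset.disjoint_left]
        intro β hβ hβ'
        have h3 := happ _ _ _ hβ'
        rcases Finset.mem_union.1 hβ with hβ | hβ
        · have := hγpos i hiJ i hiJ (hji i hiJ).symm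
          exact (this.trans_le (hle _ _ _ hβ _)).ne' h3
        · have := hγpos k hkJ i hiJ fun he => hji i hiJ (hjj.trans he.symm)
          exact (this.trans_le (hle _ _ _ hβ _)).ne' h3
      have h2 := Finset.card_le_card (Finset.union_subset (Finset.union_subset
        (hBface i hi) (hBface k hk)) (hface i hiJ _ (hp i) rfl))
      rw [Finset.card_union_of_disjoint hdisj, card_shifts, hcard _ hiJ] at h2
      omega

end

section

variable {ι : Type*} {J : Finset ι} {a : (ι → ℤ) → ℝ} {z : ι} {ℓ : ℤ}

lemma mulSum_add_single (hz : z ∈ J) (v : ι → ℤ) :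
    mulSum J a (v + Pi.single z 1) =
      a v + ∑ k ∈ J.erase z, a (v + Pi.single z 1 - Pi.single k 1) := by
  rw [mulSum, ← Finset.add_sum_erase _ _ hz, add_sub_cancel_right]

/-- The part of `a` of degree `ℓ` in `x z`. -/
def slice (a : (ι → ℤ) → ℝ) (z : ι) (ℓ : ℤ) (v : ι → ℤ) : ℝ := if v z = ℓ then a v else 0

lemma mulSum_slice (hz : z ∈ J) (hℓ : ∀ v, a v ≠ 0 → ℓ ≤ v z) (β : ι → ℤ) :
    mulSum (J.erase z) (slice a z ℓ) β = if β z = ℓ then mulSum J a β else 0 := by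
  have hk : ∀ k ∈ J.erase z, (β - Pi.single k 1 : ι → ℤ) z = β z := fun k hk => by
    simp [(Finset.mem_erase.1 hk).1.symm]
  split_ifs with h
  · have h0 : a (β - Pi.single z 1) = 0 := by
      by_contra hne
      have := hℓ _ hne
      simp only [Pi.sub_apply, Pi.single_eq_same] at this
      omega
    rw [mulSum, mulSum, ← Finset.add_sum_erase _ _ hz, h0, zero_add]
    exact Finset.sum_congr rfl fun k hk' => by rw [slice, if_pos ((hk k hk').trans h)]
  · exact Finset.sum_eq_zero fun k hk' => by
      rw [slice, if_neg fun he => h ((hk k hk').symm.trans he)]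

/-- The coefficients of `a` with signs alternating with the degree in `x z`. -/
def alt (a : (ι → ℤ) → ℝ) (z : ι) (ℓ : ℤ) (v : ι → ℤ) : ℝ := (-1 : ℝ) ^ (v z - ℓ) * a v

lemma alt_eq (hz : z ∈ J) (v : ι → ℤ) :
    alt a z ℓ v = (-1 : ℝ) ^ (v z - ℓ) * mulSum J a (v + Pi.single z 1) +
      ∑ k ∈ J.erase z, alt a z ℓ (v + Pi.single z 1 - Pi.single k 1) := by
  rw [mulSum_add_single hz, mul_add, add_assoc, Finset.mul_sum, ← Finset.sum_add_distrib,
    Finset.sum_eq_zero, add_zero, alt]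
  intro k hk
  have : (v + Pi.single z 1 - Pi.single k 1 : ι → ℤ) z - ℓ = v z - ℓ + 1 := by
    simp [(Finset.mem_erase.1 hk).1.symm]
    ring
  rw [alt, this, zpow_add_one₀ (by norm_num)]
  ring

/-- Induction on the degree in `x z`, starting from the highest degree. -/
lemma level_induction (ha : (Function.support a).Finite) {Q : (ι → ℤ) → Prop}
    (h0 : ∀ v, a v = 0 → Q v)
    (h : ∀ v, ℓ ≤ v z → (∀ k ∈ J.erase z, Q (v + Pi.single z 1 - Pi.single k 1)) → Q v)
    (v : ι → ℤ) (hv : ℓ ≤ v z) : Q v := by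
  obtain ⟨M, hM⟩ := (ha.image fun v : ι → ℤ => v z).bddAbove
  have key : ∀ n : ℕ, ∀ v : ι → ℤ, ℓ ≤ v z → M < v z + n → Q v := by
    intro n
    induction n with
    | zero =>
      intro v _ hv
      refine h0 v (by_contra fun hne => ?_)
      have := hM ⟨v, hne, rfl⟩
      simp at hv this
      omega
    | succ n ih =>
      intro v hv hv'
      refine h v hv fun k hk => ih _ ?_ ?_ <;>
      · simp [(Finset.mem_erase.1 hk).1.symm]
        push_cast at hv'
        omega
  exact key (M - v z + 1).toNat v hv (by omega)

lemma alt_nonneg (ha : (Function.support a).Finite) (hz : z ∈ J) {ε : ℝ} {U : (ι → ℤ) → Prop}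
    (hU : ∀ v, U v → ∀ k ∈ J.erase z, U (v + Pi.single z 1 - Pi.single k 1))
    (hs : ∀ v, ℓ ≤ v z → U v →
      0 ≤ ε * ((-1 : ℝ) ^ (v z - ℓ) * mulSum J a (v + Pi.single z 1)))
    (v : ι → ℤ) (hv : ℓ ≤ v z) (hUv : U v) : 0 ≤ ε * alt a z ℓ v := by
  refine level_induction (J := J) (Q := fun v => U v → 0 ≤ ε * alt a z ℓ v) ha
    (fun v hv _ => by simp [alt, hv]) (fun v hv ih hUv => ?_) v hv hUv
  rw [alt_eq hz, mul_add, Finset.mul_sum]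
  exact add_nonneg (hs v hv hUv) (Finset.sum_nonneg fun k hk => ih k hk (hU v hUv k hk))

variable [Fintype ι]

lemma NegFactor.slice (h : NegFactor J a) (hz : z ∈ J) (hℓ : ∀ v, a v ≠ 0 → ℓ ≤ v z)
    {α : ι → ℤ} (hα : a α < 0) (hαz : α z = ℓ) : NegFactor (J.erase z) (slice a z ℓ) := by
  have hs : ∀ v, _root_.slice a z ℓ v ≠ 0 → v z = ℓ ∧ a v ≠ 0 := by
    intro v hv
    simpa [_root_.slice] using hv
  refine ⟨h.finite.subset fun v hv => (hs v hv).2, fun v w hv hw i hi => ?_,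
    fun v w hv hw => h.sum_eq v w (hs v hv).2 (hs w hw).2, ⟨α, by simpa [_root_.slice, hαz]⟩,
    fun β => ?_⟩
  · by_cases hiz : i = z
    · rw [hiz, (hs v hv).1, (hs w hw).1]
    · exact h.eq_off v w (hs v hv).2 (hs w hw).2 i fun hiJ => hi (Finset.mem_erase.2 ⟨hiz, hiJ⟩)
  · rw [mulSum_slice hz hℓ]
    split_ifs
    exacts [h.nonneg β, le_rfl]

lemma sum_eq_add_sum_erase (hz : z ∈ J) {v w : ι → ℤ} (h : ∀ i ∉ J, v i = w i) :
    ∑ i, v i - ∑ i, w i = v z - w z + ∑ k ∈ J.erase z, (v k - w k) := by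
  rw [Finset.add_sum_erase J (fun k => v k - w k) hz, ← Finset.sum_sub_distrib]
  refine (Finset.sum_subset (Finset.subset_univ J) fun i _ hi => ?_).symm
  rw [h i hi, sub_self]

lemma alt_pos (ha : (Function.support a).Finite) (hz : z ∈ J) {ε : ℝ} {U : (ι → ℤ) → Prop}
    (hU : ∀ v, U v → ∀ k ∈ J.erase z, U (v + Pi.single z 1 - Pi.single k 1))
    (hs : ∀ v, ℓ ≤ v z → U v →
      0 ≤ ε * ((-1 : ℝ) ^ (v z - ℓ) * mulSum J a (v + Pi.single z 1)))
    {β : ι → ℤ} (hβ : 0 < ε * ((-1 : ℝ) ^ (β z - 1 - ℓ) * mulSum J a β))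
    (v : ι → ℤ) (hv : ℓ ≤ v z) (hUv : U v) (hoff : ∀ i ∉ J, v i = β i)
    (hsum : ∑ i, v i = ∑ i, β i - 1) (hle : ∀ k ∈ J.erase z, β k ≤ v k) :
    0 < ε * alt a z ℓ v := by
  have key : ∀ n : ℕ, ∀ v : ι → ℤ, ℓ ≤ v z → U v → (∀ i ∉ J, v i = β i) →
      ∑ i, v i = ∑ i, β i - 1 → (∀ k ∈ J.erase z, β k ≤ v k) → β z ≤ v z + n →
      0 < ε * alt a z ℓ v := by
    intro n
    induction n with
    | zero =>
      intro v hv hUv hoff hsum hle hn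
      have h1 := sum_eq_add_sum_erase hz hoff
      have h2 : 0 ≤ ∑ k ∈ J.erase z, (v k - β k) :=
        Finset.sum_nonneg fun k hk => sub_nonneg.2 (hle k hk)
      simp at hn
      omega
    | succ n ih =>
      intro v hv hUv hoff hsum hle hn
      rw [alt_eq hz, mul_add, Finset.mul_sum]
      have hnn : ∀ k ∈ J.erase z, 0 ≤ ε * alt a z ℓ (v + Pi.single z 1 - Pi.single k 1) := by
        intro k hk
        refine alt_nonneg ha hz hU hs _ ?_ (hU v hUv k hk)
        simp [(Finset.mem_erase.1 hk).1.symm]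
        omega
      by_cases hex : ∃ k ∈ J.erase z, β k < v k
      · obtain ⟨k, hk, hlt⟩ := hex
        have hkz := (Finset.mem_erase.1 hk).1
        refine add_pos_of_nonneg_of_pos (hs v hv hUv) (Finset.sum_pos' hnn ⟨k, hk, ?_⟩)
        refine ih _ ?_ (hU v hUv k hk) ?_ ?_ ?_ ?_
        · simp [hkz.symm]
          omega
        · intro i hi
          have hiz : i ≠ z := fun he => hi (he ▸ hz)
          have hik : i ≠ k := fun he => hi (he ▸ (Finset.mem_erase.1 hk).2)
          simp [hiz, hik, hoff i hi]
        · simp [Finset.sum_add_distrib, Finset.sum_sub_distrib, hsum]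
        · intro i hi
          have := hle i hi
          simp only [Pi.add_apply, Pi.sub_apply, Pi.single_apply, if_neg (Finset.mem_erase.1 hi).1]
          split_ifs with hik
          · subst hik; omega
          · omega
        · simp [hkz.symm]
          push_cast at hn
          omega
      · push Not at hex
        have h1 := sum_eq_add_sum_erase hz hoff
        rw [Finset.sum_eq_zero fun k hk => sub_eq_zero.2 ((hex k hk).antisymm (hle k hk))] at h1
        have hvz : v z = β z - 1 := by omega
        have hvβ : v + Pi.single z 1 = β := by
          funext i
          by_cases hiz : i = z
          · subst hiz; simp [hvz]
          · by_cases hi : i ∈ J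
            · have hi' := Finset.mem_erase.2 ⟨hiz, hi⟩
              simp [hiz, (hex i hi').antisymm (hle i hi')]
            · simp [hiz, hoff i hi]
        refine add_pos_of_pos_of_nonneg ?_ (Finset.sum_nonneg hnn)
        rw [hvβ, hvz]
        exact hβ
  exact key (β z - v z).toNat v hv hUv hoff hsum hle (by omega)

end

section

variable {ι : Type*} {J : Finset ι} {a : (ι → ℤ) → ℝ} {z : ι} {ℓ : ℤ}

lemma alt_of_eq {v : ι → ℤ} (hv : v z = ℓ) : alt a z ℓ v = a v := by simp [alt, hv]

lemma exists_pos_of_neg_of_level (hn : ∀ β, 0 ≤ mulSum J a β) (hℓ : ∀ v, a v ≠ 0 → ℓ ≤ v z)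
    {v : ι → ℤ} (hv : a v < 0) (hvz : v z = ℓ) {k : ι} (hk : k ∈ J.erase z) :
    ∃ j ∈ J.erase z, j ≠ k ∧ 0 < a (v + Pi.single k 1 - Pi.single j 1) ∧
      (v + Pi.single k 1 - Pi.single j 1 : ι → ℤ) z = ℓ := by
  obtain ⟨hkz, hkJ⟩ := Finset.mem_erase.1 hk
  obtain ⟨j, hj, hjk, hp⟩ := exists_pos_of_neg hn hkJ hv
  have hjz : j ≠ z := by
    rintro rfl
    have := hℓ _ hp.ne'
    simp [hkz.symm] at this
    omega
  exact ⟨j, Finset.mem_erase.2 ⟨hjz, hj⟩, hjk, hp, by simp [hkz.symm, hjz.symm, hvz]⟩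

variable [Fintype ι]

lemma NegFactor.eq_off_sum (h : NegFactor J a) {β : ι → ℤ} (hβ : mulSum J a β ≠ 0) {v : ι → ℤ}
    (hv : a v ≠ 0) : (∀ i ∉ J, v i = β i) ∧ ∑ i, v i = ∑ i, β i - 1 := by
  obtain ⟨k, hk, hne⟩ := exists_ne_zero_of_mulSum_ne_zero hβ
  refine ⟨fun i hi => ?_, ?_⟩
  · have hik : i ≠ k := fun he => hi (he ▸ hk)
    simpa [hik] using h.eq_off _ _ hv hne i hi
  · simpa [Finset.sum_sub_distrib] using h.sum_eq _ _ hv hne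

lemma NegFactor.three_mul_card_le_of_odd (h : NegFactor J a) (hz : z ∈ J) (hJ : 3 ≤ J.card)
    (hℓ : ∀ v, a v ≠ 0 → ℓ ≤ v z) {α : ι → ℤ} (hα : a α < 0) (hαz : α z = ℓ)
    {β₁ β₂ : ι → ℤ} (hβ₁ : mulSum J a β₁ ≠ 0) (hβ₂ : mulSum J a β₂ ≠ 0)
    (h1 : ℓ < β₁ z) (h2 : ℓ < β₂ z)
    (hZ : ∀ β, ℓ < β z → mulSum J a β ≠ 0 → β = β₁ ∨ β = β₂)
    (he : Even (β₁ z - 1 - ℓ)) (ho : Odd (β₂ z - 1 - ℓ)) :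
    3 * J.card ≤ (Function.support (mulSum J a)).ncard + 4 := by
  have hp₁ : 0 < mulSum J a β₁ := lt_of_le_of_ne (h.nonneg _) hβ₁.symm
  have hp₂ : 0 < mulSum J a β₂ := lt_of_le_of_ne (h.nonneg _) hβ₂.symm
  have hU : ∀ β v : ι → ℤ, (¬ ∀ k ∈ J.erase z, β k ≤ v k) → ∀ m ∈ J.erase z,
      ¬ ∀ k ∈ J.erase z, β k ≤ (v + Pi.single z 1 - Pi.single m 1 : ι → ℤ) k := by
    intro β v hv m hm hle
    refine hv fun k hk => ?_
    have := hle k hk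
    simp only [Pi.add_apply, Pi.sub_apply, Pi.single_apply, if_neg (Finset.mem_erase.1 hk).1] at this
    split_ifs at this <;> omega
  have hUself : ∀ β v : ι → ℤ, v + Pi.single z 1 = β → ∀ k ∈ J.erase z, β k ≤ v k := by
    rintro β v rfl k hk
    simp [(Finset.mem_erase.1 hk).1]
  have hvz : ∀ β v : ι → ℤ, v + Pi.single z 1 = β → v z = β z - 1 := by
    rintro β v rfl
    simp
  have hlev : ∀ v : ι → ℤ, ℓ ≤ v z → ℓ < (v + Pi.single z 1 : ι → ℤ) z := by
    intro v hv
    simp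
    omega
  have hs₁ : ∀ v : ι → ℤ, v + Pi.single z 1 = β₁ →
      0 ≤ (1 : ℝ) * ((-1 : ℝ) ^ (v z - ℓ) * mulSum J a (v + Pi.single z 1)) := by
    intro v hv
    rw [hvz _ _ hv, hv, he.neg_one_zpow, one_mul, one_mul]
    exact hp₁.le
  have hs₂ : ∀ v : ι → ℤ, v + Pi.single z 1 = β₂ →
      0 ≤ (-1 : ℝ) * ((-1 : ℝ) ^ (v z - ℓ) * mulSum J a (v + Pi.single z 1)) := by
    intro v hv
    rw [hvz _ _ hv, hv, ho.neg_one_zpow]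
    linarith
  have hsU₁ : ∀ v : ι → ℤ, ℓ ≤ v z → (¬ ∀ k ∈ J.erase z, β₂ k ≤ v k) →
      0 ≤ (1 : ℝ) * ((-1 : ℝ) ^ (v z - ℓ) * mulSum J a (v + Pi.single z 1)) := by
    intro v hv hUv
    by_cases h0 : mulSum J a (v + Pi.single z 1) = 0
    · simp [h0]
    · rcases hZ _ (hlev v hv) h0 with hv' | hv'
      · exact hs₁ v hv'
      · exact absurd (hUself _ _ hv') hUv
  have hsU₂ : ∀ v : ι → ℤ, ℓ ≤ v z → (¬ ∀ k ∈ J.erase z, β₁ k ≤ v k) →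
      0 ≤ (-1 : ℝ) * ((-1 : ℝ) ^ (v z - ℓ) * mulSum J a (v + Pi.single z 1)) := by
    intro v hv hUv
    by_cases h0 : mulSum J a (v + Pi.single z 1) = 0
    · simp [h0]
    · rcases hZ _ (hlev v hv) h0 with hv' | hv'
      · exact absurd (hUself _ _ hv') hUv
      · exact hs₂ v hv'
  have nn₁ : ∀ v : ι → ℤ, ℓ ≤ v z → (¬ ∀ k ∈ J.erase z, β₂ k ≤ v k) → 0 ≤ alt a z ℓ v := by
    intro v hv hUv
    simpa using alt_nonneg h.finite hz (hU β₂) hsU₁ v hv hUv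
  have nn₂ : ∀ v : ι → ℤ, ℓ ≤ v z → (¬ ∀ k ∈ J.erase z, β₁ k ≤ v k) → alt a z ℓ v ≤ 0 := by
    intro v hv hUv
    simpa using alt_nonneg h.finite hz (hU β₁) hsU₂ v hv hUv
  -- the shadow of `β₂` lies in the shadow of `β₁`
  have hle : ∀ l ∈ J.erase z, β₁ l ≤ β₂ l := by
    intro l hl
    by_contra! hlt
    obtain ⟨k, hk⟩ : ((J.erase z).erase l).Nonempty := by
      rw [← Finset.card_pos, Finset.card_erase_of_mem hl, Finset.card_erase_of_mem hz]
      omega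
    obtain ⟨hkl, hk⟩ := Finset.mem_erase.1 hk
    have hkz := (Finset.mem_erase.1 hk).1
    have hlz := (Finset.mem_erase.1 hl).1
    set c : ι → ℤ := β₂ + Pi.single k (β₂ z - 1 - ℓ) - Pi.single z (β₂ z - ℓ) with hc
    have hcz : c z = ℓ := by simp [hc, hkz.symm]
    have hcl : c l = β₂ l := by simp [hc, hkl.symm, hlz]
    have hpos := alt_pos h.finite hz (hU β₁) hsU₂ (β := β₂)
      (by rw [ho.neg_one_zpow]; linarith) c hcz.ge
      (fun hh => absurd (hh l hl) (by omega))
      (fun i hi => by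
        have hiz : i ≠ z := fun he => hi (he ▸ hz)
        have hik : i ≠ k := fun he => hi (he ▸ (Finset.mem_erase.1 hk).2)
        simp [hc, hiz, hik])
      (by simp [hc, Finset.sum_add_distrib, Finset.sum_sub_distrib]; ring)
      (fun i hi => by
        simp only [hc, Pi.add_apply, Pi.sub_apply, Pi.single_apply,
          if_neg (Finset.mem_erase.1 hi).1]
        split_ifs <;> omega)
    rw [alt_of_eq hcz] at hpos
    obtain ⟨j, hj, hjk, hp, hlevel⟩ :=
      exists_pos_of_neg_of_level h.nonneg hℓ (by linarith) hcz hk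
    rw [← alt_of_eq (a := a) hlevel] at hp
    refine hp.not_ge (nn₂ _ hlevel.ge fun hh => ?_)
    have := hh l hl
    simp only [Pi.add_apply, Pi.sub_apply, Pi.single_apply, if_neg hkl.symm] at this
    split_ifs at this <;> omega
  have hsum₁₂ := sum_eq_add_sum_erase hz (v := β₂) (w := β₁) fun i hi =>
    ((h.eq_off_sum hβ₂ hα.ne).1 i hi).symm.trans ((h.eq_off_sum hβ₁ hα.ne).1 i hi)
  have hsα₁ := (h.eq_off_sum hβ₁ hα.ne).2
  have hsα₂ := (h.eq_off_sum hβ₂ hα.ne).2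
  have hq : ∑ k ∈ J.erase z, (β₂ k - β₁ k) = β₁ z - β₂ z := by omega
  have hqnn : 0 ≤ ∑ k ∈ J.erase z, (β₂ k - β₁ k) :=
    Finset.sum_nonneg fun k hk => sub_nonneg.2 (hle k hk)
  obtain ⟨x, hx, hxlt⟩ : ∃ x ∈ J.erase z, β₁ x < β₂ x := by
    by_contra! hh
    rw [Finset.sum_eq_zero fun k hk => sub_eq_zero.2 ((hh k hk).antisymm (hle k hk))] at hq
    have : β₁ z = β₂ z := by omega
    rw [this] at he
    exact (Int.not_even_iff_odd.2 ho) he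
  -- the quotient of the monomials is not a pure power
  obtain ⟨y, hy, hyx, hylt⟩ : ∃ y ∈ J.erase z, y ≠ x ∧ β₁ y < β₂ y := by
    by_contra! hh
    have hxz := (Finset.mem_erase.1 hx).1
    set u : ℕ → ι → ℤ := fun r => β₂ + Pi.single x (r : ℤ) - Pi.single z ((r : ℤ) + 1) with hu
    have huz : ∀ r, u r z = β₂ z - r - 1 := fun r => by simp [hu, hxz.symm]; ring
    have huj : ∀ r, ∀ j ∈ J.erase z, j ≠ x → u r j = β₂ j := fun r j hj hjx => by
      simp [hu, hjx, (Finset.mem_erase.1 hj).1]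
    by_cases hy0 : 0 ≤ alt a z ℓ (u 0)
    · have : 0 ≤ alt a z ℓ α := by
        refine level_induction (J := J) (z := z) (ℓ := ℓ) (Q := fun v => 0 ≤ alt a z ℓ v) h.finite
          (fun v hv => by simp [alt, hv]) (fun v hv ih => ?_) α hαz.ge
        by_cases hvβ : v + Pi.single z 1 = β₂
        · have : v = u 0 := by
            rw [hu, ← hvβ]
            simp
          rwa [this]
        · rw [alt_eq hz]
          refine add_nonneg ?_ (Finset.sum_nonneg ih)
          by_cases h0 : mulSum J a (v + Pi.single z 1) = 0
          · simp [h0]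
          · simpa using hs₁ v ((hZ _ (hlev v hv) h0).resolve_right hvβ)
      rw [alt_of_eq hαz] at this
      exact this.not_gt hα
    · have hray : ∀ r, ℓ ≤ u r z → alt a z ℓ (u r) < 0 := by
        intro r
        induction r with
        | zero => exact fun _ => not_le.1 hy0
        | succ r ih =>
          intro hr
          have h0 : mulSum J a (u (r + 1) + Pi.single z 1) = 0 := by
            by_contra hne
            have hx' : (u (r + 1) + Pi.single z 1 : ι → ℤ) x = β₂ x + r + 1 := by
              simp [hu, hxz]; ring
            rcases hZ _ (hlev _ hr) hne with he' | he' <;> rw [he'] at hx' <;> omega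
          have hstep : (u (r + 1) + Pi.single z 1 - Pi.single x 1 : ι → ℤ) = u r := by
            funext i
            simp only [hu, Pi.add_apply, Pi.sub_apply, Pi.single_apply]
            push_cast
            split_ifs <;> ring
          rw [alt_eq hz, h0, mul_zero, zero_add, Finset.sum_eq_single_of_mem x hx, hstep]
          · refine ih ?_
            rw [huz] at hr ⊢
            push_cast at hr
            omega
          · intro j hj hjx
            have hjz := (Finset.mem_erase.1 hj).1
            have hjval : (u (r + 1) + Pi.single z 1 - Pi.single j 1 : ι → ℤ) j = β₂ j - 1 := by
              simp [huj _ j hj hjx, hjz]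
            have hjle := hh j hj hjx
            have hlz : ℓ ≤ (u (r + 1) + Pi.single z 1 - Pi.single j 1 : ι → ℤ) z := by
              simp [hjz.symm]
              omega
            exact le_antisymm (nn₂ _ hlz fun hc => by have := hc j hj; omega)
              (nn₁ _ hlz fun hc => by have := hc j hj; omega)
      obtain ⟨r, hr⟩ := Int.eq_ofNat_of_zero_le (show 0 ≤ β₂ z - 1 - ℓ by omega)
      have hrz : u r z = ℓ := by rw [huz]; omega
      have hneg := hray r hrz.ge
      rw [alt_of_eq hrz] at hneg
      obtain ⟨j, hj, hjx, hp, hlevel⟩ := exists_pos_of_neg_of_level h.nonneg hℓ hneg hrz hx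
      rw [← alt_of_eq (a := a) hlevel] at hp
      refine hp.not_ge (nn₂ _ hlevel.ge fun hc => ?_)
      have h3 := hc j hj
      have h4 := hh j hj hjx
      simp [huj r j hj hjx, hjx] at h3
      omega
  -- the surviving monomials of degree `ℓ` in `x z`
  have hxz := (Finset.mem_erase.1 hx).1
  have hyz := (Finset.mem_erase.1 hy).1
  have hyx' : y ∈ (J.erase z).erase x := Finset.mem_erase.2 ⟨hyx, hy⟩
  have hqsplit : ∑ k ∈ J.erase z, (β₂ k - β₁ k) = (β₂ x - β₁ x) + ((β₂ y - β₁ y) +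
      ∑ k ∈ ((J.erase z).erase x).erase y, (β₂ k - β₁ k)) := by
    rw [Finset.add_sum_erase _ (fun k => β₂ k - β₁ k) hyx',
      Finset.add_sum_erase _ (fun k => β₂ k - β₁ k) hx]
  have hrest : 0 ≤ ∑ k ∈ ((J.erase z).erase x).erase y, (β₂ k - β₁ k) :=
    Finset.sum_nonneg fun k hk => sub_nonneg.2
      (hle k (Finset.mem_of_mem_erase (Finset.mem_of_mem_erase hk)))
  obtain ⟨e₁, he₁⟩ := he
  obtain ⟨o₁, ho₁⟩ := ho
  set D : ℤ := β₁ z - ℓ with hD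
  have hD3 : 3 ≤ D := by omega
  set pt : ι → ℤ → ι → ℤ := fun k s =>
    β₁ + Pi.single x s + Pi.single k (D - s) - Pi.single z D with hpt
  have hptz : ∀ k ∈ J.erase z, ∀ s, pt k s z = ℓ := fun k hk s => by
    simp [hpt, hxz.symm, (Finset.mem_erase.1 hk).1.symm, hD]
  have hptx : ∀ k, k ≠ x → ∀ s, pt k s x = β₁ x + s := fun k hk s => by
    simp [hpt, hxz, hk.symm]
  have hptk : ∀ k ∈ J.erase z, k ≠ x → ∀ s, pt k s k = β₁ k + (D - s) := fun k hk hkx s => by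
    simp [hpt, (Finset.mem_erase.1 hk).1, hkx]
  have hpto : ∀ k i, i ≠ z → i ≠ x → i ≠ k → ∀ s, pt k s i = β₁ i := fun k i hiz hix hik s => by
    simp [hpt, hiz, hix, hik]
  have hmem : ∀ k ∈ J.erase z, k ≠ x → ∀ s, 0 ≤ s → s ≤ D →
      (¬ ∀ m ∈ J.erase z, β₂ m ≤ pt k s m) → mulSum J a (pt k s) ≠ 0 := by
    intro k hk hkx s hs0 hsD hnot
    have hkz := (Finset.mem_erase.1 hk).1
    have hnot' : ∀ m, ¬ ∀ i ∈ J.erase z, β₂ i ≤ (pt k s - Pi.single m 1 : ι → ℤ) i := by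
      intro m hm
      refine hnot fun i hi => (hm i hi).trans ?_
      simp only [Pi.sub_apply, Pi.single_apply]
      split_ifs <;> omega
    have hlm : ∀ m ∈ J.erase z, (pt k s - Pi.single m 1 : ι → ℤ) z = ℓ := fun m hm => by
      simp [hptz k hk, (Finset.mem_erase.1 hm).1.symm]
    obtain ⟨i, hi, hile⟩ : ∃ i ∈ J.erase z,
        ∀ m ∈ J.erase z, β₁ m ≤ (pt k s - Pi.single i 1 : ι → ℤ) m := by
      have hall : ∀ m ∈ J.erase z, β₁ m ≤ pt k s m := by
        intro m hm
        simp only [hpt, Pi.add_apply, Pi.sub_apply, Pi.single_apply,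
          if_neg (Finset.mem_erase.1 hm).1]
        split_ifs <;> omega
      by_cases hs : 0 < s
      · refine ⟨x, hx, fun m hm => ?_⟩
        by_cases hmx : m = x
        · subst hmx
          have := hptx k hkx s
          simp
          omega
        · simpa [hmx] using hall m hm
      · refine ⟨k, hk, fun m hm => ?_⟩
        by_cases hmk : m = k
        · subst hmk
          have := hptk m hk hkx s
          simp
          omega
        · simpa [hmk] using hall m hm
    refine mulSum_ne_zero (Finset.mem_of_mem_erase hi) (fun m hm => ?_) ?_
    · by_cases hmz : m = z
      · subst hmz
        refine (by_contra fun hne => ?_ : a _ = 0).ge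
        have := hℓ _ hne
        simp [hptz k hk] at this
      · have hm' := Finset.mem_erase.2 ⟨hmz, hm⟩
        rw [← alt_of_eq (a := a) (hlm m hm')]
        exact nn₁ _ (hlm m hm').ge (hnot' m)
    · rw [← alt_of_eq (a := a) (hlm i hi), ← one_mul (alt a z ℓ _)]
      refine alt_pos h.finite hz (hU β₂) hsU₁ (β := β₁) ?_ _ (hlm i hi).ge (hnot' i) ?_ ?_ hile
      · rw [Even.neg_one_zpow ⟨e₁, he₁⟩, one_mul, one_mul]
        exact hp₁
      · intro m hm
        have hmz : m ≠ z := fun he => hm (he ▸ hz)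
        have hmk : m ≠ k := fun he => hm (he ▸ Finset.mem_of_mem_erase hk)
        have hmx : m ≠ x := fun he => hm (he ▸ Finset.mem_of_mem_erase hx)
        have hmi : m ≠ i := fun he => hm (he ▸ Finset.mem_of_mem_erase hi)
        simp [hmi, hpto k m hmz hmx hmk]
      · simp [hpt, Finset.sum_add_distrib, Finset.sum_sub_distrib]
  obtain ⟨t, ht0, htD, htnot⟩ : ∃ t, 0 < t ∧ t < D ∧ ¬ ∀ m ∈ J.erase z, β₂ m ≤ pt y t m := by
    by_contra! hh
    have a1 := hh 1 (by omega) (by omega)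
    have a2 := a1 x hx
    have a3 := hh (D - 1) (by omega) (by omega) y hy
    rw [hptx y hyx] at a2
    rw [hptk y hy hyx] at a3
    have : ∑ k ∈ ((J.erase z).erase x).erase y, (β₂ k - β₁ k) ≤ 0 := by
      refine Finset.sum_nonpos fun k hk => ?_
      obtain ⟨hky, hk⟩ := Finset.mem_erase.1 hk
      obtain ⟨hkx, hk⟩ := Finset.mem_erase.1 hk
      have a4 := a1 k hk
      rw [hpto y k (Finset.mem_erase.1 hk).1 hkx hky] at a4
      omega
    omega
  set R := ((J.erase z).erase x).erase y with hR
  set T : Finset (ι × ℤ) := R ×ˢ {0, 1, 2} ∪ {y} ×ˢ {0, t, D} with hT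
  have hTmem : ∀ q ∈ T, q.1 ∈ J.erase z ∧ q.1 ≠ x ∧ 0 ≤ q.2 ∧ q.2 ≤ D ∧
      (q.2 = D → q.1 = y) ∧ ¬ ∀ m ∈ J.erase z, β₂ m ≤ pt q.1 q.2 m := by
    rintro ⟨k, s⟩ hq
    simp only [hT, hR, Finset.mem_union, Finset.mem_product, Finset.mem_insert,
      Finset.mem_singleton] at hq
    rcases hq with ⟨hk, hs⟩ | ⟨rfl, hs⟩
    · obtain ⟨hky, hk⟩ := Finset.mem_erase.1 hk
      obtain ⟨hkx, hk⟩ := Finset.mem_erase.1 hk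
      refine ⟨hk, hkx, ?_, ?_, ?_, fun hc => ?_⟩
      · dsimp only; omega
      · dsimp only; omega
      · intro hsD
        dsimp only at hsD
        omega
      · have := hc y hy
        rw [hpto k y hyz hyx hky.symm] at this
        omega
    · refine ⟨hy, hyx, ?_, ?_, fun _ => rfl, ?_⟩
      · dsimp only; omega
      · dsimp only; omega
      · rcases hs with rfl | rfl | rfl
        · intro hc
          have := hc x hx
          rw [hptx _ hyx] at this
          omega
        · exact htnot
        · intro hc
          have := hc k hy
          rw [hptk _ hy hyx] at this
          omega
  have hTinj : Set.InjOn (fun q : ι × ℤ => pt q.1 q.2) T := by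
    rintro ⟨k, s⟩ hq ⟨k', s'⟩ hq' hqq
    obtain ⟨hk, hkx, -, hsD, hy1, -⟩ := hTmem _ hq
    obtain ⟨hk', hkx', -, -, hy2, -⟩ := hTmem _ hq'
    dsimp only at *
    have hss : s = s' := by
      have := congrFun hqq x
      rw [hptx k hkx, hptx k' hkx'] at this
      omega
    subst hss
    by_cases hs : s = D
    · rw [hy1 hs, hy2 hs]
    · by_contra hne
      have hkk : k ≠ k' := fun he => hne (by rw [he])
      have := congrFun hqq k
      rw [hptk k hk hkx, hpto k' k (Finset.mem_erase.1 hk).1 hkx hkk] at this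
      omega
  have hTcard : T.card = 3 * R.card + 3 := by
    have c1 : ({0, 1, 2} : Finset ℤ).card = 3 := by decide
    have c2 : ({0, t, D} : Finset ℤ).card = 3 := by
      rw [Finset.card_eq_three]
      exact ⟨0, t, D, by omega, by omega, by omega, rfl⟩
    rw [hT, Finset.card_union_of_disjoint, Finset.card_product, Finset.card_product, c1, c2,
      Finset.card_singleton]
    · ring
    · rw [Finset.disjoint_left]
      rintro ⟨k, s⟩ hq hq'
      rw [Finset.mem_product] at hq hq'
      exact (Finset.mem_erase.1 hq.1).1 (Finset.mem_singleton.1 hq'.1)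
  have hRcard : R.card + 3 = J.card := by
    have e1 : R.card + 1 = _ := Finset.card_erase_add_one hyx'
    have e2 := Finset.card_erase_add_one hx
    have e3 := Finset.card_erase_add_one hz
    omega
  rw [Set.ncard_eq_toFinset_card _ (finite_support_mulSum J h.finite)]
  have hsub : T.image (fun q : ι × ℤ => pt q.1 q.2) ∪ {β₁, β₂} ⊆
      (finite_support_mulSum J h.finite).toFinset := by
    intro β hβ
    rw [Set.Finite.mem_toFinset, Function.mem_support]
    rcases Finset.mem_union.1 hβ with hβ | hβ
    · obtain ⟨q, hq, rfl⟩ := Finset.mem_image.1 hβ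
      obtain ⟨q1, q2, q3, q4, -, q5⟩ := hTmem q hq
      exact hmem _ q1 q2 _ q3 q4 q5
    · rcases Finset.mem_insert.1 hβ with rfl | hβ
      · exact hβ₁
      · rwa [Finset.mem_singleton.1 hβ]
  have hdisj : Disjoint (T.image (fun q : ι × ℤ => pt q.1 q.2)) {β₁, β₂} := by
    rw [Finset.disjoint_left]
    intro β hβ hβ'
    obtain ⟨q, hq, rfl⟩ := Finset.mem_image.1 hβ
    have := hptz _ (hTmem q hq).1 q.2
    rcases Finset.mem_insert.1 hβ' with hβ' | hβ'
    · rw [hβ'] at this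
      omega
    · rw [Finset.mem_singleton.1 hβ'] at this
      omega
  have hne : β₁ ≠ β₂ := fun he => by
    rw [he] at hxlt
    exact lt_irrefl _ hxlt
  have := Finset.card_le_card hsub
  rw [Finset.card_union_of_disjoint hdisj, Finset.card_image_of_injOn hTinj,
    Finset.card_pair hne, hTcard] at this
  omega

end

section

variable {ι : Type*} {J : Finset ι} {a : (ι → ℤ) → ℝ} {z : ι} {ℓ : ℤ} [Fintype ι]

/-- If the lowest degree `ℓ` in `x z` carries a negative coefficient, then the degrees larger
than `ℓ` occurring in the product have both parities. -/
lemma NegFactor.exists_even_and_odd (h : NegFactor J a) (hz : z ∈ J) (hJ : 2 ≤ J.card)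
    (hℓ : ∀ v, a v ≠ 0 → ℓ ≤ v z) {α : ι → ℤ} (hα : a α < 0) (hαz : α z = ℓ) :
    (∃ β, ℓ < β z ∧ mulSum J a β ≠ 0 ∧ Even (β z - 1 - ℓ)) ∧
      ∃ β, ℓ < β z ∧ mulSum J a β ≠ 0 ∧ Odd (β z - 1 - ℓ) := by
  have hvz : ∀ v : ι → ℤ, (v + Pi.single z 1 : ι → ℤ) z - 1 - ℓ = v z - ℓ := by
    intro v
    simp
  have hlev : ∀ v : ι → ℤ, ℓ ≤ v z → ℓ < (v + Pi.single z 1 : ι → ℤ) z := by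
    intro v hv
    simp
    omega
  constructor
  · by_contra! hh
    obtain ⟨k, hk⟩ : (J.erase z).Nonempty := by
      rw [← Finset.card_pos, Finset.card_erase_of_mem hz]
      omega
    obtain ⟨j, -, -, hp, hlevel⟩ := exists_pos_of_neg_of_level h.nonneg hℓ hα hαz hk
    have := alt_nonneg (ε := -1) (U := fun _ => True) h.finite hz (fun _ _ _ _ => trivial)
      (fun v hv _ => ?_) _ hlevel.ge trivial
    · rw [alt_of_eq hlevel] at this
      linarith
    · by_cases h0 : mulSum J a (v + Pi.single z 1) = 0
      · simp [h0]
      · have hpar := hh _ (hlev v hv) h0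
        rw [hvz, Int.not_even_iff_odd] at hpar
        rw [hpar.neg_one_zpow]
        linarith [h.nonneg (v + Pi.single z 1)]
  · by_contra! hh
    have := alt_nonneg (ε := 1) (U := fun _ => True) h.finite hz (fun _ _ _ _ => trivial)
      (fun v hv _ => ?_) α hαz.ge trivial
    · rw [alt_of_eq hαz] at this
      linarith
    · by_cases h0 : mulSum J a (v + Pi.single z 1) = 0
      · simp [h0]
      · have hpar := hh _ (hlev v hv) h0
        rw [hvz, Int.not_odd_iff_even] at hpar
        rw [hpar.neg_one_zpow]
        linarith [h.nonneg (v + Pi.single z 1)]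

theorem NegFactor.three_mul_card_le (h : NegFactor J a) (hJ : 2 ≤ J.card) :
    3 * J.card ≤ (Function.support (mulSum J a)).ncard + 4 := by
  induction hn : J.card generalizing J a with
  | zero => omega
  | succ n ih =>
    rw [← hn]
    by_cases hb : ∀ l ∈ J, ∀ α, a α < 0 → ∃ v, a v ≠ 0 ∧ v l < α l
    · exact h.three_mul_card_le_of_interior hJ hb
    by_cases hJ2 : J.card = 2
    · have := h.card_le_ncard
      omega
    push Not at hb
    obtain ⟨z, hz, α, hα, hℓ⟩ := hb
    obtain ⟨⟨β₁, h1, hβ₁, he⟩, β₂, h2, hβ₂, ho⟩ :=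
      h.exists_even_and_odd hz hJ hℓ hα rfl
    by_cases hZ : ∀ β, α z < β z → mulSum J a β ≠ 0 → β = β₁ ∨ β = β₂
    · exact h.three_mul_card_le_of_odd hz (by omega) hℓ hα rfl hβ₁ hβ₂ h1 h2 hZ he ho
    push Not at hZ
    obtain ⟨β₃, h3, hβ₃, h31, h32⟩ := hZ
    have h12 : β₁ ≠ β₂ := fun h12 => by
      rw [h12] at he
      exact Int.not_even_iff_odd.2 ho he
    have hcard := Finset.card_erase_add_one hz
    have hle := ih (h.slice hz hℓ hα rfl) (by omega) (by omega)
    have hfin := finite_support_mulSum J h.finite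
    set Z := Function.support (mulSum (J.erase z) (_root_.slice a z (α z))) with hZdef
    have hZ : ∀ β ∈ Z, β z = α z ∧ mulSum J a β ≠ 0 := by
      intro β hβ
      rw [hZdef, Function.mem_support, mulSum_slice hz hℓ] at hβ
      simpa using hβ
    have hZfin : Z.Finite := hfin.subset fun β hβ => (hZ β hβ).2
    have hsub : Z ∪ ({β₁, β₂, β₃} : Finset (ι → ℤ)) ⊆ Function.support (mulSum J a) := by
      rintro β (hβ | hβ)
      · exact (hZ β hβ).2
      · simp only [Finset.coe_insert, Finset.coe_singleton, Set.mem_insert_iff,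
          Set.mem_singleton_iff] at hβ
        rcases hβ with rfl | rfl | rfl <;> assumption
    have hdisj : Disjoint Z ({β₁, β₂, β₃} : Finset (ι → ℤ)) := by
      rw [Set.disjoint_left]
      intro β hβ hβ'
      have := (hZ β hβ).1
      simp only [Finset.coe_insert, Finset.coe_singleton, Set.mem_insert_iff,
        Set.mem_singleton_iff] at hβ'
      rcases hβ' with rfl | rfl | rfl <;> omega
    have := Set.ncard_le_ncard hsub hfin
    rw [Set.ncard_union_eq hdisj hZfin (Finset.finite_toSet _), Set.ncard_coe_finset,
      Finset.card_eq_three.2 ⟨β₁, β₂, β₃, h12, h31.symm, h32.symm, rfl⟩] at this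
    omega

end

section
variable {n : ℕ}

/-- The exponent vector with entries `v i`. -/
def toExp (v : Fin n → ℤ) : Fin n →₀ ℕ := Finsupp.equivFunOnFinite.symm fun i => (v i).toNat

/-- The coefficients of the homogeneous part of degree `d` of `p`, extended by zero. -/
def homCoeff (p : MvPolynomial (Fin n) ℝ) (d : ℤ) (v : Fin n → ℤ) : ℝ :=
  if (∀ i, 0 ≤ v i) ∧ ∑ i, v i = d then coeff (toExp v) p else 0

lemma homCoeff_ne_zero {p : MvPolynomial (Fin n) ℝ} {d : ℤ} {v : Fin n → ℤ}
    (h : homCoeff p d v ≠ 0) : (∀ i, 0 ≤ v i) ∧ ∑ i, v i = d ∧ coeff (toExp v) p ≠ 0 := by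
  simpa [homCoeff, and_assoc] using h

lemma injOn_toExp : Set.InjOn (toExp (n := n)) {v | ∀ i, 0 ≤ v i} := by
  intro v hv w hw h
  funext i
  have := DFunLike.congr_fun h i
  simp only [toExp, Finsupp.equivFunOnFinite_symm_apply_apply] at this
  have := hv i
  have := hw i
  omega

lemma finite_support_homCoeff (p : MvPolynomial (Fin n) ℝ) (d : ℤ) :
    (Function.support (homCoeff p d)).Finite :=
  Set.Finite.of_finite_image
    (p.support.finite_toSet.subset (Set.image_subset_iff.2 fun v hv => by
      simpa using (homCoeff_ne_zero hv).2.2))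
    (injOn_toExp.mono fun v hv => (homCoeff_ne_zero hv).1)

lemma mulSum_eq {ι : Type*} [DecidableEq ι] (J : Finset ι) (a : (ι → ℤ) → ℝ) (β : ι → ℤ) :
    mulSum J a β = ∑ i ∈ J, a (β - Pi.single i 1) := by
  rw [mulSum]
  congr!

lemma mulSum_homCoeff (p : MvPolynomial (Fin n) ℝ) (d : ℤ) :
    mulSum Finset.univ (homCoeff p d) = homCoeff (p * ∑ i, X i) (d + 1) := by
  funext β
  rw [mulSum_eq]
  by_cases hβ : (∀ i, 0 ≤ β i) ∧ ∑ i, β i = d + 1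
  · rw [homCoeff, if_pos hβ, Finset.mul_sum, coeff_sum]
    refine Finset.sum_congr rfl fun i _ => ?_
    have hmem : i ∈ (toExp β).support ↔ 1 ≤ β i := by
      simp [toExp]
      omega
    have hsum : ∑ j, (β - Pi.single i 1 : Fin n → ℤ) j = d := by
      simp [Finset.sum_sub_distrib, hβ.2]
    rw [coeff_mul_X', homCoeff]
    simp only [hsum, and_true, hmem]
    have hiff : (∀ j, 0 ≤ (β - Pi.single i 1 : Fin n → ℤ) j) ↔ 1 ≤ β i := by
      refine ⟨fun h => by simpa using h i, fun h j => ?_⟩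
      have := hβ.1 j
      simp only [Pi.sub_apply, Pi.single_apply]
      split_ifs with hji
      · subst hji; omega
      · omega
    simp only [hiff]
    refine if_congr Iff.rfl ?_ rfl
    congr 1
    ext j
    simp only [toExp, Finsupp.equivFunOnFinite_symm_apply_apply, Finsupp.tsub_apply, Pi.sub_apply,
      Pi.single_apply, Finsupp.single_apply, eq_comm (a := i)]
    split_ifs <;> omega
  · rw [homCoeff, if_neg hβ]
    refine Finset.sum_eq_zero fun i _ => ?_
    rw [homCoeff, if_neg]
    rintro ⟨h0, hs⟩
    refine hβ ⟨fun j => (h0 j).trans ?_, ?_⟩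
    · simp only [Pi.sub_apply, Pi.single_apply]
      split_ifs <;> omega
    · simp [Finset.sum_sub_distrib] at hs
      omega

lemma ncard_support_homCoeff_le (p : MvPolynomial (Fin n) ℝ) (d : ℤ) :
    (Function.support (homCoeff p d)).ncard ≤ p.support.card := by
  rw [← Set.ncard_coe_finset]
  exact Set.ncard_le_ncard_of_injOn toExp
    (fun v hv => by simpa using (homCoeff_ne_zero hv).2.2)
    (injOn_toExp.mono fun v hv => (homCoeff_ne_zero hv).1) (Finset.finite_toSet _)

lemma negFactor_homCoeff {p : MvPolynomial (Fin n) ℝ} {m : Fin n →₀ ℕ} (hm : coeff m p < 0)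
    (hpos : ∀ m, 0 ≤ coeff m (p * ∑ i, X i)) :
    NegFactor Finset.univ (homCoeff p (∑ i, (m i : ℤ))) where
  finite := finite_support_homCoeff _ _
  eq_off _ _ _ _ i hi := absurd (Finset.mem_univ i) hi
  sum_eq _ _ hv hw := (homCoeff_ne_zero hv).2.1.trans (homCoeff_ne_zero hw).2.1.symm
  exists_neg := by
    refine ⟨fun i => m i, ?_⟩
    have : toExp (fun i => (m i : ℤ)) = m := by
      ext i
      simp [toExp]
    rwa [homCoeff, if_pos ⟨fun i => Int.natCast_nonneg _, rfl⟩, this]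
  nonneg β := by
    rw [mulSum_homCoeff, homCoeff]
    split_ifs
    exacts [hpos _, le_rfl]

end

end

/-- Corollary 1.4, first part: for any (not necessarily homogeneous) polynomial `A` in `n ≥ 2`
variables with a negative coefficient such that `A * S_n` has nonnegative coefficients,
`|supp(A * S_n)| ≥ 3n − 4`. -/
theorem stmt2 (n : ℕ) (hn : 2 ≤ n)
    (A : MvPolynomial (Fin n) ℝ)
    (hneg : ∃ m, coeff m A < 0)
    (S : MvPolynomial (Fin n) ℝ) (hS : S = ∑ i, X i)
    (hpos : ∀ m, 0 ≤ coeff m (A * S)) :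
    3 * n - 4 ≤ (A * S).support.card := by
  subst hS
  obtain ⟨m, hm⟩ := hneg
  have h := (negFactor_homCoeff hm hpos).three_mul_card_le (by simpa using hn)
  rw [mulSum_homCoeff, Finset.card_univ, Fintype.card_fin] at h
  exact Nat.sub_le_iff_le_add.2
    (h.trans (Nat.add_le_add_right (ncard_support_homCoeff_le _ _) 4))
end

section
/- Let 2 ≤ n ≤ 6 and let κ₀ be the largest integer κ with κ(κ+1)/2 < n. If A is any polynomial with real coefficients in the variables x_1,…,x_n such that A·S_n is coefficientwise nonnegative, and R := |supp(A·S_n)|, then either R ≥ (κ₀+1)n − κ₀(κ₀+1)/2 − 1, or there exists an integer κ with 0 ≤ κ ≤ κ₀ such that κn − κ(κ−1)/2 ≤ R ≤ κn. -/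
open MvPolynomial

/-- The coefficient at `γ` of the product of the Laurent polynomial with coefficients `a` and
the linear form `∑ i ∈ J, x i`. -/
def mulSumCoeff {ι : Type*} [DecidableEq ι] (J : Finset ι) (a : (ι → ℤ) → ℝ) (γ : ι → ℤ) : ℝ :=
  ∑ i ∈ J, a (γ - Pi.single i 1)

/-- The coordinates in `J` in which `γ` exceeds `β`. -/
def excess {ι : Type*} (J : Finset ι) (β γ : ι → ℤ) : Finset ι :=
  {i ∈ J | β i < γ i}

section Combinatorics

lemma card_le_card_filter_exists {ι κ : Type*} {K : Finset κ} {T : Finset ι} {r : ι → κ → Prop}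
    [DecidablePred fun x => ∃ i ∈ K, r x i]
    (hr : ∀ x i j, r x i → r x j → i = j) (hK : ∀ i ∈ K, ∃ x ∈ T, r x i) :
    K.card ≤ (T.filter fun x => ∃ i ∈ K, r x i).card := by
  rcases K.eq_empty_or_nonempty with rfl | ⟨k, hk⟩
  · simp
  have : Nonempty ι := (hK k hk).nonempty
  choose! g hgT hgr using hK
  refine Finset.card_le_card_of_injOn g (fun i hi => ?_) fun i hi j hj hij => ?_
  · simpa using ⟨hgT i hi, i, hi, hgr i hi⟩
  · exact hr (g i) i j (hgr i hi) (hij ▸ hgr j hj)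

variable {ι : Type*} [DecidableEq ι]

/-- If `f` has no fixed points then two elements of `U` can be chosen so that neither is joined
to another element of `U` by a two-cycle of `f`. -/
lemma exists_pair_no_two_cycle {f : ι → ι} {U : Finset ι}
    (hf : ∀ i ∈ U, f i ≠ i) (hU : 2 ≤ U.card) :
    ∃ c ∈ U, ∃ d ∈ U, c ≠ d ∧ ∀ i ∈ U, i ≠ c → i ≠ d →
      (f i ≠ c ∨ f c ≠ i) ∧ (f i ≠ d ∨ f d ≠ i) := by
  by_cases h : ∃ c ∈ U, f c ∈ U ∧ f (f c) = c
  · obtain ⟨c, hc, hfc, hcc⟩ := h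
    exact ⟨c, hc, f c, hfc, (hf c hc).symm, fun i _ hic hid =>
      ⟨Or.inr hid.symm, Or.inr (hcc.trans_ne hic.symm)⟩⟩
  · obtain ⟨c, hc, d, hd, hcd⟩ := Finset.one_lt_card.mp hU
    refine ⟨c, hc, d, hd, hcd, fun i hi _ _ => ⟨?_, ?_⟩⟩ <;>
    · by_contra! hcon
      exact h ⟨i, hi, by rw [hcon.1]; assumption, by rw [hcon.1, hcon.2]⟩

lemma two_mul_card_le_of_no_fixedPoint {f : ι → ι} {J O : Finset ι} {M : Finset (Finset ι)}
    (hf : ∀ i ∈ J, f i ≠ i)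
    (hM : ∀ i ∈ J, ∀ j ∈ J, i ≠ j → j ∉ O → f i ≠ j → {i, j} ∈ M)
    (hU : 2 ≤ (J \ O).card) : 2 * J.card ≤ O.card + M.card + 4 := by
  obtain ⟨c, hc, d, hd, hcd, h⟩ :=
    exists_pair_no_two_cycle (fun i hi => hf i (Finset.mem_sdiff.mp hi).1) hU
  simp only [Finset.mem_sdiff] at hc hd h
  set W := (J.erase c).erase d with hW
  have hWc : W.card + 2 = J.card := by
    rw [hW, Finset.card_erase_of_mem (by simp [hd.1, hcd.symm]), Finset.card_erase_of_mem hc.1]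
    have : 1 < J.card := Finset.one_lt_card.mpr ⟨c, hc.1, d, hd.1, hcd⟩
    omega
  have hpair : ∀ e : ι, Set.InjOn (fun i => ({i, e} : Finset ι)) {i | i ≠ e} := by
    intro e i hi j hj hij
    have : i ∈ ({j, e} : Finset ι) := by
      rw [← show ({i, e} : Finset ι) = {j, e} from hij]; simp
    simp only [Finset.mem_insert, Finset.mem_singleton] at this
    exact this.resolve_right hi
  have hO : (W.filter (· ∈ O)).card ≤ O.card :=
    Finset.card_le_card fun i hi => (Finset.mem_filter.mp hi).2
  have hMcd : (W.filter fun i => {i, c} ∈ M).card + (W.filter fun i => {i, d} ∈ M).card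
      ≤ M.card := by
    rw [← Finset.card_image_of_injOn (s := W.filter fun i => {i, c} ∈ M)
        ((hpair c).mono fun i hi => by simp_all),
      ← Finset.card_image_of_injOn (s := W.filter fun i => {i, d} ∈ M)
        ((hpair d).mono fun i hi => by simp_all),
      ← Finset.card_union_of_disjoint]
    · refine Finset.card_le_card fun s hs => ?_
      simp only [Finset.mem_union, Finset.mem_image, Finset.mem_filter] at hs
      rcases hs with ⟨i, hi, rfl⟩ | ⟨i, hi, rfl⟩
      exacts [hi.2, hi.2]
    · refine Finset.disjoint_left.mpr fun s hs hs' => ?_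
      simp only [Finset.mem_image, Finset.mem_filter] at hs hs'
      obtain ⟨i, hi, rfl⟩ := hs
      obtain ⟨j, hj, hij⟩ := hs'
      have : d ∈ ({i, c} : Finset ι) := by rw [← hij]; simp
      simp only [Finset.mem_insert, Finset.mem_singleton] at this
      rcases this with rfl | rfl
      · simp [hW] at hi
      · exact hcd rfl
  have hsum : ∑ _i ∈ W, 2 ≤ ∑ i ∈ W, ((if i ∈ O then 1 else 0) +
      ((if ({i, c} : Finset ι) ∈ M then 1 else 0) + if ({i, d} : Finset ι) ∈ M then 1 else 0)) := by
    refine Finset.sum_le_sum fun i hi => ?_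
    simp only [hW, Finset.mem_erase] at hi
    obtain ⟨hid, hic, hiJ⟩ := hi
    by_cases hiO : i ∈ O
    · by_cases hfi : f i = c
      · have := hM i hiJ d hd.1 hid hd.2 (hfi.trans_ne hcd)
        simp [hiO, this]; omega
      · have := hM i hiJ c hc.1 hic hc.2 hfi
        simp [hiO, this]; omega
    · have key : ∀ e ∈ J, e ∉ O → i ≠ e → (f i ≠ e ∨ f e ≠ i) → ({i, e} : Finset ι) ∈ M := by
        rintro e he heO hie (hfe | hfe)
        · exact hM i hiJ e he hie heO hfe
        · rw [Finset.pair_comm]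
          exact hM e he i hiJ hie.symm hiO hfe
      obtain ⟨h1, h2⟩ := h i ⟨hiJ, hiO⟩ hic hid
      simp [key c hc.1 hc.2 hic h1, key d hd.1 hd.2 hid h2]
  simp only [Finset.sum_add_distrib, ← Finset.card_filter, Finset.sum_const, smul_eq_mul] at hsum
  omega

end Combinatorics

section SignedCoefficients

variable {ι : Type*} [DecidableEq ι] {J : Finset ι} {a : (ι → ℤ) → ℝ}

/-- Following the terms of `a` in direction `j` leads to a term of the product; the parity of
the number of steps is determined by the sign of the initial coefficient. -/
lemma exists_mulSumCoeff_ne_zero_of_ne_zero (hfin : a.support.Finite)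
    (hp : ∀ γ, 0 ≤ mulSumCoeff J a γ) {j : ι} (hj : j ∈ J) (α : ι → ℤ) :
    (0 < a α → ∃ γ, mulSumCoeff J a γ ≠ 0 ∧ Odd (γ j - α j) ∧ α j < γ j ∧
      ∀ l, l ≠ j → γ l ≤ α l) ∧
    (a α < 0 → ∃ γ, mulSumCoeff J a γ ≠ 0 ∧ Even (γ j - α j) ∧ α j < γ j ∧
      ∀ l, l ≠ j → γ l ≤ α l) := by
  obtain ⟨B, hB⟩ := (hfin.image fun α => α j).bddAbove
  have hB' : ∀ α, a α ≠ 0 → α j ≤ B := fun α hα => hB ⟨α, hα, rfl⟩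
  obtain ⟨k, hk⟩ : ∃ k : ℕ, B - α j < k := ⟨(B - α j + 1).toNat, by omega⟩
  induction k generalizing α with
  | zero =>
    have := hB' α
    constructor <;> intro h
    · have := this h.ne'; omega
    · have := this h.ne; omega
  | succ k ih =>
    have hsum : mulSumCoeff J a (α + Pi.single j 1) =
        a α + ∑ l ∈ J.erase j, a (α + Pi.single j 1 - Pi.single l 1) := by
      rw [mulSumCoeff, ← Finset.add_sum_erase _ _ hj, add_sub_cancel_right]
    have hstep : ∀ l, l ≠ j → (α + Pi.single j 1 - Pi.single l 1 : ι → ℤ) j = α j + 1 := by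
      intro l hl; simp [hl.symm]
    have hle : ∀ l m, m ≠ j → (α + Pi.single j 1 - Pi.single l 1 : ι → ℤ) m ≤ α m := by
      intro l m hm
      by_cases hlm : m = l
      · subst hlm; simp [hm]
      · simp [hm, hlm]
    constructor
    · intro hα
      by_cases h0 : mulSumCoeff J a (α + Pi.single j 1) = 0
      · have : ∑ l ∈ J.erase j, a (α + Pi.single j 1 - Pi.single l 1) < 0 := by linarith
        obtain ⟨l, hl, hneg⟩ := Finset.exists_lt_of_sum_lt (by simpa using this :
          _ < ∑ l ∈ J.erase j, (0 : ℝ))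
        have hlj := (Finset.mem_erase.mp hl).1
        obtain ⟨γ, h1, h2, h3, h4⟩ := (ih _ (by rw [hstep l hlj]; push_cast at hk; omega)).2 hneg
        rw [hstep l hlj] at h2 h3
        refine ⟨γ, h1, ?_, by omega, fun m hm => (h4 m hm).trans (hle l m hm)⟩
        rw [Int.even_iff] at h2; rw [Int.odd_iff]; omega
      · exact ⟨_, h0, by simp, by simp, fun l hl => by simp [hl]⟩
    · intro hα
      have := hp (α + Pi.single j 1)
      have : 0 < ∑ l ∈ J.erase j, a (α + Pi.single j 1 - Pi.single l 1) := by linarith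
      obtain ⟨l, hl, hpos⟩ := Finset.exists_lt_of_sum_lt (by simpa using this :
          ∑ l ∈ J.erase j, (0 : ℝ) < _)
      have hlj := (Finset.mem_erase.mp hl).1
      obtain ⟨γ, h1, h2, h3, h4⟩ := (ih _ (by rw [hstep l hlj]; push_cast at hk; omega)).1 hpos
      rw [hstep l hlj] at h2 h3
      refine ⟨γ, h1, ?_, by omega, fun m hm => (h4 m hm).trans (hle l m hm)⟩
      rw [Int.odd_iff] at h2; rw [Int.even_iff]; omega

lemma exists_neighbor_pos (hp : ∀ γ, 0 ≤ mulSumCoeff J a γ) {β : ι → ℤ} (hβ : a β < 0)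
    {i : ι} (hi : i ∈ J) :
    ∃ f ∈ J, f ≠ i ∧ 0 < a (β + Pi.single i 1 - Pi.single f 1) := by
  have h := hp (β + Pi.single i 1)
  rw [mulSumCoeff, ← Finset.add_sum_erase _ _ hi, add_sub_cancel_right] at h
  obtain ⟨f, hf, hpos⟩ := Finset.exists_lt_of_sum_lt (by simp; linarith :
    ∑ l ∈ J.erase i, (0 : ℝ) < ∑ l ∈ J.erase i, a (β + Pi.single i 1 - Pi.single l 1))
  exact ⟨f, (Finset.mem_erase.mp hf).2, (Finset.mem_erase.mp hf).1, hpos⟩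

lemma exists_excess_eq_singleton (hfin : a.support.Finite)
    (hp : ∀ γ, 0 ≤ mulSumCoeff J a γ) {β : ι → ℤ} (hβ : a β < 0) {i : ι} (hi : i ∈ J) :
    ∃ γ, mulSumCoeff J a γ ≠ 0 ∧ excess J β γ = {i} ∧ Even (γ i - β i) := by
  obtain ⟨γ, h1, h2, h3, h4⟩ := (exists_mulSumCoeff_ne_zero_of_ne_zero hfin hp hi β).2 hβ
  refine ⟨γ, h1, ?_, h2⟩
  ext l
  simp only [excess, Finset.mem_filter, Finset.mem_singleton]
  constructor
  · rintro ⟨_, h⟩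
    by_contra hl
    exact absurd (h4 l hl) (not_le.mpr h)
  · rintro rfl
    exact ⟨hi, h3⟩

lemma exists_excess_of_neighbor (hfin : a.support.Finite)
    (hp : ∀ γ, 0 ≤ mulSumCoeff J a γ) {β : ι → ℤ} {i j f : ι} (hi : i ∈ J) (hj : j ∈ J)
    (hij : i ≠ j) (hfj : f ≠ j) (hpos : 0 < a (β + Pi.single i 1 - Pi.single f 1)) :
    ∃ γ, mulSumCoeff J a γ ≠ 0 ∧
      (excess J β γ = {j} ∧ Odd (γ j - β j) ∨ excess J β γ = {i, j}) := by
  obtain ⟨γ, h1, h2, h3, h4⟩ := (exists_mulSumCoeff_ne_zero_of_ne_zero hfin hp hj _).1 hpos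
  have hje : (β + Pi.single i 1 - Pi.single f 1 : ι → ℤ) j = β j := by
    simp [hij.symm, hfj.symm]
  rw [hje] at h2 h3
  have h5 : ∀ l, l ≠ j → l ≠ i → γ l ≤ β l := by
    intro l hlj hli
    refine (h4 l hlj).trans ?_
    by_cases hlf : l = f
    · subst hlf; simp [hli]
    · simp [hli, hlf]
  refine ⟨γ, h1, ?_⟩
  by_cases hγi : β i < γ i
  · right
    ext l
    simp only [excess, Finset.mem_filter, Finset.mem_insert, Finset.mem_singleton]
    constructor
    · rintro ⟨_, h⟩
      by_contra! hl
      exact absurd (h5 l hl.2 hl.1) (not_le.mpr h)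
    · rintro (rfl | rfl)
      exacts [⟨hi, hγi⟩, ⟨hj, h3⟩]
  · left
    refine ⟨?_, h2⟩
    ext l
    simp only [excess, Finset.mem_filter, Finset.mem_singleton]
    constructor
    · rintro ⟨_, h⟩
      by_contra hl
      by_cases hli : l = i
      · exact hγi (hli ▸ h)
      · exact absurd (h5 l hl hli) (not_le.mpr h)
    · rintro rfl
      exact ⟨hj, h3⟩

open Classical in
/-- The directions `j` for which `T` has an element exceeding `β` only in the coordinate `j`,
by an odd amount. -/
noncomputable def oddDirections (J : Finset ι) (T : Finset (ι → ℤ)) (β : ι → ℤ) : Finset ι :=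
  {j ∈ J | ∃ γ ∈ T, excess J β γ = {j} ∧ Odd (γ j - β j)}

variable {T : Finset (ι → ℤ)}

open Classical in
lemma card_add_card_oddDirections_le (hfin : a.support.Finite)
    (hp : ∀ γ, 0 ≤ mulSumCoeff J a γ) (hT : ∀ γ, γ ∈ T ↔ mulSumCoeff J a γ ≠ 0)
    {β : ι → ℤ} (hβ : a β < 0) {K : Finset ι} (hK : K ⊆ J) :
    K.card + (K ∩ oddDirections J T β).card ≤
      (T.filter fun γ => ∃ i ∈ K, excess J β γ = {i}).card := by
  have h1 : K.card ≤
      (T.filter fun γ => ∃ i ∈ K, excess J β γ = {i} ∧ Even (γ i - β i)).card := by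
    refine card_le_card_filter_exists (r := fun γ i => excess J β γ = {i} ∧ Even (γ i - β i))
      (fun γ i j hi hj => Finset.singleton_injective (hi.1.symm.trans hj.1)) fun i hi => ?_
    · obtain ⟨γ, h⟩ := exists_excess_eq_singleton hfin hp hβ (hK hi)
      exact ⟨γ, (hT γ).mpr h.1, h.2⟩
  have h2 : (K ∩ oddDirections J T β).card ≤ (T.filter fun γ => ∃ i ∈ K ∩ oddDirections J T β,
      excess J β γ = {i} ∧ Odd (γ i - β i)).card := by
    refine card_le_card_filter_exists (r := fun γ i => excess J β γ = {i} ∧ Odd (γ i - β i))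
      (fun γ i j hi hj => Finset.singleton_injective (hi.1.symm.trans hj.1)) fun i hi => ?_
    · simp only [oddDirections, Finset.mem_inter, Finset.mem_filter] at hi
      exact hi.2.2
  refine (add_le_add h1 h2).trans ?_
  rw [← Finset.card_union_of_disjoint]
  · refine Finset.card_le_card fun γ hγ => ?_
    simp only [Finset.mem_union, Finset.mem_filter, Finset.mem_inter] at hγ ⊢
    rcases hγ with ⟨h, i, hi, h'⟩ | ⟨h, i, hi, h'⟩
    exacts [⟨h, i, hi, h'.1⟩, ⟨h, i, hi.1, h'.1⟩]
  · refine Finset.disjoint_left.mpr fun γ hγ hγ' => ?_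
    simp only [Finset.mem_filter] at hγ hγ'
    obtain ⟨_, i, _, hi, heven⟩ := hγ
    obtain ⟨_, j, _, hj, hodd⟩ := hγ'
    obtain rfl := Finset.singleton_injective (hi.symm.trans hj)
    exact Int.not_even_iff_odd.mpr hodd heven

lemma three_mul_card_le_of_two_le_card_sdiff (hfin : a.support.Finite)
    (hp : ∀ γ, 0 ≤ mulSumCoeff J a γ) (hT : ∀ γ, γ ∈ T ↔ mulSumCoeff J a γ ≠ 0)
    {β : ι → ℤ} (hβ : a β < 0) (hU : 2 ≤ (J \ oddDirections J T β).card) :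
    3 * J.card ≤ T.card + 4 := by
  classical
  have hf : ∀ i ∈ J, ∃ f ∈ J, f ≠ i ∧ 0 < a (β + Pi.single i 1 - Pi.single f 1) :=
    fun i hi => exists_neighbor_pos hp hβ hi
  have : Nonempty ι := by
    obtain ⟨i, _⟩ := Finset.card_pos.mp (zero_lt_two.trans_le hU)
    exact ⟨i⟩
  choose! f hfJ hfne hfpos using hf
  have hM := two_mul_card_le_of_no_fixedPoint (O := oddDirections J T β)
    (M := (T.image (excess J β)).filter fun s => s.card = 2) hfne (fun i hi j hj hij hjO hfj => by
      obtain ⟨γ, hγ, h | h⟩ := exists_excess_of_neighbor hfin hp hi hj hij hfj (hfpos i hi)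
      · exact absurd (Finset.mem_filter.mpr ⟨hj, γ, (hT γ).mpr hγ, h⟩) hjO
      · exact Finset.mem_filter.mpr ⟨Finset.mem_image.mpr ⟨γ, (hT γ).mpr hγ, h⟩,
          Finset.card_pair hij⟩) hU
  have hpairs : ((T.image (excess J β)).filter fun s => s.card = 2).card ≤
      (T.filter fun γ => (excess J β γ).card = 2).card := by
    rw [Finset.filter_image]
    exact Finset.card_image_le
  have hsingle := card_add_card_oddDirections_le hfin hp hT hβ subset_rfl
  have hsub : oddDirections J T β ⊆ J := Finset.filter_subset _ _
  rw [Finset.inter_eq_right.mpr hsub] at hsingle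
  have hdisj : (T.filter fun γ => ∃ i ∈ J, excess J β γ = {i}).card +
      (T.filter fun γ => (excess J β γ).card = 2).card ≤ T.card := by
    rw [← Finset.card_union_of_disjoint]
    · exact Finset.card_le_card
        (Finset.union_subset (Finset.filter_subset _ _) (Finset.filter_subset _ _))
    · refine Finset.disjoint_left.mpr fun γ hγ hγ' => ?_
      simp only [Finset.mem_filter] at hγ hγ'
      obtain ⟨_, i, _, hi⟩ := hγ
      simp [hi] at hγ'
  omega

/-- If some term of `a` lies below all negative terms in the direction `q`, then its translates
supply the terms missing from the count of terms exceeding `β` in a single coordinate. -/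
lemma three_mul_card_le_of_lt (hfin : a.support.Finite)
    (hp : ∀ γ, 0 ≤ mulSumCoeff J a γ) (hT : ∀ γ, γ ∈ T ↔ mulSumCoeff J a γ ≠ 0)
    {d : ℤ} (hd : ∀ α, a α ≠ 0 → ∑ i ∈ J, α i = d) {β μ : ι → ℤ} (hβ : a β < 0)
    (hU : (J \ oddDirections J T β).card ≤ 1) {q : ι} (hq : q ∈ J)
    (hmin : ∀ α, a α < 0 → β q ≤ α q) (hμ : a μ ≠ 0) (hμβ : μ q < β q) :
    3 * J.card ≤ T.card + 4 := by
  classical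
  have hnonneg : ∀ α, α q < β q → 0 ≤ a α := fun α hα => by
    by_contra! h
    exact absurd (hmin α h) (not_le.mpr hα)
  obtain ⟨j, hj, hjβ⟩ : ∃ j ∈ J, β j < μ j := by
    by_contra! h
    exact (Finset.sum_lt_sum h ⟨q, hq, hμβ⟩).ne ((hd μ hμ).trans (hd β hβ.ne).symm)
  have htrans : (J.erase q).card ≤ (T.filter fun γ => β j < γ j).card := by
    refine Finset.card_le_card_of_injOn (fun l => μ + Pi.single l 1) (fun l hl => ?_)
      fun l _ m _ hlm => ?_
    · rw [Finset.mem_coe, Finset.mem_erase] at hl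
      rw [Finset.mem_coe, Finset.mem_filter, hT]
      constructor
      · refine (Finset.sum_pos' (fun m _ => hnonneg _ ?_) ⟨l, hl.2, ?_⟩).ne'
        · have : (0 : ℤ) ≤ (Pi.single m 1 : ι → ℤ) q := by
            by_cases h : q = m
            · subst h; simp
            · simp [h]
          simp only [Pi.add_apply, Pi.sub_apply, Pi.single_eq_of_ne hl.1.symm]
          omega
        · rw [add_sub_cancel_right]
          exact (hnonneg μ hμβ).lt_of_ne hμ.symm
      · have : (0 : ℤ) ≤ (Pi.single l 1 : ι → ℤ) j := by
          by_cases h : j = l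
          · subst h; simp
          · simp [h]
        simp only [Pi.add_apply]
        omega
    · have h := congrFun (add_left_cancel hlm) l
      by_contra hne
      simp [hne] at h
  have hsingle := card_add_card_oddDirections_le hfin hp hT hβ (Finset.erase_subset j J)
  have hO : (J.erase j).card ≤ (J.erase j ∩ oddDirections J T β).card + 1 := by
    have h := Finset.card_inter_add_card_sdiff (J.erase j) (oddDirections J T β)
    have h' := Finset.card_le_card
      (Finset.sdiff_subset_sdiff (Finset.erase_subset j J) (subset_refl (oddDirections J T β)))
    omega
  have hdisj : (T.filter fun γ => ∃ i ∈ J.erase j, excess J β γ = {i}).card +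
      (T.filter fun γ => β j < γ j).card ≤ T.card := by
    rw [← Finset.card_union_of_disjoint]
    · exact Finset.card_le_card
        (Finset.union_subset (Finset.filter_subset _ _) (Finset.filter_subset _ _))
    · refine Finset.disjoint_left.mpr fun γ hγ hγ' => ?_
      simp only [Finset.mem_filter] at hγ hγ'
      obtain ⟨_, i, hi, hi'⟩ := hγ
      have : j ∈ excess J β γ := Finset.mem_filter.mpr ⟨hj, hγ'.2⟩
      rw [hi', Finset.mem_singleton] at this
      exact (Finset.mem_erase.mp hi).1 this.symm
  rw [Finset.card_erase_of_mem hq] at htrans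
  rw [Finset.card_erase_of_mem hj] at hO hsingle
  omega

/-- If all but at most two terms of the product lie in the lowest slice, for every direction,
then the product has few terms. -/
lemma two_mul_card_le_of_card_filter_le_two
    (hT : ∀ γ, γ ∈ T ↔ mulSumCoeff J a γ ≠ 0)
    {d : ℤ} (hd : ∀ α, a α ≠ 0 → ∑ i ∈ J, α i = d)
    {c : ι → ℤ} (hc : ∀ α, a α ≠ 0 → ∀ i, i ∉ J → α i = c i)
    {m : ι → ℤ} (hm : ∀ α, a α ≠ 0 → ∀ i ∈ J, m i ≤ α i)
    (htwo : ∀ q ∈ J, (T.filter fun γ => m q < γ q).card ≤ 2) :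
    2 * T.card ≤ 3 * J.card := by
  have hmem : ∀ γ ∈ T, ∃ l ∈ J, a (γ - Pi.single l 1) ≠ 0 := fun γ hγ =>
    Finset.exists_ne_zero_of_sum_ne_zero ((hT γ).mp hγ)
  have hlow : ∀ γ ∈ T, ∀ i ∈ J, m i ≤ γ i := by
    intro γ hγ i hi
    obtain ⟨l, _, hl⟩ := hmem γ hγ
    have h := hm _ hl i hi
    have : (0 : ℤ) ≤ (Pi.single l 1 : ι → ℤ) i := by
      by_cases h : i = l
      · subst h; simp
      · simp [h]
    simp only [Pi.sub_apply] at h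
    omega
  have hone : ∀ γ ∈ T, 1 ≤ (excess J m γ).card := by
    intro γ hγ
    obtain ⟨l, hlJ, hl⟩ := hmem γ hγ
    have h := hm _ hl l hlJ
    simp only [Pi.sub_apply, Pi.single_eq_same] at h
    exact Finset.card_pos.mpr ⟨l, Finset.mem_filter.mpr ⟨hlJ, by omega⟩⟩
  have hoff : ∀ γ ∈ T, ∀ i, i ∉ J → γ i = c i := by
    intro γ hγ i hi
    obtain ⟨l, hlJ, hl⟩ := hmem γ hγ
    have h := hc _ hl i hi
    have hil : i ≠ l := fun h => hi (h ▸ hlJ)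
    simpa [hil] using h
  have hdeg : ∀ γ ∈ T, ∑ i ∈ J, γ i = d + 1 := by
    intro γ hγ
    obtain ⟨l, hlJ, hl⟩ := hmem γ hγ
    have h := hd _ hl
    have hl1 : ∑ i ∈ J, (Pi.single l 1 : ι → ℤ) i = 1 := by simp [Pi.single_apply, hlJ]
    simp only [Pi.sub_apply, Finset.sum_sub_distrib, hl1] at h
    omega
  have hsingles : (T.filter fun γ => (excess J m γ).card = 1).card ≤ J.card := by
    rw [← Nat.choose_one_right J.card, ← Finset.card_powersetCard]
    refine Finset.card_le_card_of_injOn (excess J m) (fun γ hγ => ?_) fun γ hγ γ' hγ' h => ?_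
    · exact Finset.mem_coe.mpr (Finset.mem_powersetCard.mpr
        ⟨Finset.filter_subset _ _, (Finset.mem_filter.mp hγ).2⟩)
    · obtain ⟨hγT, hcard⟩ := Finset.mem_filter.mp hγ
      have hγT' := (Finset.mem_filter.mp hγ').1
      obtain ⟨q, hq⟩ := Finset.card_eq_one.mp hcard
      have heq : ∀ δ ∈ T, excess J m δ = {q} → ∀ i ∈ J, i ≠ q → δ i = m i := by
        intro δ hδ hδq i hi hiq
        refine le_antisymm ?_ (hlow δ hδ i hi)
        by_contra! hlt
        have : i ∈ excess J m δ := Finset.mem_filter.mpr ⟨hi, hlt⟩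
        rw [hδq, Finset.mem_singleton] at this
        exact hiq this
      have hqJ : q ∈ J := (Finset.mem_filter.mp (hq ▸ Finset.mem_singleton_self q :
        q ∈ excess J m γ)).1
      have hother : ∀ i ∈ J, i ≠ q → γ i = γ' i := fun i hi hiq =>
        (heq γ hγT hq i hi hiq).trans (heq γ' hγT' (h ▸ hq) i hi hiq).symm
      have hsum := (hdeg γ hγT).trans (hdeg γ' hγT').symm
      rw [← Finset.add_sum_erase _ _ hqJ, ← Finset.add_sum_erase _ _ hqJ,
        Finset.sum_congr rfl fun i hi => hother i (Finset.mem_erase.mp hi).2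
          (Finset.mem_erase.mp hi).1, add_left_inj] at hsum
      funext i
      by_cases hiJ : i ∈ J
      · by_cases hiq : i = q
        · exact hiq ▸ hsum
        · exact hother i hiJ hiq
      · rw [hoff γ hγT i hiJ, hoff γ' hγT' i hiJ]
  have hdouble : ∑ γ ∈ T, (excess J m γ).card = ∑ q ∈ J, (T.filter fun γ => m q < γ q).card := by
    simp only [excess, Finset.card_filter]
    exact Finset.sum_comm
  have hupper : ∑ q ∈ J, (T.filter fun γ => m q < γ q).card ≤ J.card * 2 :=
    Finset.sum_le_card_nsmul _ _ _ htwo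
  have hlower : ∑ _γ ∈ T, 2 ≤
      ∑ γ ∈ T, ((excess J m γ).card + if (excess J m γ).card = 1 then 1 else 0) := by
    refine Finset.sum_le_sum fun γ hγ => ?_
    have := hone γ hγ
    split_ifs <;> omega
  rw [Finset.sum_add_distrib, ← Finset.card_filter, Finset.sum_const, smul_eq_mul] at hlower
  omega

/-- If a homogeneous Laurent polynomial with a negative coefficient has a coefficientwise
nonnegative product with a sum of `n` variables, then the product has at least `3n - 4` terms. -/
theorem three_mul_card_le_of_neg_of_homogeneous (hfin : a.support.Finite)
    (hp : ∀ γ, 0 ≤ mulSumCoeff J a γ) (hT : ∀ γ, γ ∈ T ↔ mulSumCoeff J a γ ≠ 0)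
    {d : ℤ} (hd : ∀ α, a α ≠ 0 → ∑ i ∈ J, α i = d)
    {c : ι → ℤ} (hc : ∀ α, a α ≠ 0 → ∀ i, i ∉ J → α i = c i)
    {β : ι → ℤ} (hβ : a β < 0) : 3 * J.card ≤ T.card + 4 := by
  classical
  induction hn : J.card generalizing J a T d c β with
  | zero => omega
  | succ n ih =>
  rw [← hn]
  by_cases hU : ∃ β, a β < 0 ∧ 2 ≤ (J \ oddDirections J T β).card
  · obtain ⟨β, hβ, hU⟩ := hU
    exact three_mul_card_le_of_two_le_card_sdiff hfin hp hT hβ hU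
  have hU' : ∀ β, a β < 0 → (J \ oddDirections J T β).card ≤ 1 := by
    intro β hβ
    by_contra! h
    exact hU ⟨β, hβ, h⟩
  have hlin : 2 * J.card ≤ T.card + 1 := by
    have h1 := card_add_card_oddDirections_le hfin hp hT hβ subset_rfl
    have h2 := Finset.card_inter_add_card_sdiff J (oddDirections J T β)
    have h3 := hU' β hβ
    have h4 := Finset.card_filter_le T fun γ => ∃ i ∈ J, excess J β γ = {i}
    omega
  by_contra! hcon
  have hmin : ∀ q, ∃ β, a β < 0 ∧ ∀ α, a α < 0 → β q ≤ α q := fun q =>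
    Set.exists_min_image {α | a α < 0} (fun α => α q)
      (hfin.subset fun α hα => (hα : a α < 0).ne) ⟨β, hβ⟩
  choose b hb hbmin using hmin
  have hlow : ∀ α, a α ≠ 0 → ∀ q ∈ J, b q q ≤ α q := by
    intro α hα q hq
    by_contra! hlt
    exact absurd (three_mul_card_le_of_lt hfin hp hT hd (hb q) (hU' _ (hb q)) hq (hbmin q) hα hlt)
      (not_le.mpr hcon)
  have hslice : ∀ q ∈ J, (T.filter fun γ => b q q < γ q).card ≤ 2 := by
    intro q hq
    set a' : (ι → ℤ) → ℝ := fun α => if α q = b q q then a α else 0 with ha'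
    have hsupp : ∀ α, a' α ≠ 0 → α q = b q q ∧ a α ≠ 0 := fun α hα => by
      simpa [ha'] using hα
    have hcoeff : ∀ γ : ι → ℤ, mulSumCoeff (J.erase q) a' γ =
        if γ q = b q q then mulSumCoeff J a γ else 0 := by
      intro γ
      have hval : ∀ l ∈ J.erase q, a' (γ - Pi.single l 1) =
          if γ q = b q q then a (γ - Pi.single l 1) else 0 := by
        intro l hl
        simp [ha', (Finset.mem_erase.mp hl).1.symm]
      rw [mulSumCoeff, Finset.sum_congr rfl hval]
      split_ifs with h
      · rw [mulSumCoeff, ← Finset.add_sum_erase _ _ hq]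
        have : a (γ - Pi.single q 1) = 0 := by
          by_contra hne
          have := hlow _ hne q hq
          simp at this
          omega
        rw [this, zero_add]
      · simp
    have := @ih (J.erase q) a' (T.filter fun γ => γ q = b q q)
      (hfin.subset fun α hα => (hsupp α hα).2)
      (fun γ => by rw [hcoeff]; split_ifs; exacts [hp γ, le_rfl])
      (fun γ => by rw [hcoeff, Finset.mem_filter, hT]; split_ifs with h <;> simp [h])
      (d - b q q) (fun α hα => by
        obtain ⟨h1, h2⟩ := hsupp α hα
        rw [← hd α h2, ← Finset.add_sum_erase _ _ hq, h1]; ring)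
      (Function.update c q (b q q)) (fun α hα i hi => by
        obtain ⟨h1, h2⟩ := hsupp α hα
        by_cases hiq : i = q
        · subst hiq; simpa using h1
        · rw [Function.update_of_ne hiq]
          exact hc α h2 i fun hiJ => hi (Finset.mem_erase.mpr ⟨hiq, hiJ⟩))
      (b q) (by simpa [ha'] using hb q) (by rw [Finset.card_erase_of_mem hq]; omega)
    have hdisj : (T.filter fun γ => γ q = b q q).card + (T.filter fun γ => b q q < γ q).card
        ≤ T.card := by
      rw [← Finset.card_union_of_disjoint]
      · exact Finset.card_le_card
          (Finset.union_subset (Finset.filter_subset _ _) (Finset.filter_subset _ _))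
      · refine Finset.disjoint_left.mpr fun γ hγ hγ' => ?_
        exact (Finset.mem_filter.mp hγ').2.ne' (Finset.mem_filter.mp hγ).2
    omega
  have := two_mul_card_le_of_card_filter_le_two hT hd hc (m := fun q => b q q) hlow hslice
  omega

end SignedCoefficients

section Polynomials

variable {σ : Type*}

/-- An exponent vector with natural entries, viewed as an integer vector. -/
def intExponent (m : σ →₀ ℕ) : σ → ℤ := fun i => m i

lemma intExponent_injective : Function.Injective (intExponent (σ := σ)) := fun _ _ h =>
  Finsupp.ext fun i => Nat.cast_injective (congrFun h i)

lemma intExponent_add_single [DecidableEq σ] (m : σ →₀ ℕ) (i : σ) :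
    intExponent (m + Finsupp.single i 1) = intExponent m + Pi.single i 1 := by
  ext j
  simp [intExponent, Finsupp.single_apply, Pi.single_apply, eq_comm]

/-- The coefficients of a polynomial as a function on all integer exponent vectors. -/
noncomputable def laurentCoeff (B : MvPolynomial σ ℝ) : (σ → ℤ) → ℝ :=
  Function.extend intExponent (fun m => coeff m B) 0

lemma laurentCoeff_intExponent (B : MvPolynomial σ ℝ) (m : σ →₀ ℕ) :
    laurentCoeff B (intExponent m) = coeff m B :=
  intExponent_injective.extend_apply _ _ m

lemma laurentCoeff_of_forall_ne (B : MvPolynomial σ ℝ) {γ : σ → ℤ}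
    (hγ : ∀ m, intExponent m ≠ γ) : laurentCoeff B γ = 0 :=
  Function.extend_apply' _ _ _ fun ⟨m, hm⟩ => hγ m hm

lemma laurentCoeff_nonneg {B : MvPolynomial σ ℝ} (hB : ∀ m, 0 ≤ coeff m B) (γ : σ → ℤ) :
    0 ≤ laurentCoeff B γ := by
  by_cases h : ∃ m, intExponent m = γ
  · obtain ⟨m, rfl⟩ := h
    rw [laurentCoeff_intExponent]
    exact hB m
  · push Not at h
    exact (laurentCoeff_of_forall_ne B h).ge

variable [Fintype σ]

lemma laurentCoeff_ne_zero_iff (B : MvPolynomial σ ℝ) (γ : σ → ℤ) :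
    laurentCoeff B γ ≠ 0 ↔ γ ∈ B.support.image intExponent := by
  by_cases h : ∃ m, intExponent m = γ
  · obtain ⟨m, rfl⟩ := h
    rw [laurentCoeff_intExponent, intExponent_injective.mem_finset_image, mem_support_iff]
  · push Not at h
    rw [laurentCoeff_of_forall_ne B h]
    simp only [ne_eq, not_true_eq_false, Finset.mem_image, false_iff, not_exists, not_and]
    exact fun m _ => h m

variable [DecidableEq σ]

lemma coeff_mul_sum_X (B : MvPolynomial σ ℝ) (m : σ →₀ ℕ) :
    coeff m (B * ∑ i, X i) =
      ∑ i, if i ∈ m.support then coeff (m - Finsupp.single i 1) B else 0 := by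
  simp only [Finset.mul_sum, coeff_sum, coeff_mul_X']

lemma mulSumCoeff_laurentCoeff (B : MvPolynomial σ ℝ) (γ : σ → ℤ) :
    mulSumCoeff Finset.univ (laurentCoeff B) γ = laurentCoeff (B * ∑ i, X i) γ := by
  by_cases h : ∃ m, intExponent m = γ
  · obtain ⟨m, rfl⟩ := h
    rw [laurentCoeff_intExponent, coeff_mul_sum_X, mulSumCoeff]
    refine Finset.sum_congr rfl fun i _ => ?_
    split_ifs with hi
    · have hm : m - Finsupp.single i 1 + Finsupp.single i 1 = m :=
        tsub_add_cancel_of_le (by simpa [Nat.one_le_iff_ne_zero] using hi)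
      rw [← laurentCoeff_intExponent]
      congr 1
      rw [sub_eq_iff_eq_add, ← intExponent_add_single, hm]
    · refine laurentCoeff_of_forall_ne B fun m' hm' => ?_
      have := congrFun hm' i
      simp only [Finsupp.mem_support_iff, not_not] at hi
      simp only [intExponent, Pi.sub_apply, hi, Pi.single_eq_same] at this
      omega
  · push Not at h
    rw [laurentCoeff_of_forall_ne _ h]
    refine Finset.sum_eq_zero fun i _ => laurentCoeff_of_forall_ne B fun m hm => ?_
    exact h (m + Finsupp.single i 1) (by rw [intExponent_add_single, hm, sub_add_cancel])

/-- If `A` has a negative coefficient but its product with the sum of `n` variables has none, then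
the product has at least `3n - 4` terms. -/
theorem three_mul_card_le_card_support_of_neg {A : MvPolynomial σ ℝ}
    (hpos : ∀ m, 0 ≤ coeff m (A * ∑ i, X i)) {m : σ →₀ ℕ} (hm : coeff m A < 0) :
    3 * Fintype.card σ ≤ (A * ∑ i, X i).support.card + 4 := by
  classical
  set d : ℤ := ∑ i, intExponent m i with hd
  set a : (σ → ℤ) → ℝ := fun α => if ∑ i, α i = d then laurentCoeff A α else 0 with ha
  have hsupp : ∀ α, a α ≠ 0 → ∑ i, α i = d ∧ laurentCoeff A α ≠ 0 := fun α hα => by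
    simpa [ha] using hα
  have hcoeff : ∀ γ : σ → ℤ, mulSumCoeff Finset.univ a γ =
      if ∑ i, γ i = d + 1 then laurentCoeff (A * ∑ i, X i) γ else 0 := by
    intro γ
    have hdeg : ∀ l, ∑ i, (γ - Pi.single l 1 : σ → ℤ) i = ∑ i, γ i - 1 := fun l => by
      simp [Finset.sum_sub_distrib, Pi.single_apply]
    simp only [← mulSumCoeff_laurentCoeff, mulSumCoeff, ha, hdeg, sub_eq_iff_eq_add]
    split_ifs <;> simp
  have hfin : a.support.Finite :=
    (A.support.image intExponent).finite_toSet.subset fun α hα =>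
      Finset.mem_coe.mpr ((laurentCoeff_ne_zero_iff A α).mp (hsupp α hα).2)
  have h := three_mul_card_le_of_neg_of_homogeneous (J := Finset.univ) (a := a)
    (T := ((A * ∑ i, X i).support.image intExponent).filter fun γ => ∑ i, γ i = d + 1)
    (d := d) (c := 0) (β := intExponent m) hfin
    (fun γ => by rw [hcoeff]; split_ifs; exacts [laurentCoeff_nonneg hpos γ, le_rfl])
    (fun γ => by
      rw [hcoeff, Finset.mem_filter, ← laurentCoeff_ne_zero_iff]
      split_ifs with h <;> simp [h])
    (fun α hα => (hsupp α hα).1) (fun α _ i hi => absurd (Finset.mem_univ i) hi)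
    (by simpa [ha, hd, laurentCoeff_intExponent] using hm)
  refine h.trans (Nat.add_le_add_right ((Finset.card_filter_le _ _).trans ?_) 4)
  exact Finset.card_image_le

/-- The exponents of the monomials of the product of `x ^ m` and the sum of all variables. -/
noncomputable def simplexAt (m : σ →₀ ℕ) : Finset (σ →₀ ℕ) :=
  Finset.univ.image fun i => m + Finsupp.single i 1

lemma card_simplexAt (m : σ →₀ ℕ) : (simplexAt m).card = Fintype.card σ := by
  refine Finset.card_image_of_injective _ fun i j hij => ?_
  exact Finsupp.single_left_injective one_ne_zero (add_left_cancel hij)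

lemma card_simplexAt_inter_le_one {m m' : σ →₀ ℕ} (hm : m ≠ m') :
    (simplexAt m ∩ simplexAt m').card ≤ 1 := by
  refine Finset.card_le_one.mpr fun x hx y hy => ?_
  simp only [simplexAt, Finset.mem_inter, Finset.mem_image, Finset.mem_univ, true_and] at hx hy
  obtain ⟨⟨i, rfl⟩, j, hj⟩ := hx
  obtain ⟨⟨k, rfl⟩, l, hl⟩ := hy
  have hij : i ≠ j := by
    rintro rfl
    exact hm (add_right_cancel hj).symm
  have h1 := DFunLike.congr_fun hj i
  have h2 := DFunLike.congr_fun hl i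
  simp only [Finsupp.add_apply, Finsupp.single_apply, hij.symm, if_true, if_false] at h1 h2
  by_cases hki : k = i
  · rw [hki]
  · simp only [hki, if_false] at h2
    split_ifs at h2 <;> omega

lemma support_mul_sum_X_of_nonneg {A : MvPolynomial σ ℝ} (hA : ∀ m, 0 ≤ coeff m A) :
    (A * ∑ i, X i).support = A.support.biUnion simplexAt := by
  ext g
  rw [mem_support_iff, coeff_mul_sum_X, Ne, Finset.sum_eq_zero_iff_of_nonneg fun i _ => by
    split_ifs; exacts [hA _, le_rfl]]
  simp only [simplexAt, Finset.mem_biUnion, Finset.mem_image, Finset.mem_univ, true_and,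
    forall_const, mem_support_iff, not_forall, ite_eq_right_iff, exists_prop]
  constructor
  · rintro ⟨i, hi, h⟩
    exact ⟨_, h, i, tsub_add_cancel_of_le (by simpa [Nat.one_le_iff_ne_zero] using hi)⟩
  · rintro ⟨m, hm, i, rfl⟩
    exact ⟨i, by simp, by simpa using hm⟩

lemma le_card_biUnion_simplexAt_of_two {s : Finset (σ →₀ ℕ)} {m m' : σ →₀ ℕ} (hm : m ∈ s)
    (hm' : m' ∈ s) (hne : m ≠ m') :
    2 * Fintype.card σ ≤ (s.biUnion simplexAt).card + 1 := by
  have hsub := Finset.card_le_card (Finset.union_subset (Finset.subset_biUnion_of_mem simplexAt hm)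
    (Finset.subset_biUnion_of_mem simplexAt hm'))
  have h := Finset.card_union_add_card_inter (simplexAt m) (simplexAt m')
  have hinter := card_simplexAt_inter_le_one hne
  rw [card_simplexAt, card_simplexAt] at h
  omega

lemma le_card_biUnion_simplexAt_of_three {s : Finset (σ →₀ ℕ)} (hs : 2 < s.card) :
    3 * Fintype.card σ ≤ (s.biUnion simplexAt).card + 3 := by
  obtain ⟨m, hm, m', hm', m'', hm'', h1, h2, h3⟩ := Finset.two_lt_card.mp hs
  have hsub := Finset.card_le_card (Finset.union_subset (Finset.union_subset
    (Finset.subset_biUnion_of_mem simplexAt hm) (Finset.subset_biUnion_of_mem simplexAt hm'))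
    (Finset.subset_biUnion_of_mem simplexAt hm''))
  have h := Finset.card_union_add_card_inter (simplexAt m) (simplexAt m')
  have h' := Finset.card_union_add_card_inter (simplexAt m ∪ simplexAt m') (simplexAt m'')
  have hinter := Finset.card_union_le (simplexAt m ∩ simplexAt m'') (simplexAt m' ∩ simplexAt m'')
  rw [← Finset.union_inter_distrib_right] at hinter
  have i1 := card_simplexAt_inter_le_one h1
  have i2 := card_simplexAt_inter_le_one h2
  have i3 := card_simplexAt_inter_le_one h3
  simp only [card_simplexAt] at h h'
  omega

/-- Either the product of `A` and the sum of `n` variables has at least `3n - 4` terms, or it has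
`0` terms, `n` terms, `2n - 1` terms or `2n` terms. -/
theorem card_support_mul_sum_X_cases {A : MvPolynomial σ ℝ}
    (hpos : ∀ m, 0 ≤ coeff m (A * ∑ i, X i)) :
    3 * Fintype.card σ ≤ (A * ∑ i, X i).support.card + 4 ∨
    (A * ∑ i, X i).support.card = 0 ∨
    (A * ∑ i, X i).support.card = Fintype.card σ ∨
    2 * Fintype.card σ ≤ (A * ∑ i, X i).support.card + 1 ∧
      (A * ∑ i, X i).support.card ≤ 2 * Fintype.card σ := by
  by_cases hA : ∀ m, 0 ≤ coeff m A
  · rw [support_mul_sum_X_of_nonneg hA]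
    rcases Nat.lt_or_ge 2 A.support.card with h | h
    · have := le_card_biUnion_simplexAt_of_three h
      omega
    interval_cases hcard : A.support.card
    · rw [Finset.card_eq_zero.mp hcard]
      simp
    · obtain ⟨m, hm⟩ := Finset.card_eq_one.mp hcard
      simp [hm, card_simplexAt]
    · obtain ⟨m, m', hne, hm⟩ := Finset.card_eq_two.mp hcard
      refine Or.inr (Or.inr (Or.inr ⟨le_card_biUnion_simplexAt_of_two
        (m := m) (m' := m') (by simp [hm]) (by simp [hm]) hne, ?_⟩))
      rw [← hcard]
      exact Finset.card_biUnion_le_card_mul _ _ _ fun m _ => (card_simplexAt m).le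
  · push Not at hA
    obtain ⟨m, hm⟩ := hA
    exact Or.inl (three_mul_card_le_card_support_of_neg hpos hm)

end Polynomials

/-- Corollary 1.4, second part: Ebenfelt's SOS conjecture for diagonal Hermitian polynomials
in dimensions `2 ≤ n ≤ 6`. -/
theorem stmt3 (n : ℕ) (hn : 2 ≤ n) (hn6 : n ≤ 6)
    (k0 : ℕ) (hk0 : k0 * (k0 + 1) / 2 < n)
    (hk0max : ∀ k : ℕ, k * (k + 1) / 2 < n → k ≤ k0)
    (A : MvPolynomial (Fin n) ℝ)
    (S : MvPolynomial (Fin n) ℝ) (hS : S = ∑ i, X i)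
    (hpos : ∀ m, 0 ≤ coeff m (A * S))
    (R : ℕ) (hR : R = (A * S).support.card) :
    (k0 + 1) * n - k0 * (k0 + 1) / 2 - 1 ≤ R ∨
      ∃ k : ℕ, k ≤ k0 ∧ k * n - k * (k - 1) / 2 ≤ R ∧ R ≤ k * n := by
  subst hS
  have h := card_support_mul_sum_X_cases hpos
  rw [← hR, Fintype.card_fin] at h
  have h1 : 1 ≤ k0 := hk0max 1 (by omega)
  have h2 : k0 ≤ 2 := by
    by_contra! hlt
    have : 3 * 4 ≤ k0 * (k0 + 1) := Nat.mul_le_mul hlt (by omega)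
    omega
  rcases h with h | h | h | h
  · left
    interval_cases k0 <;> omega
  · exact Or.inr ⟨0, by omega, by omega, by omega⟩
  · exact Or.inr ⟨1, h1, by omega, by omega⟩
  · interval_cases k0
    · left
      omega
    · exact Or.inr ⟨2, le_rfl, by omega, h.2⟩
end

section
/- Let n ≥ 1 and a ∈ ℝ^n, and set P = P(a), N = N(a), Z = Z(a). Consider the quadratic polynomial Q = (a_1x_1 + ⋯ + a_nx_n)·S_n, whose coefficients are indexed by the C(n+1,2) degree-2 monomials. Then: the number of degree-2 monomials whose coefficient in Q is positive is at least P(P+1)/2 + PZ; the number with negative coefficient is at least N(N+1)/2 + NZ; and the number with zero coefficient is at most Z(Z+1)/2 + PN. Moreover, if PN = 0 then all three inequalities are equalities. -/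
open MvPolynomial

/-- The degree-two monomial exponent attached to an unordered pair of variables. -/
noncomputable def Sym2.pairExponent {ι : Type*} : Sym2 ι → (ι →₀ ℕ) :=
  Sym2.lift ⟨fun i j => Finsupp.single i 1 + Finsupp.single j 1, fun _ _ => add_comm _ _⟩

theorem single_one_add_single_one_eq_iff {ι : Type*} {i j k l : ι} :
    (Finsupp.single k 1 + Finsupp.single l 1 : ι →₀ ℕ) =
      Finsupp.single i 1 + Finsupp.single j 1 ↔ (k = i ∧ l = j) ∨ (k = j ∧ l = i) := by
  rw [Finsupp.single_add_single_eq_single_add_single one_ne_zero one_ne_zero]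
  grind

theorem Sym2.pairExponent_injective {ι : Type*} :
    Function.Injective (Sym2.pairExponent : Sym2 ι → (ι →₀ ℕ)) := by
  intro x y
  induction x with | _ k l
  induction y with | _ i j
  intro h
  exact Sym2.eq_iff.2 (single_one_add_single_one_eq_iff.1 h)

theorem image_single_add_single_eq {ι : Type*} [Fintype ι] [DecidableEq ι] :
    (Finset.univ : Finset (ι × ι)).image
      (fun p => (Finsupp.single p.1 1 + Finsupp.single p.2 1 : ι →₀ ℕ)) =
      (Finset.univ : Finset (Sym2 ι)).image Sym2.pairExponent := by
  ext m
  simp only [Finset.mem_image, Finset.mem_univ, true_and]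
  exact ⟨fun ⟨p, h⟩ => ⟨s(p.1, p.2), h⟩, fun ⟨z, h⟩ => by
    induction z with | _ i j
    exact ⟨(i, j), h⟩⟩

theorem coeff_linear_mul_sum_X {ι R : Type*} [Fintype ι] [DecidableEq ι] [CommSemiring R]
    (a : ι → R) (i j : ι) :
    coeff (Sym2.pairExponent s(i, j)) ((∑ k, C (a k) * X k) * ∑ l, X l) =
      if i = j then a i else a i + a j := by
  have hterm (k l : ι) : coeff (Sym2.pairExponent s(i, j)) (C (a k) * X k * X l) =
      if (k = i ∧ l = j) ∨ (k = j ∧ l = i) then a k else 0 := by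
    rw [X, X, C_mul_monomial, monomial_mul, coeff_monomial]
    simp only [mul_one]
    exact if_congr single_one_add_single_one_eq_iff rfl rfl
  simp only [Finset.sum_mul_sum, coeff_sum, hterm]
  split_ifs with h
  · subst h
    simp [ite_and]
  · have hsplit (k l : ι) : (if (k = i ∧ l = j) ∨ (k = j ∧ l = i) then a k else 0) =
        (if k = i then if l = j then a k else 0 else 0) +
          if k = j then if l = i then a k else 0 else 0 := by
      by_cases hk : k = i
      · subst hk
        simp [h]
      · simp [hk, ite_and]
    simp only [hsplit, Finset.sum_add_distrib]
    simp

/-- A set of unordered pairs containing all pairs from `A` and all pairs from `A × B`, with `A`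
and `B` disjoint, has at least `|A|(|A|+1)/2 + |A||B|` elements. -/
theorem card_sym2_add_card_mul_le {ι : Type*} [DecidableEq ι] {A B : Finset ι}
    {F : Finset (Sym2 ι)} (hAB : Disjoint A B) (hA : ∀ i ∈ A, ∀ j ∈ A, s(i, j) ∈ F)
    (hB : ∀ i ∈ A, ∀ j ∈ B, s(i, j) ∈ F) :
    A.card * (A.card + 1) / 2 + A.card * B.card ≤ F.card := by
  have hne {i : ι} (hi : i ∈ A) (hi' : i ∈ B) : False := Finset.disjoint_left.1 hAB hi hi'
  have hinj : Set.InjOn (fun p : ι × ι => s(p.1, p.2)) (A ×ˢ B : Finset (ι × ι)) := by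
    rintro ⟨i, j⟩ hp ⟨k, l⟩ hq h
    simp only [Finset.coe_product, Set.mem_prod, Finset.mem_coe] at hp hq
    grind [Sym2.eq_iff]
  have hdisj : Disjoint A.sym2 ((A ×ˢ B).image fun p => s(p.1, p.2)) := by
    rw [Finset.disjoint_right]
    intro z hz hz'
    obtain ⟨⟨i, j⟩, hp, rfl⟩ := Finset.mem_image.1 hz
    exact hne (Finset.mk_mem_sym2_iff.1 hz').2 (Finset.mem_product.1 hp).2
  calc
    _ = (A.sym2 ∪ (A ×ˢ B).image fun p => s(p.1, p.2)).card := by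
      rw [Finset.card_union_of_disjoint hdisj, Finset.card_image_of_injOn hinj,
        Finset.card_product, Finset.card_sym2, Nat.choose_two_right, Nat.add_sub_cancel,
        Nat.mul_comm (A.card + 1)]
    _ ≤ F.card := by
      refine Finset.card_le_card (Finset.union_subset ?_ ?_)
      · intro z hz
        induction z with | _ i j
        rw [Finset.mk_mem_sym2_iff] at hz
        exact hA i hz.1 j hz.2
      · intro z hz
        obtain ⟨⟨i, j⟩, hp, rfl⟩ := Finset.mem_image.1 hz
        exact hB i (Finset.mem_product.1 hp).1 j (Finset.mem_product.1 hp).2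

theorem card_filter_pos_add_neg_add_zero {α : Type*} (s : Finset α) (f : α → ℝ) :
    (s.filter fun x => 0 < f x).card + (s.filter fun x => f x < 0).card +
      (s.filter fun x => f x = 0).card = s.card := by
  classical
  rw [Finset.card_filter, Finset.card_filter, Finset.card_filter, Finset.card_eq_sum_ones,
    ← Finset.sum_add_distrib, ← Finset.sum_add_distrib]
  refine Finset.sum_congr rfl fun x _ => ?_
  rcases lt_trichotomy (f x) 0 with h | h | h
  · simp [h, h.ne, h.not_gt]
  · simp [h]
  · simp [h, h.ne', h.not_gt]

theorem triangle_add (p m z : ℕ) :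
    (p + m + z) * (p + m + z + 1) / 2 =
      p * (p + 1) / 2 + m * (m + 1) / 2 + z * (z + 1) / 2 + p * m + p * z + m * z := by
  have h (k : ℕ) : 2 * (k * (k + 1) / 2) = k * (k + 1) :=
    Nat.mul_div_cancel' (Nat.even_mul_succ_self k).two_dvd
  have := h p
  have := h m
  have := h z
  have := h (p + m + z)
  nlinarith

/-- Lemma 3.1: counting the signs of the coefficients of the quadratic
`(a_1x_1 + ⋯ + a_nx_n)·S_n` in terms of the numbers `P`, `N`, `Z` of positive, negative and
zero components of `a`; with equalities when `P·N = 0`. -/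
theorem stmt7 (n : ℕ) (hn : 1 ≤ n) (a : Fin n → ℝ)
    (P N Z : ℕ)
    (hP : P = (Finset.univ.filter fun i : Fin n => 0 < a i).card)
    (hN : N = (Finset.univ.filter fun i : Fin n => a i < 0).card)
    (hZ : Z = (Finset.univ.filter fun i : Fin n => a i = 0).card)
    (Q : MvPolynomial (Fin n) ℝ)
    (hQ : Q = (∑ i, C (a i) * X i) * ∑ i, X i)
    (D2 : Finset (Fin n →₀ ℕ))
    (hD2 : D2 = (Finset.univ : Finset (Fin n × Fin n)).image
      fun p => Finsupp.single p.1 1 + Finsupp.single p.2 1) :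
    P * (P + 1) / 2 + P * Z ≤ (D2.filter fun m => 0 < coeff m Q).card ∧
    N * (N + 1) / 2 + N * Z ≤ (D2.filter fun m => coeff m Q < 0).card ∧
    (D2.filter fun m => coeff m Q = 0).card ≤ Z * (Z + 1) / 2 + P * N ∧
    (P * N = 0 →
      (D2.filter fun m => 0 < coeff m Q).card = P * (P + 1) / 2 + P * Z ∧
      (D2.filter fun m => coeff m Q < 0).card = N * (N + 1) / 2 + N * Z ∧
      (D2.filter fun m => coeff m Q = 0).card = Z * (Z + 1) / 2 + P * N) := by
  have hcard (p : ℝ → Prop) [DecidablePred p] : (D2.filter fun m => p (coeff m Q)).card =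
      (Finset.univ.filter fun z : Sym2 (Fin n) => p (coeff z.pairExponent Q)).card := by
    rw [hD2, image_single_add_single_eq, Finset.filter_image,
      Finset.card_image_of_injective _ Sym2.pairExponent_injective]
  have hcoeff (i j : Fin n) :
      coeff (Sym2.pairExponent s(i, j)) Q = if i = j then a i else a i + a j := by
    rw [hQ, coeff_linear_mul_sum_X]
  rw [hcard (0 < ·), hcard (· < 0), hcard (· = 0)]
  have hvars := card_filter_pos_add_neg_add_zero Finset.univ a
  have htotal := card_filter_pos_add_neg_add_zero Finset.univ
    fun z : Sym2 (Fin n) => coeff z.pairExponent Q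
  rw [← hP, ← hN, ← hZ, Finset.card_univ, Fintype.card_fin] at hvars
  rw [Finset.card_univ, Sym2.card, Fintype.card_fin, Nat.choose_two_right, Nat.add_sub_cancel,
    Nat.mul_comm] at htotal
  have htriangle := triangle_add P N Z
  rw [hvars] at htriangle
  have hpos : P * (P + 1) / 2 + P * Z ≤
      (Finset.univ.filter fun z : Sym2 (Fin n) => 0 < coeff z.pairExponent Q).card := by
    rw [hP, hZ]
    apply card_sym2_add_card_mul_le
    · exact Finset.disjoint_filter.2 fun i _ h => h.ne'
    all_goals
      simp only [Finset.mem_filter, Finset.mem_univ, true_and, hcoeff]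
      intro i hi j hj
      split_ifs <;> linarith
  have hneg : N * (N + 1) / 2 + N * Z ≤
      (Finset.univ.filter fun z : Sym2 (Fin n) => coeff z.pairExponent Q < 0).card := by
    rw [hN, hZ]
    apply card_sym2_add_card_mul_le
    · exact Finset.disjoint_filter.2 fun i _ h => h.ne
    all_goals
      simp only [Finset.mem_filter, Finset.mem_univ, true_and, hcoeff]
      intro i hi j hj
      split_ifs <;> linarith
  have hzero : Z * (Z + 1) / 2 + Z * (∅ : Finset (Fin n)).card ≤
      (Finset.univ.filter fun z : Sym2 (Fin n) => coeff z.pairExponent Q = 0).card := by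
    rw [hZ]
    apply card_sym2_add_card_mul_le (Finset.disjoint_empty_right _)
    · simp only [Finset.mem_filter, Finset.mem_univ, true_and, hcoeff]
      intro i hi j hj
      split_ifs <;> linarith
    · simp
  rw [Finset.card_empty, Nat.mul_zero, Nat.add_zero] at hzero
  refine ⟨hpos, hneg, ?_, fun hPN => ⟨?_, ?_, ?_⟩⟩ <;> omega
end

section
/- For every n ≥ 2 and every a ∈ ℝ^n with N(a) ≥ 2, the number of degree-3 monomials in x_1,…,x_n (out of C(n+2,3)) whose coefficient in the cubic polynomial (a_1x_1 + ⋯ + a_nx_n)·S_n² is zero is at most C(n+1,3) − n·N(a) + n + c(n), where c(2) = 1, c(3) = 2, c(4) = 4, and c(n) = 10 − n for n ≥ 5. -/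
open MvPolynomial

/-- The constant sequence `c(n)` of Lemma 3.2: `c(2) = 1`, `c(3) = 2`, `c(4) = 4`, and
`c(n) = 10 − n` for `n ≥ 5`. -/
def cseq : ℕ → ℤ := fun n =>
  if n = 2 then 1 else if n = 3 then 2 else if n = 4 then 4 else 10 - (n : ℤ)

/-- The multisets of three elements of `s` over which `a` has nonzero sum. -/
noncomputable def nonzeroTriples {ι : Type*} [DecidableEq ι] (a : ι → ℝ) (s : Finset ι) :
    Finset (Sym ι 3) :=
  (s.sym 3).filter fun m => ((m : Multiset ι).map a).sum ≠ 0

/-- The multisets of size three consisting of `k` and a given pair. -/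
def consPair {ι : Type*} (k : ι) (z : Sym2 ι) : Sym ι 3 :=
  k ::ₛ Sym2.equivSym ι z

theorem consPair_injective {ι : Type*} (k : ι) : Function.Injective (consPair k) := fun _ _ h =>
  (Sym2.equivSym ι).injective (Sym.cons_inj_right _ _ _ |>.1 h)

theorem coe_consPair {ι : Type*} (k i j : ι) :
    (consPair k s(i, j) : Multiset ι) = k ::ₘ i ::ₘ {j} := rfl

theorem consPair_mem_nonzeroTriples {ι : Type*} [DecidableEq ι] {a : ι → ℝ} {s : Finset ι}
    {k i j : ι} (hk : k ∈ s) (hi : i ∈ s) (hj : j ∈ s) (h : a i + a j + a k ≠ 0) :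
    consPair k s(i, j) ∈ nonzeroTriples a s := by
  rw [nonzeroTriples, Finset.mem_filter, Finset.mem_sym_iff]
  refine ⟨fun x hx => ?_, ?_⟩
  · rw [← Sym.mem_coe, coe_consPair] at hx
    simp only [Multiset.mem_cons, Multiset.mem_singleton] at hx
    rcases hx with rfl | rfl | rfl <;> assumption
  · rw [coe_consPair]
    simp only [Multiset.map_cons, Multiset.map_singleton, Multiset.sum_cons,
      Multiset.sum_singleton]
    intro h'
    exact h (by linarith)

theorem card_image_sym2Mk {ι : Type*} [DecidableEq ι] {U V : Finset ι} (h : Disjoint U V) :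
    ((U ×ˢ V).image fun p => s(p.1, p.2)).card = U.card * V.card := by
  rw [Finset.card_image_of_injOn, Finset.card_product]
  rintro ⟨x, y⟩ hp ⟨z, w⟩ hq hpq
  simp only [Finset.coe_product, Set.mem_prod, Finset.mem_coe] at hp hq
  simp only [Sym2.eq_iff] at hpq
  rcases hpq with ⟨rfl, rfl⟩ | ⟨rfl, rfl⟩
  · rfl
  · exact absurd hq.2 (Finset.disjoint_left.1 h hp.1)

theorem two_mul_succ_choose_two (n : ℕ) : 2 * (n + 1).choose 2 = n * (n + 1) := by
  have h := Nat.div_mul_cancel (Nat.even_mul_succ_self n).two_dvd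
  rw [Nat.choose_two_right, Nat.add_sub_cancel, mul_comm (n + 1)]
  linarith

/-- Removing `k` loses at least as many nonzero triples as there are pairs, taken inside `U`,
inside `W` or between `U` and `V`, whose sum is not `-a k`. -/
theorem card_nonzeroTriples_erase_add_le {ι : Type*} [DecidableEq ι] (a : ι → ℝ)
    {s U V W : Finset ι} {k : ι} (hk : k ∈ s) (hU : U ⊆ s) (hV : V ⊆ s) (hW : W ⊆ s)
    (hUV : Disjoint U V) (hUW : Disjoint U W)
    (hUU' : ∀ i ∈ U, ∀ j ∈ U, a i + a j + a k ≠ 0)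
    (hUV' : ∀ i ∈ U, ∀ j ∈ V, a i + a j + a k ≠ 0)
    (hWW' : ∀ i ∈ W, ∀ j ∈ W, a i + a j + a k ≠ 0) :
    2 * ((nonzeroTriples a (s.erase k)).card : ℤ) + U.card * (U.card + 1)
      + 2 * (U.card * V.card) + W.card * (W.card + 1) ≤ 2 * (nonzeroTriples a s).card := by
  have htwo : ∀ T : Finset ι, ((T.card : ℤ) * (T.card + 1)) = 2 * (T.sym2.card : ℤ) := by
    intro T
    rw [Finset.card_sym2]
    exact_mod_cast (two_mul_succ_choose_two T.card).symm
  set A := U.sym2 ∪ (U ×ˢ V).image (fun p => s(p.1, p.2)) ∪ W.sym2 with hA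
  have hAcard : A.card = U.sym2.card + U.card * V.card + W.sym2.card := by
    rw [hA, Finset.card_union_of_disjoint, Finset.card_union_of_disjoint, card_image_sym2Mk hUV]
    · rw [Finset.disjoint_left]
      intro z hz hz'
      obtain ⟨⟨i, j⟩, hij, rfl⟩ := Finset.mem_image.1 hz'
      rw [Finset.mk_mem_sym2_iff] at hz
      exact Finset.disjoint_left.1 hUV hz.2 (Finset.mem_product.1 hij).2
    · rw [Finset.disjoint_left]
      intro z hz hz'
      rcases Finset.mem_union.1 hz with hz | hz
      · induction z with
        | _ i j =>
        rw [Finset.mk_mem_sym2_iff] at hz hz'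
        exact Finset.disjoint_left.1 hUW hz.1 hz'.1
      · obtain ⟨⟨i, j⟩, hij, rfl⟩ := Finset.mem_image.1 hz
        rw [Finset.mk_mem_sym2_iff] at hz'
        exact Finset.disjoint_left.1 hUW (Finset.mem_product.1 hij).1 hz'.1
  have hdisj : Disjoint (nonzeroTriples a (s.erase k)) (A.image (consPair k)) := by
    rw [Finset.disjoint_left]
    intro m hm hm'
    obtain ⟨z, -, rfl⟩ := Finset.mem_image.1 hm'
    have := Finset.mem_sym_iff.1 (Finset.mem_filter.1 hm).1 k (Sym.mem_cons_self _ _)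
    simp at this
  have hsub : nonzeroTriples a (s.erase k) ∪ A.image (consPair k) ⊆ nonzeroTriples a s := by
    refine Finset.union_subset (Finset.filter_subset_filter _
      (Finset.sym_mono (Finset.erase_subset _ _) _)) ?_
    intro m hm
    obtain ⟨z, hz, rfl⟩ := Finset.mem_image.1 hm
    rcases Finset.mem_union.1 hz with hz | hz
    · rcases Finset.mem_union.1 hz with hz | hz
      · induction z with
        | _ i j =>
        rw [Finset.mk_mem_sym2_iff] at hz
        exact consPair_mem_nonzeroTriples hk (hU hz.1) (hU hz.2) (hUU' _ hz.1 _ hz.2)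
      · obtain ⟨⟨i, j⟩, hij, rfl⟩ := Finset.mem_image.1 hz
        rw [Finset.mem_product] at hij
        exact consPair_mem_nonzeroTriples hk (hU hij.1) (hV hij.2) (hUV' _ hij.1 _ hij.2)
    · induction z with
      | _ i j =>
      rw [Finset.mk_mem_sym2_iff] at hz
      exact consPair_mem_nonzeroTriples hk (hW hz.1) (hW hz.2) (hWW' _ hz.1 _ hz.2)
  have hle := Finset.card_le_card hsub
  rw [Finset.card_union_of_disjoint hdisj, Finset.card_image_of_injective _ (consPair_injective k),
    hAcard] at hle
  rw [htwo U, htwo W]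
  zify at hle
  linarith

/-- Twice the lower bound for the number of nonzero triples. -/
def tripleBound (n N : ℤ) (c : ℤ) : ℤ := n * (n + 1) + 2 * n * N - 2 * n - 2 * c

theorem cseq_of_five_le {n : ℕ} (h : 5 ≤ n) : cseq n = 10 - n := by
  simp [cseq, show n ≠ 2 by omega, show n ≠ 3 by omega, show n ≠ 4 by omega]

theorem cseq_succ_cases {n : ℕ} (h : 2 ≤ n) :
    n = 2 ∧ cseq n = 1 ∧ cseq (n + 1) = 2 ∨ n = 3 ∧ cseq n = 2 ∧ cseq (n + 1) = 4 ∨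
      n = 4 ∧ cseq n = 4 ∧ cseq (n + 1) = 5 ∨
      5 ≤ n ∧ cseq n = 10 - n ∧ cseq (n + 1) = 9 - n := by
  by_cases h5 : 5 ≤ n
  · have := cseq_of_five_le (n := n + 1) (by omega)
    push_cast at this
    exact Or.inr (Or.inr (Or.inr ⟨h5, cseq_of_five_le h5, by linarith⟩))
  · interval_cases n <;> simp [cseq]

theorem tripleBound_succ_le {n : ℕ} {N x : ℤ} (hn : 2 ≤ n) (h2 : n = 2 → 2 * N + 2 ≤ x)
    (h3 : n = 3 → 2 * N + 2 ≤ x) (h4 : n = 4 → 2 * N + 6 ≤ x)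
    (h5 : 5 ≤ n → 2 * (n + 1) + 2 * N ≤ x) :
    tripleBound (n + 1 : ℕ) N (cseq (n + 1)) ≤ tripleBound n N (cseq n) + x := by
  unfold tripleBound
  rcases cseq_succ_cases hn with ⟨rfl, e, e'⟩ | ⟨rfl, e, e'⟩ | ⟨rfl, e, e'⟩ | ⟨h, e, e'⟩
  · have := h2 rfl
    rw [e, e']; push_cast; linarith
  · have := h3 rfl
    rw [e, e']; push_cast; linarith
  · have := h4 rfl
    rw [e, e']; push_cast; linarith
  · have := h5 h
    rw [e, e']; push_cast; linarith

theorem tripleBound_succ_le_sub_one {n : ℕ} {N x : ℤ} (hn : 2 ≤ n) (h2 : n = 2 → 2 * N + 6 ≤ x)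
    (h3 : n = 3 → 2 * N + 8 ≤ x) (h4 : n = 4 → 2 * N + 14 ≤ x)
    (h5 : 5 ≤ n → 2 * (2 * n + 1) + 2 * N ≤ x) :
    tripleBound (n + 1 : ℕ) N (cseq (n + 1)) ≤ tripleBound n (N - 1) (cseq n) + x := by
  unfold tripleBound
  rcases cseq_succ_cases hn with ⟨rfl, e, e'⟩ | ⟨rfl, e, e'⟩ | ⟨rfl, e, e'⟩ | ⟨h, e, e'⟩
  · have := h2 rfl
    rw [e, e']; push_cast; linarith
  · have := h3 rfl
    rw [e, e']; push_cast; linarith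
  · have := h4 rfl
    rw [e, e']; push_cast; linarith
  · have := h5 h
    rw [e, e']; push_cast; linarith

theorem tripleBound_le_card_nonzeroTriples {ι : Type*} [DecidableEq ι] (a : ι → ℝ) (n : ℕ) :
    ∀ s : Finset ι, s.card = n → 2 ≤ (s.filter fun i => a i < 0).card →
      tripleBound n (s.filter fun i => a i < 0).card (cseq n) ≤ 2 * (nonzeroTriples a s).card := by
  induction n with
  | zero =>
    intro s hs h
    have := Finset.card_filter_le s fun i => a i < 0
    omega
  | succ n ih =>
    intro s hs hN
    set Ng := s.filter fun i => a i < 0 with hNg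
    set Po := s.filter fun i => 0 < a i with hPo
    set Ze := s.filter fun i => a i = 0 with hZe
    have hNs : Ng ⊆ s := Finset.filter_subset _ _
    have hPs : Po ⊆ s := Finset.filter_subset _ _
    have hZs : Ze ⊆ s := Finset.filter_subset _ _
    have mN : ∀ i, i ∈ Ng → a i < 0 := fun i hi => (Finset.mem_filter.1 hi).2
    have mP : ∀ i, i ∈ Po → 0 < a i := fun i hi => (Finset.mem_filter.1 hi).2
    have mZ : ∀ i, i ∈ Ze → a i = 0 := fun i hi => (Finset.mem_filter.1 hi).2
    have dNP : Disjoint Ng Po := Finset.disjoint_left.2 fun i hi hj =>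
      lt_asymm (mN i hi) (mP i hj)
    have dNZ : Disjoint Ng Ze := Finset.disjoint_left.2 fun i hi hj =>
      (mN i hi).ne (mZ i hj)
    have dPZ : Disjoint Po Ze := Finset.disjoint_left.2 fun i hi hj =>
      (mP i hi).ne' (mZ i hj)
    have hcard : Ng.card + Po.card + Ze.card = n + 1 := by
      rw [← hs, ← Finset.card_union_of_disjoint dNP, ← Finset.card_union_of_disjoint]
      · congr 1
        ext i
        simp only [hNg, hPo, hZe, Finset.mem_union, Finset.mem_filter]
        have := lt_trichotomy (a i) 0
        tauto
      · exact Finset.disjoint_union_left.2 ⟨dNZ, dPZ⟩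
    -- the induction hypothesis after removing a nonnegative, respectively negative, element
    have ih_nonneg : ∀ k ∈ s, 0 ≤ a k →
        tripleBound n Ng.card (cseq n) ≤ 2 * (nonzeroTriples a (s.erase k)).card := by
      intro k hk hak
      have h : (s.erase k).filter (fun i => a i < 0) = Ng := by
        rw [Finset.filter_erase, Finset.erase_eq_of_notMem]
        intro h
        exact absurd (mN k h) (not_lt.2 hak)
      have := ih (s.erase k) (by rw [Finset.card_erase_of_mem hk]; omega) (by rw [h]; exact hN)
      rwa [h] at this
    have ih_neg : 3 ≤ Ng.card → ∀ k ∈ Ng,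
        tripleBound n (Ng.card - 1) (cseq n) ≤ 2 * (nonzeroTriples a (s.erase k)).card := by
      intro h3 k hk
      have h : ((s.erase k).filter (fun i => a i < 0)).card = Ng.card - 1 := by
        rw [Finset.filter_erase, Finset.card_erase_of_mem hk]
      have := ih (s.erase k) (by rw [Finset.card_erase_of_mem (hNs hk)]; omega) (by omega)
      rwa [h, Nat.cast_sub (by omega), Nat.cast_one] at this
    have step_nonneg : ∀ k ∈ s, 0 ≤ a k → ∀ x : ℤ,
        2 * ((nonzeroTriples a (s.erase k)).card : ℤ) + x ≤ 2 * (nonzeroTriples a s).card →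
        2 ≤ n → (n = 2 → 2 * (Ng.card : ℤ) + 2 ≤ x) → (n = 3 → 2 * (Ng.card : ℤ) + 2 ≤ x) →
        (n = 4 → 2 * (Ng.card : ℤ) + 6 ≤ x) → (5 ≤ n → 2 * (n + 1) + 2 * (Ng.card : ℤ) ≤ x) →
        tripleBound (n + 1 : ℕ) Ng.card (cseq (n + 1)) ≤ 2 * (nonzeroTriples a s).card :=
      fun k hk hak x h hn h2 h3 h4 h5 => by
        linarith [ih_nonneg k hk hak, tripleBound_succ_le hn h2 h3 h4 h5]
    have step_neg : ∀ k ∈ Ng, ∀ x : ℤ,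
        2 * ((nonzeroTriples a (s.erase k)).card : ℤ) + x ≤ 2 * (nonzeroTriples a s).card →
        3 ≤ Ng.card → (n = 2 → 2 * (Ng.card : ℤ) + 6 ≤ x) → (n = 3 → 2 * (Ng.card : ℤ) + 8 ≤ x) →
        (n = 4 → 2 * (Ng.card : ℤ) + 14 ≤ x) →
        (5 ≤ n → 2 * (2 * n + 1) + 2 * (Ng.card : ℤ) ≤ x) →
        tripleBound (n + 1 : ℕ) Ng.card (cseq (n + 1)) ≤ 2 * (nonzeroTriples a s).card :=
      fun k hk x h hN3 h2 h3 h4 h5 => by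
        linarith [ih_neg hN3 k hk,
          tripleBound_succ_le_sub_one (show 2 ≤ n by omega) h2 h3 h4 h5]
    have hcard' : (n : ℤ) = Ng.card + Po.card + Ze.card - 1 := by
      zify at hcard
      linarith
    have disj_empty : ∀ T : Finset ι, Disjoint T ∅ := Finset.disjoint_empty_right
    have empty_sub : (∅ : Finset ι) ⊆ s := Finset.empty_subset s
    rcases Finset.eq_empty_or_nonempty Ze with hZ0 | ⟨k, hk⟩
    swap
    · have hZ1 : 1 ≤ Ze.card := Finset.card_pos.2 ⟨k, hk⟩
      refine step_nonneg k (hZs hk) (mZ k hk).ge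
        (Ng.card * (Ng.card + 1) + 2 * (Ng.card * Ze.card) + Po.card * (Po.card + 1)) ?_
        (by omega) ?_ ?_ ?_ ?_
      · have := card_nonzeroTriples_erase_add_le a (hZs hk) hNs hZs hPs dNZ dNP
          (fun i hi j hj => by linarith [mN i hi, mN j hj, mZ k hk])
          (fun i hi j hj => by linarith [mN i hi, mZ j hj, mZ k hk])
          (fun i hi j hj => by linarith [mP i hi, mP j hj, mZ k hk])
        linarith
      all_goals
        intro h
        have hN' : (2 : ℤ) ≤ Ng.card := mod_cast hN
        have hZ' : (1 : ℤ) ≤ Ze.card := mod_cast hZ1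
        have hP : (Po.card : ℤ) ≤ Po.card * Po.card := mod_cast Nat.le_mul_self _
        have key : 2 * ((n : ℤ) + 1) + 2 * Ng.card ≤ Ng.card * (Ng.card + 1)
            + 2 * (Ng.card * Ze.card) + Po.card * (Po.card + 1) := by
          nlinarith
        omega
    have hZc : Ze.card = 0 := by rw [hZ0, Finset.card_empty]
    rw [hZc] at hcard hcard'
    rcases le_or_gt Po.card 1 with hP1 | hP2
    · rcases le_or_gt 3 Ng.card with hN3 | hN3
      · by_cases hex : ∃ k ∈ Ng, ∀ p ∈ Po, a p + a p + a k ≠ 0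
        · obtain ⟨k, hk, hkp⟩ := hex
          refine step_neg k hk (Ng.card * (Ng.card + 1) + Po.card * (Po.card + 1)) ?_ hN3
            ?_ ?_ ?_ ?_
          · have := card_nonzeroTriples_erase_add_le a (hNs hk) hNs empty_sub hPs (disj_empty _)
              dNP
              (fun i hi j hj => by linarith [mN i hi, mN j hj, mN k hk])
              (fun i hi j hj => absurd hj (Finset.notMem_empty j))
              (fun i hi j hj => by
                rw [Finset.card_le_one.1 hP1 j hj i hi]
                exact hkp i hi)
            rw [Finset.card_empty] at this
            push_cast at this
            linarith
          all_goals
            intro h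
            have hN4 : (Ng.card : ℤ) = n + 1 - Po.card := by linarith
            obtain hP | hP : Po.card = 0 ∨ Po.card = 1 := by omega
            all_goals
              rw [hN4, hP]
              first
                | omega
                | (subst h; norm_num)
                | (zify at h; push_cast; nlinarith)
        · push Not at hex
          obtain ⟨k, hk⟩ := Finset.card_pos.1 (show 0 < Ng.card by omega)
          obtain ⟨p, hp, hkp⟩ := hex k hk
          have hPc : Po.card = 1 := le_antisymm hP1 (Finset.card_pos.2 ⟨p, hp⟩)
          refine step_neg k hk (Ng.card * (Ng.card + 1) + 2 * (Ng.card * Po.card)) ?_ hN3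
            ?_ ?_ ?_ ?_
          · have := card_nonzeroTriples_erase_add_le a (hNs hk) hNs hPs empty_sub dNP
              (disj_empty _)
              (fun i hi j hj => by linarith [mN i hi, mN j hj, mN k hk])
              (fun i hi j hj => by
                rw [Finset.card_le_one.1 hP1 j hj p hp]
                linarith [mN i hi, mP p hp])
              (fun i hi j hj => absurd hj (Finset.notMem_empty j))
            rw [Finset.card_empty] at this
            push_cast at this
            linarith
          all_goals
            intro h
            have hN4 : (Ng.card : ℤ) = n := by linarith [show (Po.card : ℤ) = 1 by rw [hPc]; rfl]
            rw [hN4, hPc]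
            first
              | omega
              | (subst h; norm_num)
              | (zify at h; push_cast; nlinarith)
      · have hN2 : Ng.card = 2 := by omega
        obtain ⟨i, j, hij, hNij⟩ := Finset.card_eq_two.1 hN2
        have hi : i ∈ Ng := by simp [hNij]
        have hj : j ∈ Ng := by simp [hNij]
        rcases Nat.eq_zero_or_pos Po.card with hP0 | hP0
        · have h1 := card_nonzeroTriples_erase_add_le a (hNs hi) hNs empty_sub empty_sub
            (disj_empty _) (disj_empty _)
            (fun x hx y hy => by linarith [mN x hx, mN y hy, mN i hi])
            (fun x hx y hy => absurd hy (Finset.notMem_empty y))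
            (fun x hx y hy => absurd hy (Finset.notMem_empty y))
          have hj' : j ∈ s.erase i := Finset.mem_erase.2 ⟨hij.symm, hNs hj⟩
          have h2 := card_nonzeroTriples_erase_add_le a (s := s.erase i) (U := {j}) hj'
            (Finset.singleton_subset_iff.2 hj') (Finset.empty_subset _) (Finset.empty_subset _)
            (disj_empty _) (disj_empty _)
            (fun x hx y hy => by
              rw [Finset.mem_singleton.1 hx, Finset.mem_singleton.1 hy]
              linarith [mN j hj])
            (fun x hx y hy => absurd hy (Finset.notMem_empty y))
            (fun x hx y hy => absurd hy (Finset.notMem_empty y))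
          obtain rfl : n = 1 := by omega
          rw [hN2, Finset.card_empty] at h1
          rw [Finset.card_singleton, Finset.card_empty] at h2
          rw [hN2]
          simp only [tripleBound, cseq]
          norm_num at h1 h2 ⊢
          omega
        · have hPc : Po.card = 1 := by omega
          obtain rfl : n = 2 := by omega
          obtain ⟨p, hp⟩ := Finset.card_pos.1 hP0
          have hPp : ∀ q ∈ Po, q = p := fun q hq => Finset.card_le_one.1 hP1 q hq p hp
          have main : 2 * ((nonzeroTriples a (s.erase p)).card : ℤ) + 6
              ≤ 2 * (nonzeroTriples a s).card := by
            have aux : ∀ i ∈ Ng, ∀ j ∈ Ng, i ≠ j → a i + a p + a p = 0 →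
                2 * ((nonzeroTriples a (s.erase p)).card : ℤ) + 6
                  ≤ 2 * (nonzeroTriples a s).card := by
              intro i hi j hj hij hip
              have := card_nonzeroTriples_erase_add_le a (U := {i}) (V := {j}) (W := Po)
                (hPs hp) (Finset.singleton_subset_iff.2 (hNs hi))
                (Finset.singleton_subset_iff.2 (hNs hj)) hPs (Finset.disjoint_singleton.2 hij)
                (Finset.disjoint_singleton_left.2 (Finset.disjoint_left.1 dNP hi))
                (fun x hx y hy => by
                  rw [Finset.mem_singleton.1 hx, Finset.mem_singleton.1 hy]
                  linarith [mP p hp])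
                (fun x hx y hy => by
                  rw [Finset.mem_singleton.1 hx, Finset.mem_singleton.1 hy]
                  linarith [mP p hp, mN j hj])
                (fun x hx y hy => by linarith [mP p hp, mP x hx, mP y hy])
              rw [Finset.card_singleton, Finset.card_singleton, hPc] at this
              push_cast at this
              linarith
            by_cases hip : a i + a p + a p = 0
            · exact aux i hi j hj hij hip
            by_cases hjp : a j + a p + a p = 0
            · exact aux j hj i hi hij.symm hjp
            have := card_nonzeroTriples_erase_add_le a (hPs hp) hPs hNs empty_sub dNP.symm
              (disj_empty _)
              (fun x hx y hy => by linarith [mP p hp, mP x hx, mP y hy])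
              (fun x hx y hy => by
                rw [hPp x hx]
                rw [hNij, Finset.mem_insert, Finset.mem_singleton] at hy
                rcases hy with rfl | rfl
                · rwa [add_comm (a p)]
                · rwa [add_comm (a p)])
              (fun x hx y hy => absurd hy (Finset.notMem_empty y))
            rw [Finset.card_empty, hPc, hN2] at this
            push_cast at this
            linarith
          refine step_nonneg p (hPs hp) (mP p hp).le 6 main le_rfl ?_ ?_ ?_ ?_ <;> intro h <;> omega
    · rcases le_or_gt 3 Ng.card with hN3 | hN3
      · obtain ⟨k, hk, hmax⟩ := Finset.exists_max_image s (fun i => |a i|)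
          (Finset.card_pos.1 (by omega))
        rcases lt_or_ge (a k) 0 with hneg | hnonneg
        · have hkN : k ∈ Ng := Finset.mem_filter.2 ⟨hk, hneg⟩
          refine step_neg k hkN (Ng.card * (Ng.card + 1) + 2 * (Ng.card * Po.card)) ?_ hN3
            ?_ ?_ ?_ ?_
          · have := card_nonzeroTriples_erase_add_le a hk hNs hPs empty_sub dNP
              (disj_empty _)
              (fun i hi j hj => by linarith [mN i hi, mN j hj, mN k hkN])
              (fun i hi j hj => by
                have := hmax j (hPs hj)
                rw [abs_of_pos (mP j hj), abs_of_neg hneg] at this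
                linarith [mN i hi])
              (fun i hi j hj => absurd hj (Finset.notMem_empty j))
            rw [Finset.card_empty] at this
            push_cast at this
            linarith
          all_goals
            intro h
            have hN' : (3 : ℤ) ≤ Ng.card := mod_cast hN3
            have hP' : (2 : ℤ) ≤ Po.card := mod_cast hP2
            have key : 2 * (2 * (n : ℤ) + 1) + 2 * Ng.card ≤ Ng.card * (Ng.card + 1)
                + 2 * (Ng.card * Po.card) := by
              nlinarith
            omega
        · refine step_nonneg k hk hnonneg (Po.card * (Po.card + 1) + 2 * (Po.card * Ng.card)) ?_
            (by omega) ?_ ?_ ?_ ?_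
          · have := card_nonzeroTriples_erase_add_le a hk hPs hNs empty_sub dNP.symm
              (disj_empty _)
              (fun i hi j hj => by linarith [mP i hi, mP j hj])
              (fun i hi j hj => by
                have := hmax j (hNs hj)
                rw [abs_of_neg (mN j hj), abs_of_nonneg hnonneg] at this
                linarith [mP i hi])
              (fun i hi j hj => absurd hj (Finset.notMem_empty j))
            rw [Finset.card_empty] at this
            push_cast at this
            linarith
          all_goals
            intro h
            have hN' : (3 : ℤ) ≤ Ng.card := mod_cast hN3
            have hP' : (2 : ℤ) ≤ Po.card := mod_cast hP2
            have key : 2 * ((n : ℤ) + 1) + 2 * Ng.card ≤ Po.card * (Po.card + 1)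
                + 2 * (Po.card * Ng.card) := by
              nlinarith
            omega
      · obtain ⟨k, hk⟩ := Finset.card_pos.1 (show 0 < Po.card by omega)
        refine step_nonneg k (hPs hk) (mP k hk).le (Po.card * (Po.card + 1)) ?_
          (by omega) ?_ ?_ ?_ ?_
        · have := card_nonzeroTriples_erase_add_le a (hPs hk) hPs empty_sub empty_sub
            (disj_empty _) (disj_empty _)
            (fun i hi j hj => by linarith [mP i hi, mP j hj, mP k hk])
            (fun i hi j hj => absurd hj (Finset.notMem_empty j))
            (fun i hi j hj => absurd hj (Finset.notMem_empty j))
          rw [Finset.card_empty] at this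
          push_cast at this
          linarith
        all_goals
          intro h
          have hN2 : (Ng.card : ℤ) = 2 := by exact_mod_cast (show Ng.card = 2 by omega)
          have hP4 : (Po.card : ℤ) = n - 1 := by linarith
          rw [hN2, hP4]
          first
            | omega
            | (subst h; norm_num)
            | (zify at h; push_cast; nlinarith)

/-- The cubic `(∑ aᵢxᵢ)(∑ xᵢ)²` has a zero coefficient at `xᵢxⱼxₖ` only if `aᵢ + aⱼ + aₖ = 0`. -/
theorem sum_eq_zero_of_coeff_eq_zero {n : ℕ} (a : Fin n → ℝ) {Q : MvPolynomial (Fin n) ℝ}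
    (hQ : Q = (∑ i, C (a i) * X i) * (∑ i, X i) ^ 2) (p : Fin n × Fin n × Fin n)
    (hp : coeff (Finsupp.single p.1 1 + Finsupp.single p.2.1 1 + Finsupp.single p.2.2 1) Q = 0) :
    a p.1 + a p.2.1 + a p.2.2 = 0 := by
  let L : (Fin n →₀ ℕ) → ℝ := fun m => ∑ i, (m i : ℝ) * a i
  let e : Fin n × Fin n × Fin n → (Fin n →₀ ℕ) := fun p =>
    Finsupp.single p.1 1 + Finsupp.single p.2.1 1 + Finsupp.single p.2.2 1
  have hLe : ∀ p, L (e p) = a p.1 + a p.2.1 + a p.2.2 := by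
    intro p
    simp [L, e, add_mul, Finset.sum_add_distrib, Finsupp.single_apply]
  have hcoeff : ∀ m, coeff m Q = ∑ i, ∑ j, ∑ k, if e (i, j, k) = m then a i else 0 := by
    intro m
    have hmon : ∀ i j k : Fin n, (C (a i) * X i * (X j * X k) : MvPolynomial (Fin n) ℝ)
        = monomial (e (i, j, k)) (a i) := by
      intro i j k
      simp [e, X, C_mul_monomial, monomial_mul, add_assoc]
    rw [hQ, sq, Finset.sum_mul_sum, Finset.sum_mul_sum, coeff_sum]
    refine Finset.sum_congr rfl fun i _ => ?_
    rw [coeff_sum]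
    refine Finset.sum_congr rfl fun j _ => ?_
    rw [Finset.mul_sum, coeff_sum]
    refine Finset.sum_congr rfl fun k _ => ?_
    rw [hmon, coeff_monomial]
  change coeff (e p) Q = 0 at hp
  have hfst := hcoeff (e p)
  have hsnd : coeff (e p) Q = ∑ i, ∑ j, ∑ k, if e (i, j, k) = e p then a j else 0 := by
    rw [hfst, Finset.sum_comm]
    have : ∀ i j k, e (i, j, k) = e (j, i, k) := fun i j k => by simp only [e]; abel
    exact Finset.sum_congr rfl fun i _ => Finset.sum_congr rfl fun j _ =>
      Finset.sum_congr rfl fun k _ => by rw [this i j k]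
  have hthd : coeff (e p) Q = ∑ i, ∑ j, ∑ k, if e (i, j, k) = e p then a k else 0 := by
    rw [hsnd]
    have : ∀ i j k, e (i, j, k) = e (i, k, j) := fun i j k => by simp only [e]; abel
    refine Finset.sum_congr rfl fun i _ => ?_
    rw [Finset.sum_comm]
    exact Finset.sum_congr rfl fun j _ => Finset.sum_congr rfl fun k _ => by rw [this i j k]
  have hsum : ∑ i, ∑ j, ∑ k, (if e (i, j, k) = e p then L (e p) else 0) = 0 := by
    have : ∀ i j k, (if e (i, j, k) = e p then L (e p) else 0) =
        (if e (i, j, k) = e p then a i else 0) + (if e (i, j, k) = e p then a j else 0) +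
          (if e (i, j, k) = e p then a k else 0) := by
      intro i j k
      split_ifs with h
      · rw [← h, hLe]
      · simp
    simp only [this, Finset.sum_add_distrib]
    rw [← hfst, ← hsnd, ← hthd, hp]
    simp
  rw [← hLe p]
  by_contra hne
  have hone : ∑ i, ∑ j, ∑ k, (if e (i, j, k) = e p then (1 : ℝ) else 0) = 0 := by
    refine (mul_eq_zero.1 ?_).resolve_right hne
    simpa only [Finset.sum_mul, ite_mul, one_mul, zero_mul] using hsum
  have hnn : ∀ i j k, (0 : ℝ) ≤ if e (i, j, k) = e p then (1 : ℝ) else 0 := fun i j k => by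
    split_ifs <;> norm_num
  have hone_fst := (Finset.sum_eq_zero_iff_of_nonneg fun i _ => Finset.sum_nonneg fun j _ =>
    Finset.sum_nonneg fun k _ => hnn i j k).1 hone p.1 (Finset.mem_univ _)
  have hone_snd := (Finset.sum_eq_zero_iff_of_nonneg fun j _ =>
    Finset.sum_nonneg fun k _ => hnn p.1 j k).1 hone_fst p.2.1 (Finset.mem_univ _)
  have hone_thd := (Finset.sum_eq_zero_iff_of_nonneg fun k _ => hnn p.1 p.2.1 k).1 hone_snd p.2.2
    (Finset.mem_univ _)
  simp at hone_thd

/-- Lemma 3.2: for `n ≥ 2` and `a ∈ ℝ^n` with at least two negative components, the number of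
degree-3 monomials with zero coefficient in `(a_1x_1 + ⋯ + a_nx_n)·S_n²` is at most
`C(n+1,3) − n·N(a) + n + c(n)`. -/
theorem stmt8 (n : ℕ) (hn : 2 ≤ n) (a : Fin n → ℝ)
    (N : ℕ) (hN : N = (Finset.univ.filter fun i : Fin n => a i < 0).card)
    (hN2 : 2 ≤ N)
    (Q : MvPolynomial (Fin n) ℝ)
    (hQ : Q = (∑ i, C (a i) * X i) * (∑ i, X i) ^ 2)
    (D3 : Finset (Fin n →₀ ℕ))
    (hD3 : D3 = (Finset.univ : Finset (Fin n × Fin n × Fin n)).image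
      fun p => Finsupp.single p.1 1 + Finsupp.single p.2.1 1 + Finsupp.single p.2.2 1) :
    ((D3.filter fun m => coeff m Q = 0).card : ℤ) ≤
      ((n + 1).choose 3 : ℤ) - n * N + n + cseq n := by
  have hle : (D3.filter fun m => coeff m Q = 0).card ≤
      (((Finset.univ : Finset (Fin n)).sym 3).filter fun m : Sym (Fin n) 3 =>
        ¬ ((m : Multiset (Fin n)).map a).sum ≠ 0).card := by
    refine (Finset.card_le_card ?_).trans
      (Finset.card_image_le (f := fun m : Sym (Fin n) 3 => Multiset.toFinsupp (m : Multiset (Fin n))))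
    intro m hm
    rw [Finset.mem_filter, hD3, Finset.mem_image] at hm
    obtain ⟨⟨p, -, rfl⟩, hm⟩ := hm
    refine Finset.mem_image.2 ⟨consPair p.1 s(p.2.1, p.2.2), Finset.mem_filter.2 ⟨?_, ?_⟩, ?_⟩
    · exact Finset.mem_sym_iff.2 fun x _ => Finset.mem_univ x
    · rw [coe_consPair, not_not]
      simpa [add_assoc] using sum_eq_zero_of_coeff_eq_zero a hQ p hm
    · simp only [coe_consPair, ← Multiset.singleton_add, map_add, Multiset.toFinsupp_singleton,
        add_assoc]
  have hsplit := Finset.card_filter_add_card_filter_not (s := (Finset.univ : Finset (Fin n)).sym 3)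
    fun m => ((m : Multiset (Fin n)).map a).sum ≠ 0
  have hsym : ((Finset.univ : Finset (Fin n)).sym 3).card = (n + 2).choose 3 := by
    rw [Finset.sym_univ, Finset.card_univ, Sym.card_sym_eq_choose, Fintype.card_fin]
    rfl
  have hpascal : (n + 2).choose 3 = (n + 1).choose 2 + (n + 1).choose 3 := Nat.choose_succ_succ _ _
  have htwo := two_mul_succ_choose_two n
  have hbound := tripleBound_le_card_nonzeroTriples a n Finset.univ (by simp) (hN ▸ hN2)
  rw [← hN] at hbound
  unfold tripleBound at hbound
  rw [hsym, hpascal] at hsplit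
  change (nonzeroTriples a Finset.univ).card + _ = _ at hsplit
  zify at hle hsplit htwo
  linarith
end

section
/- In four variables, the quadratic polynomial A = x_1² + x_2² + x_3² + x_4² − x_1x_2 − x_1x_3 + 2x_1x_4 + 2x_2x_3 − x_2x_4 − x_3x_4 has a negative coefficient, the product A·(x_1+x_2+x_3+x_4) = x_1³ + x_2³ + x_3³ + x_4³ + 3x_1²x_4 + 3x_2²x_3 + 3x_2x_3² + 3x_1x_4² is coefficientwise nonnegative, and |supp(A·(x_1+x_2+x_3+x_4))| = 8 = 3·4 − 4. Hence the lower bound 3n − 4 of Theorem 1.3(A) is attained for n = 4, d = 2. -/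
open MvPolynomial

/-- A finite sum of terms `c v * x ^ v`, indexed by exponent vectors written as functions. -/
noncomputable def sumTerms {σ R : Type*} [Fintype σ] [CommSemiring R] (t : Finset (σ → ℕ))
    (c : (σ → ℕ) → R) : MvPolynomial σ R :=
  ∑ v ∈ t, C (c v) * ∏ i, X i ^ v i

theorem coeff_sumTerms {σ R : Type*} [Fintype σ] [DecidableEq σ] [CommSemiring R]
    (t : Finset (σ → ℕ)) (c : (σ → ℕ) → R) (m : σ →₀ ℕ) :
    coeff m (sumTerms t c) = if ⇑m ∈ t then c m else 0 := by
  have key (v : σ → ℕ) : coeff m (C (c v) * ∏ i, X i ^ v i) = if v = m then c v else 0 := by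
    have hv : C (c v) * ∏ i, X i ^ v i = monomial (Finsupp.equivFunOnFinite.symm v) (c v) := by
      rw [monomial_eq, Finsupp.prod_fintype _ _ fun _ => pow_zero _]
      simp
    rw [hv, coeff_monomial]
    simp only [Equiv.symm_apply_eq]
    rfl
  simp [sumTerms, coeff_sum, key]

theorem card_support_sumTerms {σ R : Type*} [Fintype σ] [DecidableEq σ] [CommSemiring R]
    (t : Finset (σ → ℕ)) (c : (σ → ℕ) → R) (hc : ∀ v ∈ t, c v ≠ 0) :
    (sumTerms t c).support.card = t.card := by
  have hs : (sumTerms t c).support = t.map Finsupp.equivFunOnFinite.symm.toEmbedding := by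
    ext m
    rw [mem_support_iff, coeff_sumTerms, Finset.mem_map_equiv, Equiv.symm_symm]
    change _ ↔ ⇑m ∈ t
    by_cases h : ⇑m ∈ t
    · simp [h, hc _ h]
    · simp [h]
  rw [hs, Finset.card_map]

/-- Sharpness of the bound `3n − 4` for `n = 4`, `d = 2`: the quadratic
`A = x_1² + x_2² + x_3² + x_4² − x_1x_2 − x_1x_3 + 2x_1x_4 + 2x_2x_3 − x_2x_4 − x_3x_4` has a
negative coefficient, its first prolongation
`A·(x_1+x_2+x_3+x_4) = x_1³ + x_2³ + x_3³ + x_4³ + 3x_1²x_4 + 3x_2²x_3 + 3x_2x_3² + 3x_1x_4²`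
has nonnegative coefficients, and has exactly `8 = 3·4 − 4` monomials. -/
theorem stmt13 :
    let A : MvPolynomial (Fin 4) ℝ :=
      X 0 ^ 2 + X 1 ^ 2 + X 2 ^ 2 + X 3 ^ 2 - X 0 * X 1 - X 0 * X 2 + 2 * X 0 * X 3
        + 2 * X 1 * X 2 - X 1 * X 3 - X 2 * X 3
    let S : MvPolynomial (Fin 4) ℝ := X 0 + X 1 + X 2 + X 3
    (∃ m, coeff m A < 0) ∧
    A * S = X 0 ^ 3 + X 1 ^ 3 + X 2 ^ 3 + X 3 ^ 3 + 3 * X 0 ^ 2 * X 3 + 3 * X 1 ^ 2 * X 2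
      + 3 * X 1 * X 2 ^ 2 + 3 * X 0 * X 3 ^ 2 ∧
    (∀ m, 0 ≤ coeff m (A * S)) ∧
    (A * S).support.card = 8 ∧ 8 = 3 * 4 - 4 := by
  intro A S
  have h2 : (C 2 : MvPolynomial (Fin 4) ℝ) = 2 := map_ofNat C 2
  have h3 : (C 3 : MvPolynomial (Fin 4) ℝ) = 3 := map_ofNat C 3
  have hA : A = sumTerms {![2, 0, 0, 0], ![0, 2, 0, 0], ![0, 0, 2, 0], ![0, 0, 0, 2],
      ![1, 1, 0, 0], ![1, 0, 1, 0], ![1, 0, 0, 1], ![0, 1, 1, 0], ![0, 1, 0, 1], ![0, 0, 1, 1]}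
      (fun v => if v 0 + v 3 = 1 then -1 else if ∃ i, v i = 2 then 1 else 2) := by
    simp [A, sumTerms, Fin.prod_univ_four, Fin.exists_fin_succ, h2]
    ring
  have hAS : A * S = X 0 ^ 3 + X 1 ^ 3 + X 2 ^ 3 + X 3 ^ 3 + 3 * X 0 ^ 2 * X 3
      + 3 * X 1 ^ 2 * X 2 + 3 * X 1 * X 2 ^ 2 + 3 * X 0 * X 3 ^ 2 := by
    simp only [A, S]
    ring
  have hAS' : A * S = sumTerms {![3, 0, 0, 0], ![0, 3, 0, 0], ![0, 0, 3, 0], ![0, 0, 0, 3],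
      ![2, 0, 0, 1], ![0, 2, 1, 0], ![0, 1, 2, 0], ![1, 0, 0, 2]}
      (fun v => if ∃ i, v i = 3 then 1 else 3) := by
    rw [hAS]
    simp [sumTerms, Fin.prod_univ_four, Fin.exists_fin_succ, h3]
    ring
  refine ⟨⟨Finsupp.equivFunOnFinite.symm ![1, 1, 0, 0], ?_⟩, hAS, fun m => ?_, ?_, by norm_num⟩
  · rw [hA, coeff_sumTerms]
    simp
  · rw [hAS', coeff_sumTerms]
    split_ifs <;> norm_num
  · rw [hAS', card_support_sumTerms]
    · decide
    · intro v _
      split_ifs <;> norm_num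
end

section
/- Let n ≥ 2 and d ≥ 2, let a, b be integers with 0 ≤ a < b ≤ d, let α, β ∈ ℕ^n be exponent vectors with |α| = a and |β| = b, and let c > 0 and λ > 0 be real numbers. If the homogeneous polynomial F = (−1)^{d−a}·c·x^α·S_n^{d−a+1} + (−1)^{d−b}·λ·x^β·S_n^{d−b+1} of degree d+1 is coefficientwise nonnegative, then |supp(F)| ≥ C(n+2,3) − 1. -/
open MvPolynomial

/-- Exponent vectors `μ ≥ γ` at which `∏ i, μ i ! / (μ i - γ i)!` cannot be increased by lowering
one coordinate and raising another one by one. -/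
def IsBalanced {n : ℕ} (γ μ : Fin n →₀ ℕ) : Prop :=
  γ ≤ μ ∧ ∀ i k, γ i * (μ k - γ k) ≤ γ k * (μ i - γ i + 1)

lemma mem_finsuppAntidiag_univ_iff_degree {n m : ℕ} {μ : Fin n →₀ ℕ} :
    μ ∈ Finset.univ.finsuppAntidiag m ↔ μ.degree = m := by
  simp [Finset.mem_finsuppAntidiag, Finsupp.degree_eq_sum]

/-- Transfer of the whole `k`-th coordinate onto the `i`-th one. -/
noncomputable def transfer {n : ℕ} (i k : Fin n) (μ : Fin n →₀ ℕ) : Fin n →₀ ℕ :=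
  μ.erase k + Finsupp.single i (μ k)

section transfer

variable {n : ℕ} {i k : Fin n} (μ : Fin n →₀ ℕ)

lemma degree_transfer : (transfer i k μ).degree = μ.degree := by
  conv_rhs => rw [← Finsupp.erase_add_single k μ]
  simp [transfer, map_add, Finsupp.degree_single]

lemma transfer_apply_source (h : i ≠ k) : transfer i k μ k = 0 := by
  simp [transfer, Finsupp.single_eq_of_ne' h]

lemma transfer_apply_target (h : i ≠ k) : transfer i k μ i = μ i + μ k := by
  simp [transfer, Finsupp.erase_ne h]

lemma transfer_apply_of_ne {l : Fin n} (hi : l ≠ i) (hk : l ≠ k) : transfer i k μ l = μ l := by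
  simp [transfer, Finsupp.erase_ne hk, Finsupp.single_eq_of_ne hi]

end transfer

lemma le_add_one_of_mul_le {x y s t s' t' : ℕ} (hx : 0 < x) (h1 : y * s ≤ x * (t + 1))
    (h2 : x * t' ≤ y * (s' + 1)) (hst : s + t = s' + t') : t' ≤ t + 1 := by
  by_contra! h
  obtain ⟨u, rfl⟩ : ∃ u, t' = t + 2 + u := ⟨t' - (t + 2), by omega⟩
  obtain rfl : s = s' + 2 + u := by omega
  nlinarith [Nat.zero_le (x * u), Nat.zero_le (y * u)]

lemma IsBalanced.le_add_one {n : ℕ} {γ μ μ' : Fin n →₀ ℕ} (h : IsBalanced γ μ) (h' : IsBalanced γ μ')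
    {j k : Fin n} (hj : 0 < γ j) (hs : μ j + μ k = μ' j + μ' k) : μ' k ≤ μ k + 1 := by
  have a1 := h.1 j
  have a2 := h.1 k
  have a3 := h'.1 j
  have a4 := h'.1 k
  have := le_add_one_of_mul_le hj (h.2 k j) (h'.2 j k) (by omega)
  omega

open Classical in
/-- At most half of the exponent vectors of a given degree are balanced. -/
lemma two_mul_card_filter_isBalanced_le {n m : ℕ} (γ : Fin n →₀ ℕ) {j k : Fin n} (hjk : j ≠ k)
    (hj : 0 < γ j) :
    2 * ((Finset.univ.finsuppAntidiag m).filter (IsBalanced γ)).card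
      ≤ ((Finset.univ : Finset (Fin n)).finsuppAntidiag m).card := by
  set T := (Finset.univ : Finset (Fin n)).finsuppAntidiag m with hT
  have key : (T.filter (IsBalanced γ)).card ≤ (T.filter (fun μ => ¬ IsBalanced γ μ)).card := by
    refine Finset.card_le_card_of_injOn
      (fun μ => if Even (μ k - γ k) then transfer k j μ else transfer j k μ) ?_ ?_
    · intro μ hμ
      simp only [Finset.coe_filter, Set.mem_ofPred_eq, hT, mem_finsuppAntidiag_univ_iff_degree]
        at hμ ⊢
      obtain ⟨hd, hb⟩ := hμ
      split_ifs with hp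
      · refine ⟨by rw [degree_transfer, hd], fun hb' => ?_⟩
        have := hb'.1 j
        rw [transfer_apply_source μ hjk.symm] at this
        omega
      · refine ⟨by rw [degree_transfer, hd], fun hb' => ?_⟩
        have h0 := hb'.1 k
        rw [transfer_apply_source μ hjk] at h0
        have h1 := hb.2 j k
        have h2 : γ k = 0 := by omega
        rw [h2, zero_mul, Nat.le_zero, mul_eq_zero] at h1
        refine hp ?_
        rw [h2]
        rcases h1 with h1 | h1
        · omega
        · rw [h1]; exact Even.zero
    · intro μ hμ μ' hμ' he
      simp only [Finset.coe_filter, Set.mem_ofPred_eq] at hμ hμ'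
      have hb := hμ.2
      have hb' := hμ'.2
      have p1 := hb.1 j
      have p2 := hb.1 k
      have p3 := hb'.1 j
      have p4 := hb'.1 k
      have finish : μ j + μ k = μ' j + μ' k → (Even (μ k - γ k) ↔ Even (μ' k - γ k)) →
          (∀ l, l ≠ j → l ≠ k → μ l = μ' l) → μ = μ' := by
        intro hs hpar hl
        have e1 := hb.le_add_one hb' hj hs
        have e2 := hb'.le_add_one hb hj hs.symm
        have e3 : μ k = μ' k := by
          rw [Nat.even_iff, Nat.even_iff] at hpar
          omega
        ext l
        by_cases h1 : l = j
        · subst h1; omega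
        by_cases h2 : l = k
        · subst h2; exact e3
        exact hl l h1 h2
      have hval := fun l => DFunLike.congr_fun he l
      have vj := hval j
      have vk := hval k
      by_cases q1 : Even (μ k - γ k) <;> by_cases q2 : Even (μ' k - γ k) <;>
        simp only [q1, q2, if_true, if_false] at vj vk hval <;>
        simp only [transfer_apply_source _ hjk, transfer_apply_source _ hjk.symm,
          transfer_apply_target _ hjk, transfer_apply_target _ hjk.symm] at vj vk
      · refine finish (by omega) (by simp [q1, q2]) fun l h1 h2 => ?_
        have := hval l
        rwa [transfer_apply_of_ne _ h2 h1, transfer_apply_of_ne _ h2 h1] at this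
      · omega
      · omega
      · refine finish (by omega) (by simp [q1, q2]) fun l h1 h2 => ?_
        have := hval l
        rwa [transfer_apply_of_ne _ h1 h2, transfer_apply_of_ne _ h1 h2] at this
  have := Finset.card_filter_add_card_filter_not (s := T) (IsBalanced γ)
  omega

open Classical in
lemma card_filter_isBalanced_le_one_of_degree_eq_one {n m : ℕ} {γ : Fin n →₀ ℕ}
    (hγ : γ.degree = 1) :
    (((Finset.univ : Finset (Fin n)).finsuppAntidiag m).filter (IsBalanced γ)).card ≤ 1 := by
  obtain ⟨j, rfl⟩ : ∃ j, γ = Finsupp.single j 1 := (Finsupp.sum_eq_one_iff γ).1 hγ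
  have hz : ∀ μ, IsBalanced (Finsupp.single j 1) μ → ∀ k, k ≠ j → μ k = 0 := by
    intro μ h k hk
    have := h.2 j k
    simpa [Finsupp.single_eq_of_ne hk] using this
  rw [Finset.card_le_one]
  intro μ hμ μ' hμ'
  simp only [Finset.mem_filter, mem_finsuppAntidiag_univ_iff_degree] at hμ hμ'
  have hval : ∀ μ, IsBalanced (Finsupp.single j 1) μ → μ.degree = μ j := by
    intro μ h
    rw [Finsupp.degree_eq_sum]
    exact Finset.sum_eq_single j (fun k _ hk => hz μ h k hk) (by simp)
  ext k
  by_cases hk : k = j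
  · subst hk
    rw [← hval μ hμ.2, ← hval μ' hμ'.2, hμ.1, hμ'.1]
  · rw [hz μ hμ.2 k hk, hz μ' hμ'.2 k hk]

lemma prod_factorial_add_single {n : ℕ} (κ : Fin n →₀ ℕ) (k : Fin n) :
    ∏ i, ((κ + Finsupp.single k 1 : Fin n →₀ ℕ) i).factorial = (κ k + 1) * ∏ i, (κ i).factorial := by
  rw [← Finset.mul_prod_erase _ _ (Finset.mem_univ k),
    ← Finset.mul_prod_erase Finset.univ (fun i => (κ i).factorial) (Finset.mem_univ k), ← mul_assoc]
  congr 1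
  · simp [Nat.factorial_succ]
  · refine Finset.prod_congr rfl fun i hi => ?_
    simp [Finsupp.single_eq_of_ne (Finset.ne_of_mem_erase hi)]

lemma isBalanced_add_of_eq {n r : ℕ} {γ ν : Fin n →₀ ℕ} {u v : ℝ} (hv : 0 < v)
    (hle : ∀ ν' : Fin n →₀ ℕ, ν'.degree = r →
      v * (∏ i, ((ν' + γ : Fin n →₀ ℕ) i).factorial : ℕ) ≤ u * (∏ i, (ν' i).factorial : ℕ))
    (hν : ν.degree = r)
    (heq : v * (∏ i, ((ν + γ : Fin n →₀ ℕ) i).factorial : ℕ) = u * (∏ i, (ν i).factorial : ℕ)) :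
    IsBalanced γ (ν + γ) := by
  refine ⟨le_add_self, fun j k => ?_⟩
  rcases Nat.eq_zero_or_pos (ν k) with h0 | h0
  · simp [h0]
  by_cases hjk : j = k
  · subst hjk; gcongr; omega
  obtain ⟨κ, rfl⟩ : ∃ κ, ν = κ + Finsupp.single k 1 :=
    ⟨ν - Finsupp.single k 1, (tsub_add_cancel_of_le (by simpa [Nat.one_le_iff_ne_zero, Nat.pos_iff_ne_zero] using h0)).symm⟩
  have h1 := hle (κ + Finsupp.single j 1) (by rw [← hν]; simp [map_add, Finsupp.degree_single])
  rw [add_right_comm, prod_factorial_add_single, prod_factorial_add_single] at h1 heq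
  have hA : 0 < ∏ i, ((κ + γ : Fin n →₀ ℕ) i).factorial :=
    Finset.prod_pos fun i _ => Nat.factorial_pos _
  generalize ∏ i, ((κ + γ : Fin n →₀ ℕ) i).factorial = A at h1 heq hA
  generalize ∏ i, (κ i).factorial = B at h1 heq
  simp only [Finsupp.add_apply, Nat.cast_mul, Nat.cast_add, Nat.cast_one] at h1 heq
  have h2 : v * A * (((κ j + γ j + 1) * (κ k + 1) : ℕ) : ℝ)
      ≤ v * A * (((κ k + γ k + 1) * (κ j + 1) : ℕ) : ℝ) := by
    push_cast
    have e1 := mul_le_mul_of_nonneg_right h1 (by positivity : (0 : ℝ) ≤ κ k + 1)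
    have e2 := congrArg (· * ((κ j : ℝ) + 1)) heq
    linarith
  have h3 := le_of_mul_le_mul_left h2 (by positivity)
  have h4 : (κ j + γ j + 1) * (κ k + 1) ≤ (κ k + γ k + 1) * (κ j + 1) := by exact_mod_cast h3
  simp [Finsupp.single_eq_of_ne hjk]
  nlinarith

lemma coeff_sum_X_pow_mul_prod_factorial {n k : ℕ} {μ : Fin n →₀ ℕ} (hμ : μ.degree = k) :
    coeff μ ((∑ i, X i : MvPolynomial (Fin n) ℝ) ^ k) * (∏ i, (μ i).factorial : ℕ)
      = k.factorial := by
  have hs : μ.sum (fun _ m => m) = k := by rw [← hμ]; rfl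
  rw [coeff_sum_X_pow_of_fintype, if_pos hs,
    Finsupp.multinomial_eq_of_support_subset (Finset.subset_univ _), mul_comm]
  have := Nat.multinomial_spec Finset.univ μ
  rw [← Finsupp.degree_eq_sum, hμ] at this
  exact_mod_cast this

lemma coeff_sum_X_pow_pos {n k : ℕ} {μ : Fin n →₀ ℕ} (hμ : μ.degree = k) :
    0 < coeff μ ((∑ i, X i : MvPolynomial (Fin n) ℝ) ^ k) := by
  have h := coeff_sum_X_pow_mul_prod_factorial hμ
  refine pos_of_mul_pos_left (b := ((∏ i, (μ i).factorial : ℕ) : ℝ)) ?_ (Nat.cast_nonneg _)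
  rw [h]
  exact_mod_cast k.factorial_pos

lemma coeff_sum_X_pow_nonneg {n : ℕ} (k : ℕ) (μ : Fin n →₀ ℕ) :
    0 ≤ coeff μ ((∑ i, X i : MvPolynomial (Fin n) ℝ) ^ k) := by
  rw [coeff_sum_X_pow_of_fintype]
  split_ifs <;> simp

lemma coeff_C_mul_monomial_mul {n : ℕ} (u : ℝ) (α M : Fin n →₀ ℕ) (P : MvPolynomial (Fin n) ℝ) :
    coeff M (C u * monomial α 1 * P) = if α ≤ M then u * coeff (M - α) P else 0 := by
  rw [C_mul_monomial, mul_one, coeff_monomial_mul']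

/-- A negative multiple of `x^β S^l` can only be compensated by a multiple of `x^α S^k` if
`x^α` divides `x^β`. -/
lemma le_of_coeff_nonneg {n k l : ℕ} (hn : 2 ≤ n) {α β : Fin n →₀ ℕ} {u v : ℝ} (hv : v < 0)
    (h : ∀ M, 0 ≤ coeff M (C u * monomial α 1 * (∑ i, X i : MvPolynomial (Fin n) ℝ) ^ k
      + C v * monomial β 1 * (∑ i, X i) ^ l)) : α ≤ β := by
  intro i
  have : Nontrivial (Fin n) := Fin.nontrivial_iff_two_le.2 hn
  obtain ⟨j, hj⟩ := exists_ne i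
  have h1 := h (β + Finsupp.single j l)
  rw [coeff_add, coeff_C_mul_monomial_mul, coeff_C_mul_monomial_mul, if_pos le_self_add,
    add_tsub_cancel_left] at h1
  have h2 : 0 < coeff (Finsupp.single j l) ((∑ i, X i : MvPolynomial (Fin n) ℝ) ^ l) :=
    coeff_sum_X_pow_pos (Finsupp.degree_single _ _)
  split_ifs at h1 with hle
  · simpa [Finsupp.single_eq_of_ne hj.symm] using hle i
  · nlinarith

lemma two_mul_choose_three_le {n : ℕ} (hn : 2 ≤ n) :
    2 * ((n + 2).choose 3 - 1) ≤ (n + 4).choose 5 := by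
  have h1 := Nat.add_one_mul_choose_eq (n + 3) 4
  have h2 := Nat.add_one_mul_choose_eq (n + 2) 3
  simp only [Nat.add_assoc, Nat.reduceAdd] at h1 h2
  rcases Nat.lt_or_ge n 4 with h | h
  · interval_cases n <;> decide
  · nlinarith [Nat.sub_le ((n + 2).choose 3) 1]

lemma choose_add_le_choose_add {n p m : ℕ} (hn : 2 ≤ n) (h : p ≤ m) :
    (n + p - 1).choose p ≤ (n + m - 1).choose m := by
  rw [← Nat.choose_symm_of_eq_add (show n + p - 1 = (n - 1) + p by omega),
    ← Nat.choose_symm_of_eq_add (show n + m - 1 = (n - 1) + m by omega)]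
  exact Nat.choose_le_choose _ (by omega)

open Classical in
/-- Among the exponent vectors of degree `m` there are many that are not balanced. -/
lemma choose_le_card_filter_not_isBalanced {n m r : ℕ} (hn : 2 ≤ n) (γ : Fin n →₀ ℕ)
    (hr : 2 ≤ r) (hγ : Odd γ.degree) (hm : γ.degree + r = m) (hmo : Odd m) :
    (n + 2).choose 3 - 1
      ≤ (((Finset.univ : Finset (Fin n)).finsuppAntidiag m).filter
          (fun μ => ¬ IsBalanced γ μ)).card := by
  have hsum := Finset.card_filter_add_card_filter_not
    (s := (Finset.univ : Finset (Fin n)).finsuppAntidiag m) (IsBalanced γ)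
  have hT := Finset.card_finsuppAntidiag_nat_eq_choose (s := (Finset.univ : Finset (Fin n))) m
  rw [Finset.card_univ, Fintype.card_fin] at hT
  have hγ0 := hγ.pos
  rcases Nat.lt_or_ge m 5 with h | h
  · have hm3 : m = 3 := by
      rw [Nat.odd_iff] at hmo
      omega
    subst hm3
    have := card_filter_isBalanced_le_one_of_degree_eq_one (m := 3) (γ := γ) (by omega)
    rw [show n + 3 - 1 = n + 2 by omega] at hT
    omega
  · obtain ⟨j, hj⟩ : ∃ j, γ j ≠ 0 := by
      by_contra! h0
      have : γ = 0 := Finsupp.ext h0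
      simp [this] at hγ0
    have : Nontrivial (Fin n) := Fin.nontrivial_iff_two_le.2 hn
    obtain ⟨k, hk⟩ := exists_ne j
    have h1 := two_mul_card_filter_isBalanced_le (m := m) γ hk.symm (Nat.pos_of_ne_zero hj)
    have h2 := choose_add_le_choose_add hn h
    have h3 := two_mul_choose_three_le hn
    rw [show n + 5 - 1 = n + 4 by omega] at h2
    omega

lemma card_le_card_support_of_add_mem {n : ℕ} {F : MvPolynomial (Fin n) ℝ} (α : Fin n →₀ ℕ)
    {s : Finset (Fin n →₀ ℕ)} (h : ∀ μ ∈ s, coeff (α + μ) F ≠ 0) : s.card ≤ F.support.card :=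
  Finset.card_le_card_of_injOn (α + ·) (fun μ hμ => mem_support_iff.2 (h μ hμ))
    (add_right_injective α).injOn

/-- Lemma 5.3: if the polynomial
`F = (−1)^{d−a}·c·x^α·S_n^{d−a+1} + (−1)^{d−b}·λ·x^β·S_n^{d−b+1}` (with `0 ≤ a < b ≤ d`,
`|α| = a`, `|β| = b`, `c, λ > 0`) has nonnegative coefficients, then
`|supp(F)| ≥ C(n+2,3) − 1`. -/
theorem stmt16 (n d a b : ℕ) (hn : 2 ≤ n) (hd : 2 ≤ d)
    (hab : a < b) (hbd : b ≤ d)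
    (α β : Fin n →₀ ℕ) (hα : (∑ i, α i) = a) (hβ : (∑ i, β i) = b)
    (c lam : ℝ) (hc : 0 < c) (hlam : 0 < lam)
    (S : MvPolynomial (Fin n) ℝ) (hS : S = ∑ i, X i)
    (F : MvPolynomial (Fin n) ℝ)
    (hF : F = C ((-1) ^ (d - a) * c) * monomial α 1 * S ^ (d - a + 1)
            + C ((-1) ^ (d - b) * lam) * monomial β 1 * S ^ (d - b + 1))
    (hpos : ∀ m, 0 ≤ coeff m F) :
    (n + 2).choose 3 - 1 ≤ F.support.card := by
  classical
  rw [← Finsupp.degree_eq_sum] at hα hβ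
  subst hS
  rcases Nat.even_or_odd (d - a) with hp | hp
  swap
  · have hle : β ≤ α := by
      refine le_of_coeff_nonneg (k := d - b + 1) (l := d - a + 1) (u := (-1) ^ (d - b) * lam)
        (v := (-1) ^ (d - a) * c) hn (by rw [hp.neg_one_pow]; linarith) fun M => ?_
      rw [add_comm, ← hF]
      exact hpos M
    have := Finsupp.degree_mono hle
    omega
  rw [hp.neg_one_pow, one_mul] at hF
  rcases Nat.even_or_odd (d - b) with hq | hq
  · rw [hq.neg_one_pow, one_mul] at hF
    have h1 : ((Finset.univ : Finset (Fin n)).finsuppAntidiag (d - a + 1)).card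
        ≤ F.support.card := by
      refine card_le_card_support_of_add_mem α fun μ hμ => ne_of_gt ?_
      rw [mem_finsuppAntidiag_univ_iff_degree] at hμ
      rw [hF, coeff_add, coeff_C_mul_monomial_mul, coeff_C_mul_monomial_mul, if_pos le_self_add,
        add_tsub_cancel_left]
      refine add_pos_of_pos_of_nonneg (mul_pos hc (coeff_sum_X_pow_pos hμ)) ?_
      split_ifs
      · exact mul_nonneg hlam.le (coeff_sum_X_pow_nonneg _ _)
      · exact le_rfl
    rw [Finset.card_finsuppAntidiag_nat_eq_choose, Finset.card_univ, Fintype.card_fin] at h1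
    rw [Nat.even_iff] at hp hq
    have h2 := choose_add_le_choose_add hn (show 3 ≤ d - a + 1 by omega)
    rw [show n + 3 - 1 = n + 2 by omega] at h2
    omega
  rw [hq.neg_one_pow, neg_one_mul] at hF
  have hle : α ≤ β := le_of_coeff_nonneg hn (neg_neg_of_pos hlam) (hF ▸ hpos)
  obtain ⟨γ, rfl⟩ := exists_add_of_le hle
  rw [map_add, hα] at hβ
  have hcoeff : ∀ ν : Fin n →₀ ℕ, coeff (α + (ν + γ)) F
      = c * coeff (ν + γ) ((∑ i, X i) ^ (d - a + 1)) - lam * coeff ν ((∑ i, X i) ^ (d - b + 1)) := by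
    intro ν
    rw [hF, coeff_add, coeff_C_mul_monomial_mul, coeff_C_mul_monomial_mul, if_pos le_self_add,
      add_tsub_cancel_left, if_pos (by gcongr; exact le_add_self), add_tsub_add_eq_tsub_left,
      add_tsub_cancel_right]
    ring
  have hscaled : ∀ ν : Fin n →₀ ℕ, ν.degree = d - b + 1 →
      coeff (α + (ν + γ)) F *
        ((∏ i, ((ν + γ : Fin n →₀ ℕ) i).factorial : ℕ) * (∏ i, (ν i).factorial : ℕ))
      = c * (d - a + 1).factorial * (∏ i, (ν i).factorial : ℕ)
        - lam * (d - b + 1).factorial * (∏ i, ((ν + γ : Fin n →₀ ℕ) i).factorial : ℕ) := by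
    intro ν hν
    rw [hcoeff, ← coeff_sum_X_pow_mul_prod_factorial hν,
      ← coeff_sum_X_pow_mul_prod_factorial (μ := ν + γ) (k := d - a + 1)
        (by rw [map_add, hν]; omega)]
    ring
  refine (choose_le_card_filter_not_isBalanced (m := d - a + 1) (r := d - b + 1) hn γ ?_ ?_ ?_
    hp.add_one).trans (card_le_card_support_of_add_mem α fun μ hμ h0 => ?_)
  · have := hq.pos
    omega
  · rw [Nat.odd_iff] at hq ⊢
    rw [Nat.even_iff] at hp
    omega
  · omega
  rw [Finset.mem_filter, mem_finsuppAntidiag_univ_iff_degree] at hμ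
  obtain ⟨hμ, hb⟩ := hμ
  have hγμ : γ ≤ μ := by
    by_contra hγμ
    rw [hF, coeff_add, coeff_C_mul_monomial_mul, coeff_C_mul_monomial_mul, if_pos le_self_add,
      add_tsub_cancel_left, if_neg (by rwa [add_le_add_iff_left]), add_zero] at h0
    exact (mul_pos hc (coeff_sum_X_pow_pos hμ)).ne' h0
  obtain ⟨ν, rfl⟩ := exists_add_of_le hγμ
  rw [add_comm γ ν] at h0 hb hμ
  rw [map_add] at hμ
  refine hb (isBalanced_add_of_eq (r := d - b + 1) (u := c * (d - a + 1).factorial)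
    (v := lam * (d - b + 1).factorial) (by positivity) (fun ν' hν' => ?_) (by omega) ?_)
  · rw [← sub_nonneg, ← hscaled ν' hν']
    exact mul_nonneg (hpos _) (by positivity)
  · have := hscaled ν (by omega)
    rw [h0, zero_mul] at this
    linarith
end
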